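/- arXiv:1710.08509 — 10 statements merged into one kernel-verified Lean document; each statement's English description precedes it below -/
import Mathlib

section
/- Let k = k(n) be a sequence of positive integers with k(n) = n^{o(1)}, i.e. log k(n)/log n → 0 as n → ∞. Then the number m(n,k) of maximal families in the power set of [n] of VC dimension k satisfies m(n,k) = n^{(1+o(1))·C(n,k)}; that is, for every ε > 0 there exists N such that for all n ≥ N, n^{(1-ε)·C(n,k(n))} ≤ m(n, k(n)) ≤ n^{(1+ε)·C(n,k(n))}. -/
/-- `F` shatters `S` if every subset of `S` is the trace of a member of `F` on `S`. -/
def Shatters {n : ℕ} (F : Finset (Finset (Fin n))) (S : Finset (Fin n)) : Prop :=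
  ∀ A ⊆ S, ∃ B ∈ F, B ∩ S = A

/-- The VC dimension of `F`: the maximum size of a set shattered by `F`. -/
noncomputable def vcDim {n : ℕ} (F : Finset (Finset (Fin n))) : ℕ :=
  sSup {d : ℕ | ∃ S : Finset (Fin n), Shatters F S ∧ S.card = d}

/-- A family is maximal if its size attains the Sauer–Shelah bound for its VC dimension. -/
def IsMaximal {n : ℕ} (F : Finset (Finset (Fin n))) : Prop :=
  F.card = ∑ i ∈ Finset.range (vcDim F + 1), n.choose i

/-- `m(n,k)`: the number of maximal families in the power set of `[n]` of VC dimension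
exactly `k`. -/
noncomputable def maxFamCount (n k : ℕ) : ℕ :=
  Nat.card {F : Finset (Finset (Fin n)) // IsMaximal F ∧ vcDim F = k}


namespace MF
open Finset hiding Shatters vcDim

variable {n : ℕ}

lemma shatters_iff (F : Finset (Finset (Fin n))) (S : Finset (Fin n)) :
    Shatters F S ↔ F.Shatters S := by
  unfold Shatters Finset.Shatters
  simp only [Finset.inter_comm]

lemma vcDim_eq (F : Finset (Finset (Fin n))) : vcDim F = F.vcDim := by
  unfold vcDim Finset.vcDim
  apply le_antisymm
  · by_cases h : {d : ℕ | ∃ S : Finset (Fin n), Shatters F S ∧ S.card = d}.Nonempty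
    · apply csSup_le h
      rintro d ⟨S, hS, rfl⟩
      exact Finset.le_sup (f := Finset.card) (mem_shatterer.2 ((shatters_iff F S).1 hS))
    · rw [Set.not_nonempty_iff_eq_empty.1 h]; simp
  · apply Finset.sup_le
    intro S hS
    apply le_csSup
    · refine ⟨n, ?_⟩
      rintro d ⟨S, hS, rfl⟩
      simpa using Finset.card_le_univ S
    · exact ⟨S, (shatters_iff F S).2 (mem_shatterer.1 hS), rfl⟩

/-- Extremality passes to sections. -/
lemma section_aux (F : Finset (Finset (Fin n))) (hF : F.shatterer.card ≤ F.card) (x : Fin n) :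
    (F.filter (fun C => x ∈ C)).shatterer.card ≤ (F.filter (fun C => x ∈ C)).card ∧
    (F.filter (fun C => x ∉ C)).shatterer.card ≤ (F.filter (fun C => x ∉ C)).card := by
  set F1 := F.filter (fun C => x ∈ C) with hF1
  set F0 := F.filter (fun C => x ∉ C) with hF0
  have hcard : F1.card + F0.card = F.card := Finset.card_filter_add_card_filter_not _
  have h1 := card_le_card_shatterer F1
  have h0 := card_le_card_shatterer F0
  have hx1 : ∀ S ∈ F1.shatterer, x ∉ S := by
    intro S hS hx
    obtain ⟨u, hu, hu'⟩ := (mem_shatterer.1 hS) (erase_subset x S)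
    have : x ∈ S ∩ u := mem_inter.2 ⟨hx, (mem_filter.1 hu).2⟩
    rw [hu'] at this
    simp at this
  have hsub1 : F1.shatterer ⊆ F.shatterer := shatterer_mono (filter_subset _ _)
  have hsub0 : F0.shatterer ⊆ F.shatterer := shatterer_mono (filter_subset _ _)
  have hx0 : ∀ S ∈ F0.shatterer, x ∉ S := by
    intro S hS hx
    obtain ⟨u, hu, hu'⟩ := (mem_shatterer.1 hS) (Subset.refl S)
    have : x ∈ S ∩ u := by rw [hu']; exact hx
    exact (mem_filter.1 hu).2 (mem_inter.1 this).2
  have hinj : ((F1.shatterer ∩ F0.shatterer).image (insert x)).card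
      = (F1.shatterer ∩ F0.shatterer).card := by
    apply Finset.card_image_of_injOn
    intro S hS T hT hST
    have hS' := hx1 S (mem_inter.1 hS).1
    have hT' := hx1 T (mem_inter.1 hT).1
    have : (insert x S).erase x = (insert x T).erase x := by
      simpa using congrArg (fun U => Finset.erase U x) hST
    rwa [erase_insert hS', erase_insert hT'] at this
  have hdisj : Disjoint (F1.shatterer ∪ F0.shatterer)
      ((F1.shatterer ∩ F0.shatterer).image (insert x)) := by
    rw [Finset.disjoint_left]
    intro S hS hS'
    obtain ⟨T, _, rfl⟩ := mem_image.1 hS'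
    rcases mem_union.1 hS with h | h
    · exact hx1 _ h (mem_insert_self _ _)
    · exact hx0 _ h (mem_insert_self _ _)
  have hsub : (F1.shatterer ∪ F0.shatterer) ∪
      ((F1.shatterer ∩ F0.shatterer).image (insert x)) ⊆ F.shatterer := by
    apply union_subset (union_subset hsub1 hsub0)
    intro S hS
    obtain ⟨T, hT, rfl⟩ := mem_image.1 hS
    obtain ⟨hT1, hT0⟩ := mem_inter.1 hT
    have hxT := hx1 T hT1
    rw [mem_shatterer]
    intro t ht
    by_cases hxt : x ∈ t
    · obtain ⟨u, hu, hu'⟩ := (mem_shatterer.1 hT1) (show t.erase x ⊆ T by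
        intro y hy
        have := ht (mem_of_mem_erase hy)
        exact mem_of_mem_insert_of_ne this (ne_of_mem_erase hy))
      refine ⟨u, (mem_filter.1 hu).1, ?_⟩
      rw [insert_inter_of_mem (mem_filter.1 hu).2, hu', insert_erase hxt]
    · obtain ⟨u, hu, hu'⟩ := (mem_shatterer.1 hT0) (show t ⊆ T by
        intro y hy
        have := ht hy
        exact mem_of_mem_insert_of_ne this (by rintro rfl; exact hxt hy))
      refine ⟨u, (mem_filter.1 hu).1, ?_⟩
      rw [insert_inter_of_notMem (mem_filter.1 hu).2, hu']
  have hfin := card_le_card hsub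
  rw [card_union_of_disjoint hdisj, hinj, card_union_add_card_inter] at hfin
  constructor <;> omega

lemma section_ext (F : Finset (Finset (Fin n))) (hF : F.shatterer.card ≤ F.card)
    (A D : Finset (Fin n)) :
    (F.filter (fun C => ∀ x ∈ D, (x ∈ C ↔ x ∈ A))).shatterer.card ≤
      (F.filter (fun C => ∀ x ∈ D, (x ∈ C ↔ x ∈ A))).card := by
  induction D using Finset.induction_on with
  | empty => simpa using hF
  | insert a D ha ih =>
    have key := section_aux _ ih a
    by_cases haA : a ∈ A
    · have : (F.filter (fun C => ∀ x ∈ insert a D, (x ∈ C ↔ x ∈ A))) =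
          (F.filter (fun C => ∀ x ∈ D, (x ∈ C ↔ x ∈ A))).filter (fun C => a ∈ C) := by
        ext C; simp [haA]; tauto
      rw [this]; exact key.1
    · have : (F.filter (fun C => ∀ x ∈ insert a D, (x ∈ C ↔ x ∈ A))) =
          (F.filter (fun C => ∀ x ∈ D, (x ∈ C ↔ x ∈ A))).filter (fun C => a ∉ C) := by
        ext C; simp [haA]; tauto
      rw [this]; exact key.2

/-- Connectivity of `F` in the hypercube, seen from `v`. -/
def Conn (F : Finset (Finset (Fin n))) (v : Finset (Fin n)) : Prop :=
  ∀ U : Finset (Finset (Fin n)), v ∈ U →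
    (∀ A ∈ U, ∀ x, symmDiff A {x} ∈ F → symmDiff A {x} ∈ U) → F ⊆ U

lemma conn_of_ext (F : Finset (Finset (Fin n))) (hF : F.shatterer.card ≤ F.card)
    (v : Finset (Fin n)) (hv : v ∈ F) : Conn F v := by
  intro U hvU hU
  by_contra hne
  obtain ⟨B₀, hB₀, hB₀U⟩ := Finset.not_subset.1 hne
  -- choose a closest pair
  have hex : ((F ∩ U) ×ˢ (F \ U)).Nonempty :=
    ⟨(v, B₀), by simp [hv, hvU, hB₀, hB₀U]⟩
  obtain ⟨⟨A, B⟩, hAB, hmin⟩ := Finset.exists_min_image _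
    (fun p : Finset (Fin n) × Finset (Fin n) => (symmDiff p.1 p.2).card) hex
  simp only [mem_product, mem_inter, mem_sdiff] at hAB hmin
  obtain ⟨⟨hAF, hAU⟩, hBF, hBU⟩ := hAB
  have hmin' : ∀ A' ∈ F, A' ∈ U → ∀ B' ∈ F, B' ∉ U →
      (symmDiff A B).card ≤ (symmDiff A' B').card := by
    intro A' h1 h2 B' h3 h4
    exact hmin (A', B') ⟨⟨h1, h2⟩, h3, h4⟩
  have hABne : A ≠ B := by rintro rfl; exact hBU hAU
  have hpos : 0 < (symmDiff A B).card := by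
    rw [card_pos, Finset.nonempty_iff_ne_empty]
    intro h
    exact hABne (symmDiff_eq_bot.1 h)
  have hone : (symmDiff A B).card ≠ 1 := by
    intro h
    obtain ⟨x, hx⟩ := card_eq_one.1 h
    have : B = symmDiff A {x} := by rw [← hx, symmDiff_symmDiff_cancel_left]
    apply hBU
    rw [this]
    apply hU A hAU
    rw [← this]; exact hBF
  have htwo : 1 < (symmDiff A B).card := by omega
  obtain ⟨x, hx, y, hy, hxy⟩ := one_lt_card.1 htwo
  have hsec := section_ext F hF A (univ.filter (fun z => z ∈ A ↔ z ∈ B))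
  set G := F.filter (fun C => ∀ z ∈ univ.filter (fun z => z ∈ A ↔ z ∈ B), (z ∈ C ↔ z ∈ A))
    with hG
  have hAG : A ∈ G := by simp [hG, hAF]
  have hBG : B ∈ G := by
    simp only [hG, mem_filter, hBF, true_and, mem_univ]
    intro z hz; exact hz.symm
  have hGsub : G ⊆ {A, B} := by
    intro C hC
    simp only [hG, mem_filter, mem_univ, true_and] at hC
    obtain ⟨hCF, hC⟩ := hC
    by_contra hcon
    simp only [mem_insert, mem_singleton, not_or] at hcon
    have hAC : symmDiff A C ⊂ symmDiff A B := by
      rw [Finset.ssubset_iff_subset_ne]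
      constructor
      · intro z hz
        have hz' := hC z
        simp only [mem_symmDiff] at hz ⊢
        clear * - hz hz'
        by_cases z ∈ A <;> by_cases z ∈ B <;> by_cases z ∈ C <;> simp_all
      · intro h
        exact hcon.2 (symmDiff_right_injective A h)
    have hCB : symmDiff C B ⊂ symmDiff A B := by
      rw [Finset.ssubset_iff_subset_ne]
      constructor
      · intro z hz
        have hz' := hC z
        simp only [mem_symmDiff] at hz ⊢
        clear * - hz hz'
        by_cases z ∈ A <;> by_cases z ∈ B <;> by_cases z ∈ C <;> simp_all
      · intro h
        exact hcon.1 (symmDiff_left_injective B h)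
    by_cases hCU : C ∈ U
    · exact absurd (hmin' C hCF hCU B hBF hBU) (not_le.2 (card_lt_card hCB))
    · exact absurd (hmin' A hAF hAU C hCF hCU) (not_le.2 (card_lt_card hAC))
  have hcard2 : G.card ≤ 2 := (card_le_card hGsub).trans card_le_two
  have hsing : ∀ z ∈ symmDiff A B, {z} ∈ G.shatterer := by
    intro z hz
    rw [mem_shatterer]
    intro t ht
    rcases subset_singleton_iff.1 ht with rfl | rfl
    · by_cases hzA : z ∈ A
      · refine ⟨B, hBG, ?_⟩
        rw [mem_symmDiff] at hz
        exact singleton_inter_of_notMem (by clear * - hz hzA; tauto)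
      · exact ⟨A, hAG, singleton_inter_of_notMem hzA⟩
    · by_cases hzA : z ∈ A
      · exact ⟨A, hAG, singleton_inter_of_mem hzA⟩
      · refine ⟨B, hBG, ?_⟩
        rw [mem_symmDiff] at hz
        exact singleton_inter_of_mem (by clear * - hz hzA; tauto)
  have hthree : ({∅, {x}, {y}} : Finset (Finset (Fin n))) ⊆ G.shatterer := by
    intro s hs
    simp only [mem_insert, mem_singleton] at hs
    rcases hs with rfl | rfl | rfl
    · rw [mem_shatterer]
      intro t ht
      exact ⟨A, hAG, by rw [subset_empty.1 ht]; simp⟩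
    · exact hsing _ hx
    · exact hsing _ hy
  have h3 : ({∅, {x}, {y}} : Finset (Finset (Fin n))).card = 3 := by
    rw [card_eq_three]
    refine ⟨∅, {x}, {y}, ?_, ?_, ?_, rfl⟩
    · exact (singleton_ne_empty x).symm
    · exact (singleton_ne_empty y).symm
    · simpa using hxy
  have := card_le_card hthree
  omega

/-- Outer vertex boundary in the hypercube. -/
def bdry (F : Finset (Finset (Fin n))) : Finset (Finset (Fin n)) :=
  ((F ×ˢ (univ : Finset (Fin n))).image (fun p => symmDiff p.1 {p.2})) \ F

lemma card_bdry (F : Finset (Finset (Fin n))) : (bdry F).card ≤ n * F.card := by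
  unfold bdry
  refine (card_le_card sdiff_subset).trans (card_image_le.trans ?_)
  rw [card_product]; simp [mul_comm]

/-- Colourings in which `F` is exactly the open cluster. -/
def ev (m : ℕ) (F : Finset (Finset (Fin n))) : Finset (Finset (Fin n) → Fin (m+1)) :=
  Fintype.piFinset (fun A => if A ∈ F then {0} else if A ∈ bdry F then {0}ᶜ else univ)

lemma ev_sub {m : ℕ} {F G : Finset (Finset (Fin n))} {v : Finset (Fin n)}
    (hF : Conn F v) (hvG : v ∈ G) {h : Finset (Fin n) → Fin (m+1)}
    (h1 : h ∈ ev m F) (h2 : h ∈ ev m G) : F ⊆ G := by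
  apply hF G hvG
  intro A hA x hx
  by_contra hcon
  have hb : symmDiff A {x} ∈ bdry G := by
    unfold bdry
    rw [mem_sdiff]
    exact ⟨mem_image.2 ⟨(A, x), by simp [hA], rfl⟩, hcon⟩
  unfold ev at h1 h2
  rw [Fintype.mem_piFinset] at h1 h2
  have e1 := h1 (symmDiff A {x})
  have e2 := h2 (symmDiff A {x})
  rw [if_pos hx] at e1
  rw [if_neg hcon, if_pos hb] at e2
  simp at e1 e2
  exact e2 e1

lemma card_ev (m : ℕ) (F : Finset (Finset (Fin n))) :
    ((ev m F).card : ℝ) = ((m : ℝ) + 1) ^ (2 ^ n) * (1 / ((m : ℝ) + 1)) ^ F.card *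
      (1 - 1 / ((m : ℝ) + 1)) ^ (bdry F).card := by
  unfold ev
  rw [Fintype.card_piFinset]
  push_cast
  have hm : (m : ℝ) + 1 ≠ 0 := by positivity
  have : ∀ A : Finset (Fin n), (((if A ∈ F then {0} else if A ∈ bdry F then {0}ᶜ else univ :
      Finset (Fin (m+1))).card : ℕ) : ℝ) = ((m : ℝ) + 1) *
      (if A ∈ F then (1 / ((m : ℝ) + 1)) else 1) *
      (if A ∈ bdry F then (1 - 1 / ((m : ℝ) + 1)) else 1) := by
    intro A
    by_cases h1 : A ∈ F
    · have h2 : A ∉ bdry F := by simp [bdry, h1]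
      simp [h1, h2, hm]
    · by_cases h2 : A ∈ bdry F
      · simp only [h1, h2, if_true, if_false]
        rw [card_compl]
        simp
        field_simp
        ring
      · simp [h1, h2]
  rw [Finset.prod_congr rfl (fun A _ => this A)]
  rw [Finset.prod_mul_distrib, Finset.prod_mul_distrib]
  simp [Finset.prod_ite_mem]

lemma count_conn (hn : 0 < n) (f : ℕ) (v : Finset (Fin n)) (𝒞 : Finset (Finset (Finset (Fin n))))
    (h𝒞 : ∀ F ∈ 𝒞, Conn F v ∧ v ∈ F ∧ F.card = f) :
    (𝒞.card : ℝ) ≤ (4 * n) ^ f := by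
  set m := 2 * n - 1 with hm
  have hm1 : (m : ℝ) + 1 = 2 * n := by
    have : m + 1 = 2 * n := by omega
    exact_mod_cast this
  have hn' : (0 : ℝ) < n := by exact_mod_cast hn
  have hdis : (𝒞 : Set (Finset (Finset (Fin n)))).PairwiseDisjoint (ev m) := by
    intro F hF G hG hne
    rw [Function.onFun, Finset.disjoint_left]
    intro h h1 h2
    apply hne
    exact Subset.antisymm (ev_sub (h𝒞 F hF).1 (h𝒞 G hG).2.1 h1 h2)
      (ev_sub (h𝒞 G hG).1 (h𝒞 F hF).2.1 h2 h1)
  have hsum : ∑ F ∈ 𝒞, (ev m F).card ≤ (m + 1) ^ (2 ^ n) := by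
    rw [← card_biUnion hdis]
    refine (card_le_univ _).trans ?_
    simp
  have hsum' : ∑ F ∈ 𝒞, ((ev m F).card : ℝ) ≤ ((m : ℝ) + 1) ^ (2 ^ n) := by exact_mod_cast hsum
  have hbern : (1 / 2 : ℝ) ≤ (1 - 1 / ((m : ℝ) + 1)) ^ n := by
    have hge : (1 : ℝ) ≤ n := by exact_mod_cast hn
    have hinv : 1 / (2 * (n : ℝ)) ≤ 1 / 2 := by
      apply one_div_le_one_div_of_le <;> linarith
    have := one_add_mul_le_pow (a := - (1 / ((m : ℝ) + 1))) (by rw [hm1]; linarith) n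
    calc (1 / 2 : ℝ) = 1 + n * (- (1 / ((m : ℝ) + 1))) := by rw [hm1]; field_simp; norm_num
      _ ≤ _ := this
      _ = _ := by ring
  have h01 : 0 ≤ 1 - 1 / ((m : ℝ) + 1) := by
    rw [sub_nonneg, div_le_one (by positivity)]
    have : (0 : ℝ) ≤ m := by positivity
    linarith
  have h11 : 1 - 1 / ((m : ℝ) + 1) ≤ 1 := by
    have : 0 ≤ 1 / ((m : ℝ) + 1) := by positivity
    linarith
  have hlow : ∀ F ∈ 𝒞, ((m : ℝ) + 1) ^ (2 ^ n) * (1 / (4 * n)) ^ f ≤ ((ev m F).card : ℝ) := by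
    intro F hF
    rw [card_ev, (h𝒞 F hF).2.2, mul_assoc]
    apply mul_le_mul_of_nonneg_left _ (by positivity)
    have hb := card_bdry F
    rw [(h𝒞 F hF).2.2] at hb
    calc (1 / (4 * (n : ℝ))) ^ f = (1 / ((m : ℝ) + 1)) ^ f * (1 / 2) ^ f := by
          rw [← mul_pow, hm1]; congr 1; field_simp; norm_num
      _ ≤ (1 / ((m : ℝ) + 1)) ^ f * ((1 - 1 / ((m : ℝ) + 1)) ^ n) ^ f := by gcongr
      _ = (1 / ((m : ℝ) + 1)) ^ f * (1 - 1 / ((m : ℝ) + 1)) ^ (n * f) := by rw [pow_mul]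
      _ ≤ _ := by
          apply mul_le_mul_of_nonneg_left _ (by positivity)
          exact pow_le_pow_of_le_one h01 h11 hb
  have h2 := (Finset.card_nsmul_le_sum 𝒞 _ _ hlow).trans hsum'
  rw [nsmul_eq_mul] at h2
  have hM : 0 < ((m : ℝ) + 1) ^ (2 ^ n) := by positivity
  have h3 : (𝒞.card : ℝ) * (1 / (4 * n)) ^ f ≤ 1 := by
    by_contra hcon
    push Not at hcon
    nlinarith
  rw [one_div, inv_pow, ← div_eq_mul_inv, div_le_one (by positivity)] at h3
  exact h3

/-- Upper bound. -/
lemma upper (n k : ℕ) (hn : 0 < n) (hk : 0 < k) :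
    (maxFamCount n k : ℝ) ≤ (8 * n) ^ (∑ i ∈ range (k + 1), n.choose i) := by
  classical
  set f := ∑ i ∈ range (k + 1), n.choose i with hf
  set 𝒜 : Finset (Finset (Finset (Fin n))) := univ.filter (fun F => IsMaximal F ∧ vcDim F = k)
    with h𝒜
  have hm : maxFamCount n k = 𝒜.card := by
    unfold maxFamCount
    rw [Nat.card_eq_fintype_card, Fintype.card_subtype]
  have hnf : n ≤ f := by
    have : n.choose 1 ≤ f :=
      Finset.single_le_sum (f := fun i => n.choose i) (fun _ _ => Nat.zero_le _)
        (mem_range.2 (by omega))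
    simpa using this
  have hA : ∀ F ∈ 𝒜, F.card = f ∧ F.shatterer.card ≤ F.card := by
    intro F hF
    obtain ⟨h1, h2⟩ := (mem_filter.1 hF).2
    unfold IsMaximal at h1
    rw [h2] at h1
    refine ⟨h1, ?_⟩
    have := Finset.card_shatterer_le_sum_vcDim (𝒜 := F)
    rw [← vcDim_eq, h2] at this
    rw [h1]
    refine this.trans (le_of_eq ?_)
    rw [Fintype.card_fin, ← Nat.range_succ_eq_Iic]
  have hcov : 𝒜 ⊆ univ.biUnion (fun v : Finset (Fin n) => 𝒜.filter (fun F => v ∈ F)) := by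
    intro F hF
    have hne : F.Nonempty := by
      rw [← card_pos, (hA F hF).1]; omega
    obtain ⟨v, hv⟩ := hne
    exact mem_biUnion.2 ⟨v, mem_univ _, mem_filter.2 ⟨hF, hv⟩⟩
  have h1 : (𝒜.card : ℝ) ≤ ∑ v : Finset (Fin n), ((𝒜.filter (fun F => v ∈ F)).card : ℝ) := by
    exact_mod_cast (card_le_card hcov).trans card_biUnion_le
  have h2 : ∀ v : Finset (Fin n), ((𝒜.filter (fun F => v ∈ F)).card : ℝ) ≤ (4 * n) ^ f := by
    intro v
    apply count_conn hn f v
    intro F hF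
    obtain ⟨hF1, hv⟩ := mem_filter.1 hF
    exact ⟨conn_of_ext F (hA F hF1).2 v hv, hv, (hA F hF1).1⟩
  rw [hm]
  calc (𝒜.card : ℝ) ≤ _ := h1
    _ ≤ ∑ v : Finset (Fin n), (4 * (n : ℝ)) ^ f := Finset.sum_le_sum (fun v _ => h2 v)
    _ = 2 ^ n * (4 * (n : ℝ)) ^ f := by simp
    _ ≤ 2 ^ f * (4 * (n : ℝ)) ^ f := by
        gcongr
        norm_num
    _ = (8 * n) ^ f := by rw [← mul_pow]; congr 1; ring


/-- The modification map: a `k`-set avoiding `R` is extended by one element of `R`. -/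
def phi (k : ℕ) (R : Finset (Fin n)) (g : Finset (Fin n) → Fin n) (T : Finset (Fin n)) :
    Finset (Fin n) :=
  if T.card = k ∧ Disjoint T R then insert (g T) T else T

/-- All sets of size at most `k`. -/
def lay (n k : ℕ) : Finset (Finset (Fin n)) := univ.filter (fun T => T.card ≤ k)

lemma card_lay (n k : ℕ) : (lay n k).card = ∑ i ∈ range (k + 1), n.choose i := by
  have : lay n k = (range (k + 1)).biUnion (fun i => powersetCard i univ) := by
    ext T; simp [lay]
  rw [this, card_biUnion]
  · simp
  · intro i _ j _ hij
    exact pairwise_disjoint_powersetCard _ hij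

section
variable {k : ℕ} {R : Finset (Fin n)} {g : Finset (Fin n) → Fin n}

lemma phi_pos {T : Finset (Fin n)} (h : T.card = k ∧ Disjoint T R) :
    phi k R g T = insert (g T) T := if_pos h

lemma phi_neg {T : Finset (Fin n)} (h : ¬ (T.card = k ∧ Disjoint T R)) :
    phi k R g T = T := if_neg h

lemma phi_card_pos (hg : ∀ T, g T ∈ R) {T : Finset (Fin n)} (h : T.card = k ∧ Disjoint T R) :
    (phi k R g T).card = k + 1 := by
  rw [phi_pos h, card_insert_of_notMem, h.1]
  intro h'
  exact Finset.disjoint_left.1 h.2 h' (hg T)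

lemma phi_sdiff (hg : ∀ T, g T ∈ R) {T : Finset (Fin n)} (h : T.card = k ∧ Disjoint T R) :
    phi k R g T \ R = T := by
  rw [phi_pos h, insert_sdiff_of_mem _ (hg T), sdiff_eq_self_of_disjoint h.2]

/-- A value of size above `k` comes from a modified set. -/
lemma phi_big {T : Finset (Fin n)} (hT : T.card ≤ k) (h : k + 1 ≤ (phi k R g T).card) :
    T.card = k ∧ Disjoint T R := by
  by_contra hcon
  rw [phi_neg hcon] at h
  omega

lemma phi_inj (hg : ∀ T, g T ∈ R) : Set.InjOn (phi k R g) (lay n k : Set (Finset (Fin n))) := by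
  intro S hS T hT hST
  have hS' : S.card ≤ k := by simpa [lay] using hS
  have hT' : T.card ≤ k := by simpa [lay] using hT
  by_cases h1 : S.card = k ∧ Disjoint S R
  · have h2 : T.card = k ∧ Disjoint T R := by
      apply phi_big (g := g) hT'
      rw [← hST, phi_card_pos hg h1]
    rw [← phi_sdiff hg h1, hST, phi_sdiff hg h2]
  · by_cases h2 : T.card = k ∧ Disjoint T R
    · exact absurd (phi_big (g := g) hS' (by rw [hST, phi_card_pos hg h2])) h1
    · rwa [phi_neg h1, phi_neg h2] at hST

/-- The modified family. -/
def fam (k : ℕ) (R : Finset (Fin n)) (g : Finset (Fin n) → Fin n) : Finset (Finset (Fin n)) :=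
  (lay n k).image (phi k R g)

lemma card_fam (hg : ∀ T, g T ∈ R) : (fam k R g).card = ∑ i ∈ range (k + 1), n.choose i := by
  unfold fam
  rw [card_image_of_injOn (phi_inj hg), card_lay]

lemma fam_shatters (hg : ∀ T, g T ∈ R) {S : Finset (Fin n)} (hS : (fam k R g).Shatters S) :
    S.card ≤ k := by
  by_contra hcon
  push Not at hcon
  obtain ⟨u, hu, hSu⟩ := hS.exists_superset
  obtain ⟨T, hT, rfl⟩ := mem_image.1 hu
  have hT' : T.card ≤ k := by simpa [lay] using hT
  have hTp := phi_big hT' (hcon.trans_le (card_le_card hSu))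
  have hc := phi_card_pos hg hTp
  have hSeq : S = phi k R g T := eq_of_subset_of_card_le hSu (by omega)
  have hTS : T ⊆ S := by rw [hSeq, phi_pos hTp]; exact subset_insert _ _
  obtain ⟨w, hw, hSw⟩ := hS hTS
  obtain ⟨W, hW, rfl⟩ := mem_image.1 hw
  have hW' : W.card ≤ k := by simpa [lay] using hW
  have hTW : T ⊆ phi k R g W := by rw [← hSw]; exact inter_subset_right
  by_cases hWp : W.card = k ∧ Disjoint W R
  · have : T ⊆ W := by
      rw [← phi_sdiff hg hWp]
      exact subset_sdiff.2 ⟨hTW, hTp.2⟩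
    have hTWeq : T = W := eq_of_subset_of_card_le this (by omega)
    rw [← hTWeq, ← hSeq, inter_self] at hSw
    rw [hSw] at hcon
    omega
  · rw [phi_neg hWp] at hTW
    have hTWeq : T = W := eq_of_subset_of_card_le hTW (by omega)
    exact hWp (hTWeq ▸ hTp)

lemma fam_vcDim (hg : ∀ T, g T ∈ R) (hkn : k ≤ n) : _root_.vcDim (fam k R g) = k := by
  rw [vcDim_eq]
  apply le_antisymm
  · exact Finset.sup_le (fun S hS => fam_shatters hg (mem_shatterer.1 hS))
  · by_contra hcon
    push Not at hcon
    have h1 := (card_le_card_shatterer (fam k R g)).trans card_shatterer_le_sum_vcDim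
    rw [card_fam hg, Fintype.card_fin, ← Nat.range_succ_eq_Iic, sum_range_succ] at h1
    have h2 : ∑ i ∈ range (Finset.vcDim (fam k R g) + 1), n.choose i ≤ ∑ i ∈ range k, n.choose i :=
      sum_le_sum_of_subset (range_subset_range.2 (by omega))
    have := Nat.choose_pos hkn
    omega

end

lemma fam_inj {k : ℕ} {R : Finset (Fin n)} {g g' : Finset (Fin n) → Fin n}
    (hg : ∀ T, g T ∈ R) (hg' : ∀ T, g' T ∈ R) (h : fam k R g = fam k R g')
    {T : Finset (Fin n)} (hT : T.card = k ∧ Disjoint T R) : g T = g' T := by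
  have h1 : phi k R g T ∈ fam k R g' := by
    rw [← h]
    exact mem_image_of_mem _ (by simp [lay, hT.1])
  obtain ⟨W, hW, hWT⟩ := mem_image.1 h1
  have hW' : W.card ≤ k := by simpa [lay] using hW
  have hWp : W.card = k ∧ Disjoint W R := by
    apply phi_big (g := g') hW'
    rw [hWT, phi_card_pos hg hT]
  have hWTeq : W = T := by rw [← phi_sdiff hg' hWp, hWT, phi_sdiff hg hT]
  subst hWTeq
  rw [phi_pos hWp, phi_pos hWp] at hWT
  have : g W ∈ insert (g' W) W := by rw [hWT]; exact mem_insert_self _ _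
  rcases mem_insert.1 this with h | h
  · exact h
  · exact absurd (hg W) (Finset.disjoint_left.1 hT.2 h)

lemma lower (n k r : ℕ) (hr0 : 0 < r) (hr : r ≤ n) (hkn : k ≤ n) :
    r ^ ((n - r).choose k) ≤ maxFamCount n k := by
  classical
  obtain ⟨R, -, hRc⟩ := exists_subset_card_eq (s := (univ : Finset (Fin n))) (n := r)
    (by simpa using hr)
  obtain ⟨r₀, hr₀⟩ : R.Nonempty := by rw [← card_pos]; omega
  let D : Finset (Finset (Fin n)) := powersetCard k Rᶜ
  have hD : ∀ T, T ∈ D ↔ (T.card = k ∧ Disjoint T R) := by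
    intro T
    simp only [D, mem_powersetCard, subset_compl_iff_disjoint_right]
    tauto
  have hDc : D.card = (n - r).choose k := by
    simp [D, card_compl, hRc]
  let ex : (D → R) → Finset (Fin n) → Fin n :=
    fun g T => if h : T ∈ D then (g ⟨T, h⟩ : Fin n) else r₀
  have hex : ∀ g T, ex g T ∈ R := by
    intro g T
    simp only [ex]
    split_ifs with h
    · exact (g ⟨T, h⟩).2
    · exact hr₀
  let Φ : (D → R) → {F : Finset (Finset (Fin n)) // IsMaximal F ∧ _root_.vcDim F = k} :=
    fun g => ⟨fam k R (ex g), by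
      have hv := fam_vcDim (hex g) hkn
      refine ⟨?_, hv⟩
      unfold IsMaximal
      rw [hv, card_fam (hex g)]⟩
  have hΦ : Function.Injective Φ := by
    intro g g' h
    have h' : fam k R (ex g) = fam k R (ex g') := congrArg Subtype.val h
    funext ⟨T, hT⟩
    have := fam_inj (hex g) (hex g') h' ((hD T).1 hT)
    simp only [ex, hT, dif_pos] at this
    exact Subtype.ext this
  have := Nat.card_le_card_of_injective Φ hΦ
  unfold maxFamCount
  refine le_trans (le_of_eq ?_) this
  rw [Nat.card_eq_fintype_card, Fintype.card_fun]
  simp [hDc, hRc]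

/-! Binomial estimates. -/

lemma choose_sub (n k : ℕ) (hk : 0 < k) : ∀ r, r ≤ n →
    n.choose k ≤ (n - r).choose k + r * (n - 1).choose (k - 1) := by
  intro r
  induction r with
  | zero => simp
  | succ r ih =>
    intro hr
    have h := ih (by omega)
    obtain ⟨a, ha⟩ : ∃ a, n - r = a + 1 := ⟨n - r - 1, by omega⟩
    obtain ⟨b, rfl⟩ : ∃ b, k = b + 1 := ⟨k - 1, by omega⟩
    have h2 : n - (r + 1) = a := by omega
    rw [ha, Nat.choose_succ_succ'] at h
    rw [h2]
    have h3 : a.choose b ≤ (n - 1).choose b := Nat.choose_le_choose _ (by omega)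
    simp only [Nat.add_sub_cancel] at h ⊢
    rw [add_mul, one_mul]
    omega

lemma choose_sub_real (n k r : ℕ) (hk : 0 < k) (hr : r ≤ n) (hn : 0 < n) :
    (1 - r * k / n : ℝ) * n.choose k ≤ (n - r).choose k := by
  have h := choose_sub n k hk r hr
  have h2 : n * (n - 1).choose (k - 1) = n.choose k * k := by
    obtain ⟨a, rfl⟩ : ∃ a, n = a + 1 := ⟨n - 1, by omega⟩
    obtain ⟨b, rfl⟩ : ∃ b, k = b + 1 := ⟨k - 1, by omega⟩
    simpa using Nat.add_one_mul_choose_eq a b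
  have hn' : (0 : ℝ) < n := by exact_mod_cast hn
  have h' : (n.choose k : ℝ) ≤ (n - r).choose k + r * (n - 1).choose (k - 1) := by exact_mod_cast h
  have h2' : (n : ℝ) * (n - 1).choose (k - 1) = n.choose k * k := by exact_mod_cast h2
  have h3 : ((n - 1).choose (k - 1) : ℝ) = n.choose k * k / n := by
    field_simp; linarith
  rw [h3] at h'
  have : (1 - r * k / n : ℝ) * n.choose k = n.choose k - r * (n.choose k * k / n) := by
    field_simp
  linarith

lemma sum_choose (n k : ℕ) (q : ℝ) (hq0 : 0 ≤ q) (hq1 : q < 1) (hkn : k ≤ n)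
    (h : (k : ℝ) ≤ q * (n - k)) : ∀ j ≤ k,
    (1 - q) * ((∑ i ∈ range (j + 1), n.choose i : ℕ) : ℝ) ≤ n.choose j := by
  intro j
  induction j with
  | zero => intro _; simp; linarith
  | succ j ih =>
    intro hj
    have h1 := ih (by omega)
    rw [sum_range_succ]
    push_cast at h1 ⊢
    have h2 : n.choose (j + 1) * (j + 1) = n.choose j * (n - j) := Nat.choose_succ_right_eq n j
    have h2' : (n.choose (j + 1) : ℝ) * (j + 1) = n.choose j * (n - j) := by
      rw [← Nat.cast_sub (by omega : j ≤ n)]; exact_mod_cast h2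
    have hjk : (j : ℝ) + 1 ≤ k := by exact_mod_cast hj
    have hk0 : (0 : ℝ) < k := by have : (0 : ℝ) ≤ j := by positivity
                                 linarith
    have hnk : (0 : ℝ) < n - k := by
      by_contra hc
      push Not at hc
      nlinarith
    have hC0 : (0 : ℝ) ≤ n.choose j := by positivity
    have hC1 : (0 : ℝ) ≤ n.choose (j + 1) := by positivity
    have h3 : (n.choose j : ℝ) ≤ q * n.choose (j + 1) := by
      have e1 : (n.choose j : ℝ) * (n - k) ≤ n.choose (j + 1) * (q * (n - k)) := by
        calc (n.choose j : ℝ) * (n - k) ≤ n.choose j * (n - j) := by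
              apply mul_le_mul_of_nonneg_left _ hC0; linarith
          _ = n.choose (j + 1) * (j + 1) := h2'.symm
          _ ≤ n.choose (j + 1) * (q * (n - k)) := by
              apply mul_le_mul_of_nonneg_left _ hC1; linarith
      have e2 : (n.choose j : ℝ) * (n - k) ≤ (q * n.choose (j + 1)) * (n - k) := by linarith
      exact le_of_mul_le_mul_right e2 hnk
    linarith


lemma final (k : ℕ → ℕ) (hkpos : ∀ n, 0 < k n)
    (hko : Filter.Tendsto (fun n : ℕ => Real.log (k n) / Real.log n)
      Filter.atTop (nhds 0)) (ε : ℝ) (hε : 0 < ε) (hε1 : ε ≤ 1 / 2) :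
    ∃ N : ℕ, ∀ n : ℕ, N ≤ n →
      (n : ℝ) ^ ((1 - ε) * (n.choose (k n) : ℝ)) ≤ (maxFamCount n (k n) : ℝ) ∧
      (maxFamCount n (k n) : ℝ) ≤ (n : ℝ) ^ ((1 + ε) * (n.choose (k n) : ℝ)) := by
  have hcast : Filter.Tendsto (fun n : ℕ => (n : ℝ)) Filter.atTop Filter.atTop :=
    tendsto_natCast_atTop_atTop
  have hlog : Filter.Tendsto (fun n : ℕ => Real.log n) Filter.atTop Filter.atTop :=
    Real.tendsto_log_atTop.comp hcast
  have hneg : Filter.Tendsto (fun n : ℕ => (n : ℝ) ^ (-(ε / 4))) Filter.atTop (nhds 0) :=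
    (tendsto_rpow_neg_atTop (by linarith)).comp hcast
  have e1 := hko.eventually (gt_mem_nhds (show (0 : ℝ) < ε / 4 by linarith))
  have e2 := hneg.eventually (gt_mem_nhds (show (0 : ℝ) < ε / 16 by linarith))
  have e3 := hlog.eventually_ge_atTop (4 / ε * Real.log 8 + 1)
  have e4 := Filter.eventually_ge_atTop (2 : ℕ)
  obtain ⟨N, hN⟩ := Filter.eventually_atTop.1 (e1.and (e2.and (e3.and e4)))
  refine ⟨N, fun n hn => ?_⟩
  obtain ⟨h1, h2, h3, h4⟩ := hN n hn
  have hn0 : 0 < n := by omega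
  have hnr : (1 : ℝ) < n := by exact_mod_cast (by omega : 1 < n)
  have hnr0 : (0 : ℝ) < n := by linarith
  have hL : 0 < Real.log n := Real.log_pos hnr
  have hk0 := hkpos n
  set K := k n with hK
  have hkr : (0 : ℝ) < K := by exact_mod_cast hk0
  -- K ≤ n^(ε/4)
  have hKle : (K : ℝ) ≤ (n : ℝ) ^ (ε / 4) := by
    rw [← Real.log_le_log_iff hkr (by positivity), Real.log_rpow hnr0]
    rw [div_lt_iff₀ hL] at h1
    exact h1.le
  -- key smallness: n^(-ε/4) small
  have hsplit : ∀ a b : ℝ, (n : ℝ) ^ (a + b) = (n : ℝ) ^ a * (n : ℝ) ^ b :=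
    fun a b => Real.rpow_add hnr0 a b
  have hp1 : (n : ℝ) ^ (1 : ℝ) = n := Real.rpow_one _
  -- n^(1-ε/2) * K ≤ ε/16 n
  have hkey : (n : ℝ) ^ (1 - ε / 2) * K ≤ ε / 16 * n := by
    calc (n : ℝ) ^ (1 - ε / 2) * K ≤ (n : ℝ) ^ (1 - ε / 2) * (n : ℝ) ^ (ε / 4) := by gcongr
      _ = (n : ℝ) ^ (-(ε / 4)) * n := by
          nth_rewrite 4 [← hp1]
          rw [← hsplit, ← hsplit]; congr 1; ring
      _ ≤ ε / 16 * n := by gcongr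
  have hx1 : (1 : ℝ) ≤ (n : ℝ) ^ (1 - ε / 2) := Real.one_le_rpow hnr.le (by linarith)
  have hKn : (K : ℝ) ≤ ε / 16 * n := by nlinarith
  have hKn' : K ≤ n := by
    have : (K : ℝ) ≤ n := by nlinarith
    exact_mod_cast this
  set C : ℝ := (n.choose K : ℝ) with hC
  have hC0 : 0 ≤ C := by positivity
  constructor
  · set r := ⌈(n : ℝ) ^ (1 - ε / 2)⌉₊ with hr
    have hr1 : (n : ℝ) ^ (1 - ε / 2) ≤ r := Nat.le_ceil _
    have hr2 : (r : ℝ) < (n : ℝ) ^ (1 - ε / 2) + 1 := Nat.ceil_lt_add_one (by positivity)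
    have hr3 : (r : ℝ) * K ≤ ε / 8 * n := by nlinarith
    have hrn : r ≤ n := by
      have hK1 : (1 : ℝ) ≤ K := by exact_mod_cast hk0
      have : (r : ℝ) ≤ n := by nlinarith
      exact_mod_cast this
    have hr0 : 0 < r := by
      have : (0 : ℝ) < r := by linarith
      exact_mod_cast this
    have hlow := lower n K r hr0 hrn hKn'
    have hlow' : (r : ℝ) ^ ((n - r).choose K) ≤ (maxFamCount n K : ℝ) := by exact_mod_cast hlow
    refine le_trans ?_ hlow'
    have hch := choose_sub_real n K r hk0 hrn hn0
    have hch' : (1 - ε / 8) * C ≤ ((n - r).choose K : ℝ) := by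
      refine le_trans ?_ hch
      apply mul_le_mul_of_nonneg_right _ hC0
      have : (r : ℝ) * K / n ≤ ε / 8 := by rw [div_le_iff₀ hnr0]; exact hr3
      linarith
    calc (n : ℝ) ^ ((1 - ε) * C) ≤ (n : ℝ) ^ ((1 - ε / 2) * ((n - r).choose K : ℝ)) := by
          apply Real.rpow_le_rpow_of_exponent_le hnr.le
          calc (1 - ε) * C ≤ ((1 - ε / 2) * (1 - ε / 8)) * C := by
                apply mul_le_mul_of_nonneg_right _ hC0
                nlinarith
            _ = (1 - ε / 2) * ((1 - ε / 8) * C) := by ring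
            _ ≤ _ := by
                apply mul_le_mul_of_nonneg_left hch'
                linarith
      _ = ((n : ℝ) ^ (1 - ε / 2)) ^ ((n - r).choose K) := by
          rw [Real.rpow_mul hnr0.le, Real.rpow_natCast]
      _ ≤ (r : ℝ) ^ ((n - r).choose K) := by gcongr
  · refine (upper n K hn0 hk0).trans ?_
    set f := ∑ i ∈ range (K + 1), n.choose i with hf
    have hS := sum_choose n K (ε / 4) (by linarith) (by linarith) hKn' (by nlinarith) K le_rfl
    rw [← hf] at hS
    have hf0 : (0 : ℝ) ≤ f := by positivity
    have h8 : Real.log 8 ≤ ε / 4 * Real.log n := by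
      have : ε / 4 * (4 / ε * Real.log 8 + 1) ≤ ε / 4 * Real.log n := by gcongr
      have e : ε / 4 * (4 / ε * Real.log 8 + 1) = Real.log 8 + ε / 4 := by field_simp
      linarith
    rw [← Real.log_le_log_iff (by positivity) (by positivity), Real.log_pow, Real.log_rpow hnr0,
      Real.log_mul (by norm_num) (by positivity)]
    have hfC : (1 + ε / 4) * (f : ℝ) ≤ (1 + ε) * C := by
      have a : (1 + ε / 4) * (f : ℝ) ≤ ((1 + ε) * (1 - ε / 4)) * f := by
        apply mul_le_mul_of_nonneg_right _ hf0
        nlinarith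
      have b : (1 + ε) * ((1 - ε / 4) * (f : ℝ)) ≤ (1 + ε) * C := by
        apply mul_le_mul_of_nonneg_left hS; linarith
      linarith
    calc (f : ℝ) * (Real.log 8 + Real.log n) ≤ f * ((1 + ε / 4) * Real.log n) := by
          apply mul_le_mul_of_nonneg_left _ hf0; linarith
      _ = ((1 + ε / 4) * f) * Real.log n := by ring
      _ ≤ _ := mul_le_mul_of_nonneg_right hfC hL.le

end MF

/-- **Theorem 1.** If `k(n) = n^{o(1)}`, then `m(n,k) = n^{(1+o(1))·C(n,k)}`:
for every `ε > 0`, eventually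
`n^{(1-ε)·C(n,k(n))} ≤ m(n,k(n)) ≤ n^{(1+ε)·C(n,k(n))}`. -/
theorem maxFamCount_asymptotics (k : ℕ → ℕ) (hkpos : ∀ n, 0 < k n)
    (hko : Filter.Tendsto (fun n : ℕ => Real.log (k n) / Real.log n)
      Filter.atTop (nhds 0)) :
    ∀ ε : ℝ, 0 < ε → ∃ N : ℕ, ∀ n : ℕ, N ≤ n →
      (n : ℝ) ^ ((1 - ε) * (n.choose (k n) : ℝ)) ≤ (maxFamCount n (k n) : ℝ) ∧
      (maxFamCount n (k n) : ℝ) ≤ (n : ℝ) ^ ((1 + ε) * (n.choose (k n) : ℝ)) := by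
  intro ε hε
  obtain ⟨N, hN⟩ := MF.final k hkpos hko (min ε (1 / 2)) (by positivity) (min_le_right _ _)
  refine ⟨max N 1, fun n hn => ?_⟩
  obtain ⟨h1, h2⟩ := hN n ((le_max_left _ _).trans hn)
  have hn1 : (1 : ℝ) ≤ n := by exact_mod_cast (le_max_right _ _).trans hn
  have hle : min ε (1 / 2) ≤ ε := min_le_left _ _
  have hC : (0 : ℝ) ≤ (n.choose (k n) : ℝ) := by positivity
  constructor
  · refine le_trans (Real.rpow_le_rpow_of_exponent_le hn1 ?_) h1
    apply mul_le_mul_of_nonneg_right _ hC; linarith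
  · refine h2.trans (Real.rpow_le_rpow_of_exponent_le hn1 ?_)
    apply mul_le_mul_of_nonneg_right _ hC; linarith
end

section
/- Let k = k(n) be a sequence of positive integers with k(n) = n^{o(1)}, i.e. log k(n)/log n → 0 as n → ∞. Then n^{(1+o(1))·C(n,k)} ≤ IndMat(n,k) ≤ m(n,k) ≤ ExVC(n,k) ≤ n^{(1+o(1))·C(n,k)}; precisely, for every ε > 0 there exists N such that for all n ≥ N: n^{(1-ε)·C(n,k(n))} ≤ IndMat(n,k(n)) ≤ m(n,k(n)) ≤ ExVC(n,k(n)) ≤ n^{(1+ε)·C(n,k(n))}. -/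
/-- `M` is an induced matching between layers `k` and `k+1` of the hypercube `Q_n`:
each edge joins a `k`-set to a `(k+1)`-set containing it, distinct edges share no
endpoint, and no endpoint of one edge is adjacent in `Q_n` to an endpoint of another
edge. -/
def IsInducedMatching (n k : ℕ) (M : Finset (Finset (Fin n) × Finset (Fin n))) : Prop :=
  (∀ e ∈ M, e.1.card = k ∧ e.2.card = k + 1 ∧ e.1 ⊆ e.2) ∧
  (∀ e₁ ∈ M, ∀ e₂ ∈ M, e₁ ≠ e₂ →
    e₁.1 ≠ e₂.1 ∧ e₁.2 ≠ e₂.2 ∧ ¬ e₁.1 ⊆ e₂.2 ∧ ¬ e₂.1 ⊆ e₁.2)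

/-- `IndMat(n,k)`: the number of induced matchings between layers `k` and `k+1` of `Q_n`. -/
noncomputable def indMat (n k : ℕ) : ℕ :=
  Nat.card {M : Finset (Finset (Fin n) × Finset (Fin n)) // IsInducedMatching n k M}

/-- `ExVC(n,k)`: the number of shattering-extremal families (families `F` with
`|Sh(F)| = |F|`) in the power set of `[n]` with VC dimension at most `k`. -/
noncomputable def exVC (n k : ℕ) : ℕ :=
  Nat.card {F : Finset (Finset (Fin n)) //
    Nat.card {S : Finset (Fin n) // Shatters F S} = F.card ∧ vcDim F ≤ k}

theorem shatters_iff' {n : ℕ} (F : Finset (Finset (Fin n))) (S : Finset (Fin n)) :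
    Shatters F S ↔ Finset.Shatters F S := by
  constructor
  · intro h t ht
    obtain ⟨u, hu, he⟩ := h t ht
    exact ⟨u, hu, by rw [Finset.inter_comm]; exact he⟩
  · intro h t ht
    obtain ⟨u, hu, he⟩ := h ht
    exact ⟨u, hu, by rw [Finset.inter_comm]; exact he⟩

theorem vcDim_eq' {n : ℕ} (F : Finset (Finset (Fin n))) : vcDim F = F.vcDim := by
  unfold vcDim
  have hb : BddAbove {d : ℕ | ∃ S : Finset (Fin n), Shatters F S ∧ S.card = d} := by
    refine ⟨F.vcDim, ?_⟩
    rintro d ⟨S, hS, rfl⟩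
    exact ((shatters_iff' F S).1 hS).card_le_vcDim
  apply le_antisymm
  · apply csSup_le'
    rintro d ⟨S, hS, rfl⟩
    exact ((shatters_iff' F S).1 hS).card_le_vcDim
  · unfold Finset.vcDim
    apply Finset.sup_le
    intro S hS
    exact le_csSup hb ⟨S, (shatters_iff' F S).2 (by simpa using hS), rfl⟩

theorem natCard_shatters {n : ℕ} (F : Finset (Finset (Fin n))) :
    Nat.card {S : Finset (Fin n) // Shatters F S} = F.shatterer.card := by
  exact Nat.subtype_card F.shatterer (fun S => by rw [Finset.mem_shatterer, shatters_iff'])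

theorem sauer {n : ℕ} (F : Finset (Finset (Fin n))) :
    F.shatterer.card ≤ ∑ i ∈ Finset.range (vcDim F + 1), n.choose i := by
  have h := Finset.card_shatterer_le_sum_vcDim (𝒜 := F)
  rw [Fintype.card_fin, ← vcDim_eq'] at h
  rwa [Nat.range_succ_eq_Iic]

theorem maxFam_le_exVC (n k : ℕ) : maxFamCount n k ≤ exVC n k := by
  unfold maxFamCount exVC
  apply Nat.card_le_card_of_injective
    (fun F => ⟨F.1, by
      obtain ⟨F, hF, hk⟩ := F
      refine ⟨?_, hk.le⟩
      rw [natCard_shatters]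
      unfold IsMaximal at hF
      have h1 := sauer F
      have h2 := F.card_le_card_shatterer
      change F.shatterer.card = F.card
      omega⟩ : {F : Finset (Finset (Fin n)) // IsMaximal F ∧ vcDim F = k} → _)
  intro a b h
  simpa [Subtype.ext_iff] using h

/-- Every nonempty proper subfamily has a cube edge leaving it. -/
def CubeConn {n : ℕ} (F : Finset (Finset (Fin n))) : Prop :=
  ∀ A ⊆ F, A.Nonempty → A ≠ F → ∃ a ∈ A, ∃ i : Fin n, symmDiff a {i} ∈ F ∧ symmDiff a {i} ∉ A

theorem shatterer_split {n : ℕ} (F : Finset (Finset (Fin n))) (i : Fin n) :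
    (F.filter (i ∉ ·)).shatterer.card + (F.filter (i ∈ ·)).shatterer.card ≤ F.shatterer.card := by
  classical
  set F0 := F.filter (i ∉ ·) with hF0
  set F1 := F.filter (i ∈ ·) with hF1
  have h0 : ∀ S, F0.Shatters S → i ∉ S := by
    intro S hS hi
    obtain ⟨u, hu, he⟩ := hS (Finset.Subset.refl S)
    have : i ∈ S ∩ u := by rw [he]; exact hi
    simp [hF0] at hu
    exact hu.2 (Finset.mem_inter.1 this).2
  have h1 : ∀ S, F1.Shatters S → i ∉ S := by
    intro S hS hi
    obtain ⟨u, hu, he⟩ := hS (Finset.empty_subset S)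
    simp [hF1] at hu
    have : i ∈ S ∩ u := Finset.mem_inter.2 ⟨hi, hu.2⟩
    rw [he] at this
    simp at this
  rw [← Finset.card_union_add_card_inter]
  have hinj : ((F0.shatterer ∩ F1.shatterer).image (insert i)).card
      = (F0.shatterer ∩ F1.shatterer).card := by
    apply Finset.card_image_of_injOn
    intro a ha b hb hab
    simp at ha hb
    have ha' := h0 a ha.1
    have hb' := h0 b hb.1
    have := congrArg (fun s => Finset.erase s i) hab
    simpa [Finset.erase_insert ha', Finset.erase_insert hb'] using this
  rw [← hinj, ← Finset.card_union_of_disjoint]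
  · apply Finset.card_le_card
    intro S hS
    simp only [Finset.mem_union, Finset.mem_image, Finset.mem_inter, Finset.mem_shatterer] at hS ⊢
    rcases hS with (h | h) | ⟨T, ⟨hT0, hT1⟩, rfl⟩
    · exact h.mono_left (Finset.filter_subset _ _)
    · exact h.mono_left (Finset.filter_subset _ _)
    · intro t ht
      have hiT := h0 T hT0
      by_cases hit : i ∈ t
      · obtain ⟨u, hu, he⟩ := hT1 (show t.erase i ⊆ T by
          intro x hx
          have := ht (Finset.mem_of_mem_erase hx)
          simp at this hx
          tauto)
        simp [hF1] at hu
        refine ⟨u, hu.1, ?_⟩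
        rw [Finset.insert_inter_of_mem hu.2, he, Finset.insert_erase hit]
      · obtain ⟨u, hu, he⟩ := hT0 (show t ⊆ T by
          intro x hx
          have := ht hx
          simp at this
          rcases this with rfl | h
          · exact absurd hx hit
          · exact h)
        simp [hF0] at hu
        refine ⟨u, hu.1, ?_⟩
        rw [Finset.insert_inter_of_notMem hu.2, he]
  · rw [Finset.disjoint_left]
    intro S hS hS'
    simp only [Finset.mem_union, Finset.mem_image, Finset.mem_shatterer] at hS hS'
    obtain ⟨T, -, rfl⟩ := hS'
    rcases hS with h | h
    · exact h0 _ h (Finset.mem_insert_self _ _)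
    · exact h1 _ h (Finset.mem_insert_self _ _)

theorem exists_edge_dir {n : ℕ} (F : Finset (Finset (Fin n))) (hF : F.shatterer.card = F.card)
    (i : Fin n) (h0 : (F.filter (i ∉ ·)).Nonempty) (h1 : (F.filter (i ∈ ·)).Nonempty) :
    ∃ a ∈ F, i ∉ a ∧ insert i a ∈ F := by
  classical
  by_contra! hcon
  set G := F.image (fun B => B.erase i) with hG
  have hc : G.card = F.card := by
    apply Finset.card_image_of_injOn
    intro a ha b hb hab
    simp only at hab
    by_cases hia : i ∈ a <;> by_cases hib : i ∈ b
    · rw [← Finset.insert_erase hia, ← Finset.insert_erase hib, hab]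
    · exfalso
      apply hcon b hb hib
      rw [Finset.erase_eq_of_notMem hib] at hab
      rw [← hab, Finset.insert_erase hia]; exact ha
    · exfalso
      apply hcon a ha hia
      rw [Finset.erase_eq_of_notMem hia] at hab
      rw [hab, Finset.insert_erase hib]; exact hb
    · rwa [Finset.erase_eq_of_notMem hia, Finset.erase_eq_of_notMem hib] at hab
  have hi : ∀ S, G.Shatters S → i ∉ S := by
    intro S hS hiS
    obtain ⟨u, hu, he⟩ := hS (Finset.Subset.refl S)
    simp only [hG, Finset.mem_image] at hu
    obtain ⟨v, hv, rfl⟩ := hu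
    have : i ∈ S ∩ v.erase i := by rw [he]; exact hiS
    simp at this
  have hss : G.shatterer ⊂ F.shatterer := by
    rw [Finset.ssubset_iff_of_subset]
    · refine ⟨{i}, ?_, ?_⟩
      · rw [Finset.mem_shatterer]
        intro t ht
        rcases Finset.subset_singleton_iff.1 ht with rfl | rfl
        · obtain ⟨a, ha⟩ := h0
          simp at ha
          exact ⟨a, ha.1, by ext x; simp; rintro rfl; exact ha.2⟩
        · obtain ⟨a, ha⟩ := h1
          simp at ha
          exact ⟨a, ha.1, by ext x; simp; rintro rfl; exact ha.2⟩
      · rw [Finset.mem_shatterer]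
        intro h
        exact hi _ h (Finset.mem_singleton_self i)
    · intro S hS
      rw [Finset.mem_shatterer] at hS ⊢
      intro t ht
      have hiS := hi S hS
      obtain ⟨u, hu, he⟩ := hS ht
      simp only [hG, Finset.mem_image] at hu
      obtain ⟨v, hv, rfl⟩ := hu
      refine ⟨v, hv, ?_⟩
      rw [← he]
      ext x
      simp only [Finset.mem_inter, Finset.mem_erase]
      constructor
      · rintro ⟨h, h'⟩
        exact ⟨h, by rintro rfl; exact hiS h, h'⟩
      · tauto
  have := Finset.card_lt_card hss
  have := G.card_le_card_shatterer
  omega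

theorem extremal_conn {n : ℕ} : ∀ (m : ℕ) (F : Finset (Finset (Fin n))), F.card = m →
    F.shatterer.card = F.card → CubeConn F := by
  classical
  intro m
  induction m using Nat.strong_induction_on with
  | _ m ih =>
  intro F hm hF A hAF hAne hAF'
  obtain ⟨x, hx⟩ := hAne
  obtain ⟨y, hyF, hyA⟩ : ∃ y ∈ F, y ∉ A := by
    by_contra! h
    exact hAF' (Finset.Subset.antisymm hAF h)
  have hxy : x ≠ y := by rintro rfl; exact hyA hx
  obtain ⟨i, hi⟩ : ∃ i, ¬ (i ∈ x ↔ i ∈ y) := by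
    by_contra! h
    exact hxy (Finset.ext h)
  have hne : (F.filter (i ∉ ·)).Nonempty ∧ (F.filter (i ∈ ·)).Nonempty := by
    by_cases h : i ∈ x
    · exact ⟨⟨y, by simp; exact ⟨hyF, by tauto⟩⟩, ⟨x, by simp; exact ⟨hAF hx, h⟩⟩⟩
    · exact ⟨⟨x, by simp; exact ⟨hAF hx, h⟩⟩, ⟨y, by simp; exact ⟨hyF, by tauto⟩⟩⟩
  obtain ⟨a, haF, hia, haF'⟩ := exists_edge_dir F hF i hne.1 hne.2
  have hsum : (F.filter (i ∈ ·)).card + (F.filter (i ∉ ·)).card = F.card :=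
    Finset.card_filter_add_card_filter_not _
  have hsp := shatterer_split F i
  have e0 := (F.filter (i ∉ ·)).card_le_card_shatterer
  have e1 := (F.filter (i ∈ ·)).card_le_card_shatterer
  have p0 := hne.1.card_pos
  have p1 := hne.2.card_pos
  have c0 := ih _ (by omega) (F.filter (i ∉ ·)) rfl (by omega)
  have c1 := ih _ (by omega) (F.filter (i ∈ ·)) rfl (by omega)
  have key : ∀ (p : Finset (Fin n) → Prop) [DecidablePred p], CubeConn (F.filter p) →
      (A.filter p).Nonempty → A.filter p ≠ F.filter p →
      ∃ a ∈ A, ∃ i : Fin n, symmDiff a {i} ∈ F ∧ symmDiff a {i} ∉ A := by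
    intro p _ hc h1 h2
    obtain ⟨a, ha, j, hj, hj'⟩ := hc (A.filter p) (Finset.filter_subset_filter _ hAF) h1 h2
    simp only [Finset.mem_filter] at ha hj hj'
    exact ⟨a, ha.1, j, hj.1, fun h => hj' ⟨h, hj.2⟩⟩
  have sd1 : symmDiff a {i} = insert i a := by
    ext z; simp [Finset.mem_symmDiff]
    by_cases h : z = i
    · subst h; simp [hia]
    · simp [h]
  have sd2 : symmDiff (insert i a) {i} = a := by
    rw [← sd1, symmDiff_symmDiff_cancel_right]
  by_cases haA : a ∈ A
  · by_cases haA' : insert i a ∈ A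
    · by_cases q : A.filter (i ∉ ·) = F.filter (i ∉ ·)
      · apply key (i ∈ ·) c1 ⟨insert i a, by simp [haA']⟩
        intro q'
        apply hyA
        by_cases hiy : i ∈ y
        · exact Finset.filter_subset _ _ (q' ▸ (by simp [hyF, hiy] : y ∈ F.filter (i ∈ ·)))
        · exact Finset.filter_subset _ _ (q ▸ (by simp [hyF, hiy] : y ∈ F.filter (i ∉ ·)))
      · exact key (i ∉ ·) c0 ⟨a, by simp [haA, hia]⟩ q
    · exact ⟨a, haA, i, by rw [sd1]; exact ⟨haF', haA'⟩⟩
  · by_cases haA' : insert i a ∈ A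
    · exact ⟨insert i a, haA', i, by rw [sd2]; exact ⟨haF, haA⟩⟩
    · by_cases hix : i ∈ x
      · apply key (i ∈ ·) c1 ⟨x, by simp [hx, hix]⟩
        intro q
        have : insert i a ∈ F.filter (i ∈ ·) := by simp [haF']
        rw [← q] at this
        exact haA' (Finset.mem_filter.1 this).1
      · apply key (i ∉ ·) c0 ⟨x, by simp [hx, hix]⟩
        intro q
        have : a ∈ F.filter (i ∉ ·) := by simp [haF, hia]
        rw [← q] at this
        exact haA (Finset.mem_filter.1 this).1

theorem conn_count {n m : ℕ} (hn : 2 ≤ n) : ∀ (d : ℕ) (A X : Finset (Finset (Fin n))),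
    A.Nonempty → A.card ≤ m →
    X ⊆ A.biUnion (fun a => Finset.univ.image (fun i : Fin n => symmDiff a {i})) →
    (m - A.card) + (n * m - X.card) ≤ d →
    (Nat.card {S : Finset (Finset (Fin n)) // CubeConn S ∧ S.card ≤ m ∧ A ⊆ S ∧ Disjoint S X} : ℝ)
      ≤ (n : ℝ) ^ (m - A.card) * ((n : ℝ) / (n - 1)) ^ (n * m - X.card) := by
  classical
  have hn' : (2 : ℝ) ≤ n := by exact_mod_cast hn
  have hr : 1 ≤ (n : ℝ) / (n - 1) := by
    rw [le_div_iff₀ (by linarith)]; linarith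
  intro d
  induction d with
  | zero =>
    intro A X hA hAm hX hd
    have hone : (1 : ℝ) ≤ (n : ℝ) ^ (m - A.card) * ((n : ℝ) / (n - 1)) ^ (n * m - X.card) :=
      one_le_mul_of_one_le_of_one_le (one_le_pow₀ (by linarith)) (one_le_pow₀ hr)
    refine le_trans ?_ hone
    have : Subsingleton {S : Finset (Finset (Fin n)) //
        CubeConn S ∧ S.card ≤ m ∧ A ⊆ S ∧ Disjoint S X} := by
      constructor
      rintro ⟨S, hS1, hS2, hS3, hS4⟩ ⟨T, hT1, hT2, hT3, hT4⟩
      have e1 := Finset.eq_of_subset_of_card_le hS3 (by omega)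
      have e2 := Finset.eq_of_subset_of_card_le hT3 (by omega)
      simp [← e1, ← e2]
    exact_mod_cast Finite.card_le_one_iff_subsingleton.2 this
  | succ d ih =>
    intro A X hA hAm hX hd
    have hone : (1 : ℝ) ≤ (n : ℝ) ^ (m - A.card) * ((n : ℝ) / (n - 1)) ^ (n * m - X.card) :=
      one_le_mul_of_one_le_of_one_le (one_le_pow₀ (by linarith)) (one_le_pow₀ hr)
    have hsub : (∀ S : Finset (Finset (Fin n)), CubeConn S → S.card ≤ m → A ⊆ S → Disjoint S X →
        S = A) → (Nat.card {S : Finset (Finset (Fin n)) //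
        CubeConn S ∧ S.card ≤ m ∧ A ⊆ S ∧ Disjoint S X} : ℝ)
      ≤ (n : ℝ) ^ (m - A.card) * ((n : ℝ) / (n - 1)) ^ (n * m - X.card) := by
      intro h
      refine le_trans ?_ hone
      have : Subsingleton {S : Finset (Finset (Fin n)) //
          CubeConn S ∧ S.card ≤ m ∧ A ⊆ S ∧ Disjoint S X} := by
        constructor
        rintro ⟨S, hS1, hS2, hS3, hS4⟩ ⟨T, hT1, hT2, hT3, hT4⟩
        simp [h S hS1 hS2 hS3 hS4, h T hT1 hT2 hT3 hT4]
      exact_mod_cast Finite.card_le_one_iff_subsingleton.2 this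
    by_cases hAm' : A.card = m
    · apply hsub
      intro S _ h2 h3 _
      exact (Finset.eq_of_subset_of_card_le h3 (by omega)).symm
    by_cases hw : ∃ w, w ∈ A.biUnion (fun a => Finset.univ.image (fun i : Fin n => symmDiff a {i})) ∧
        w ∉ A ∧ w ∉ X
    · obtain ⟨w, hwN, hwA, hwX⟩ := hw
      have cA : (insert w A).card = A.card + 1 := Finset.card_insert_of_notMem hwA
      have cX : (insert w X).card = X.card + 1 := Finset.card_insert_of_notMem hwX
      have hX' : insert w X ⊆
          A.biUnion (fun a => Finset.univ.image (fun i : Fin n => symmDiff a {i})) :=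
        Finset.insert_subset hwN hX
      have hXc : X.card + 1 ≤ n * m := by
        rw [← cX]
        calc (insert w X).card ≤ _ := Finset.card_le_card hX'
          _ ≤ A.card * n := by
            apply Finset.card_biUnion_le_card_mul
            intro a _
            exact Finset.card_image_le.trans (by simp)
          _ ≤ n * m := by rw [mul_comm]; exact Nat.mul_le_mul_left _ hAm
      have i1 := ih (insert w A) X (Finset.insert_nonempty _ _) (by omega)
        (hX.trans (Finset.biUnion_subset_biUnion_of_subset_left _ (Finset.subset_insert _ _)))
        (by omega)
      have i2 := ih A (insert w X) hA hAm hX' (by omega)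
      rw [cA] at i1
      rw [cX] at i2
      have hsplit : Nat.card {S : Finset (Finset (Fin n)) //
          CubeConn S ∧ S.card ≤ m ∧ A ⊆ S ∧ Disjoint S X} ≤
          Nat.card {S : Finset (Finset (Fin n)) //
            CubeConn S ∧ S.card ≤ m ∧ insert w A ⊆ S ∧ Disjoint S X} +
          Nat.card {S : Finset (Finset (Fin n)) //
            CubeConn S ∧ S.card ≤ m ∧ A ⊆ S ∧ Disjoint S (insert w X)} := by
        simp only [Nat.card_eq_fintype_card, Fintype.card_subtype]
        refine le_trans (Finset.card_le_card ?_) (Finset.card_union_le _ _)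
        intro S hS
        simp only [Finset.mem_filter, Finset.mem_univ, true_and, Finset.mem_union,
          Finset.insert_subset_iff, Finset.disjoint_insert_right] at hS ⊢
        tauto
      have hsplit' := (Nat.cast_le (α := ℝ)).2 hsplit
      push_cast at hsplit'
      refine hsplit'.trans ((add_le_add i1 i2).trans (le_of_eq ?_))
      obtain ⟨a, ha⟩ : ∃ a, m - A.card = a + 1 := ⟨m - A.card - 1, by omega⟩
      obtain ⟨b, hb⟩ : ∃ b, n * m - X.card = b + 1 := ⟨n * m - X.card - 1, by omega⟩
      rw [show m - (A.card + 1) = a by omega, show n * m - (X.card + 1) = b by omega, ha, hb]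
      have : (n : ℝ) - 1 ≠ 0 := by linarith
      rw [pow_succ, pow_succ]
      field_simp
      ring
    · push Not at hw
      apply hsub
      intro S hS h2 h3 h4
      by_contra hne
      obtain ⟨a, ha, i, hi, hi'⟩ := hS A h3 hA (Ne.symm hne)
      have := hw (symmDiff a {i}) (by
        simp only [Finset.mem_biUnion, Finset.mem_image, Finset.mem_univ, true_and]
        exact ⟨a, ha, i, rfl⟩) hi'
      exact Finset.disjoint_left.1 h4 hi this

theorem exVC_le {n k m : ℕ} (hn : 2 ≤ n) (hm : m = ∑ i ∈ Finset.range (k + 1), n.choose i) :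
    (exVC n k : ℝ) ≤ 1 + 2 ^ n * (9 * n) ^ m := by
  classical
  have hn' : (2 : ℝ) ≤ n := by exact_mod_cast hn
  have hr : 1 ≤ (n : ℝ) / (n - 1) := by
    rw [le_div_iff₀ (by linarith)]; linarith
  have hpow : ((n : ℝ) / (n - 1)) ^ n ≤ 9 := by
    have h1 : (n : ℝ) / (n - 1) ≤ Real.exp (1 / (n - 1)) := by
      have := Real.add_one_le_exp (1 / ((n : ℝ) - 1))
      refine le_trans (le_of_eq ?_) this
      have : (n : ℝ) - 1 ≠ 0 := by linarith
      field_simp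
      ring
    have h2 : ((n : ℝ) / (n - 1)) ^ n ≤ Real.exp 2 := by
      calc ((n : ℝ) / (n - 1)) ^ n ≤ (Real.exp (1 / (n - 1))) ^ n :=
            pow_le_pow_left₀ (by linarith) h1 n
        _ = Real.exp (n * (1 / (n - 1))) := (Real.exp_nat_mul _ _).symm
        _ ≤ Real.exp 2 := by
            apply Real.exp_le_exp.2
            rw [mul_one_div, div_le_iff₀ (by linarith)]
            linarith
    have h3 : Real.exp 2 = Real.exp 1 * Real.exp 1 := by rw [← Real.exp_add]; norm_num
    have h4 := Real.exp_one_lt_d9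
    have h5 := Real.exp_pos 1
    nlinarith
  have hm1 : 1 ≤ m := by
    rw [hm, Finset.sum_range_succ']
    simp
  have hroot : ∀ v : Finset (Fin n), (Nat.card {S : Finset (Finset (Fin n)) //
      CubeConn S ∧ S.card ≤ m ∧ {v} ⊆ S ∧ Disjoint S ∅} : ℝ) ≤ (9 * n) ^ m := by
    intro v
    refine (conn_count hn _ {v} ∅ (by simp) (by simpa using hm1) (by simp) le_rfl).trans ?_
    simp only [Finset.card_singleton, Finset.card_empty, Nat.sub_zero]
    rw [mul_pow, mul_comm, pow_mul]
    apply mul_le_mul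
    · exact pow_le_pow_left₀ (by positivity) hpow m
    · exact pow_le_pow_right₀ (by linarith) (by omega)
    · positivity
    · positivity
  have hcover : exVC n k ≤ 1 + ∑ v : Finset (Fin n), Nat.card {S : Finset (Finset (Fin n)) //
      CubeConn S ∧ S.card ≤ m ∧ {v} ⊆ S ∧ Disjoint S ∅} := by
    unfold exVC
    simp only [natCard_shatters]
    simp only [Nat.card_eq_fintype_card, Fintype.card_subtype]
    calc _ ≤ ({∅} ∪ (Finset.univ.biUnion fun v : Finset (Fin n) =>
          Finset.univ.filter fun S : Finset (Finset (Fin n)) =>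
            CubeConn S ∧ S.card ≤ m ∧ {v} ⊆ S ∧ Disjoint S ∅)).card := by
          apply Finset.card_le_card
          intro F hF
          simp only [Finset.mem_filter, Finset.mem_univ, true_and] at hF
          rcases Finset.eq_empty_or_nonempty F with rfl | ⟨v, hv⟩
          · simp
          · apply Finset.mem_union_right
            simp only [Finset.mem_biUnion, Finset.mem_filter, Finset.mem_univ, true_and]
            refine ⟨v, extremal_conn _ F rfl hF.1, ?_, by simpa using hv, by simp⟩
            rw [← hF.1, hm]
            refine (sauer F).trans (Finset.sum_le_sum_of_subset ?_)
            intro x hx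
            simp at hx ⊢
            omega
      _ ≤ _ := by
          refine (Finset.card_union_le _ _).trans ?_
          rw [Finset.card_singleton]
          exact Nat.add_le_add_left Finset.card_biUnion_le _
  have hc := (Nat.cast_le (α := ℝ)).2 hcover
  refine hc.trans ?_
  push_cast
  apply add_le_add le_rfl
  refine (Finset.sum_le_sum (fun v _ => hroot v)).trans ?_
  simp

theorem indMat_le_maxFam (n k : ℕ) (hk : k ≤ n) : indMat n k ≤ maxFamCount n k := by
  classical
  unfold indMat maxFamCount
  let G : Finset (Finset (Fin n) × Finset (Fin n)) → Finset (Finset (Fin n)) := fun M =>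
    ((Finset.univ.filter fun A : Finset (Fin n) => A.card ≤ k) \ M.image Prod.fst) ∪ M.image Prod.snd
  have memG : ∀ M B, B ∈ G M ↔ (B.card ≤ k ∧ ∀ e ∈ M, e.1 ≠ B) ∨ ∃ e ∈ M, e.2 = B := by
    intro M B
    simp only [G, Finset.mem_union, Finset.mem_sdiff, Finset.mem_filter, Finset.mem_univ, true_and,
      Finset.mem_image, not_exists, not_and]
  have hvc : ∀ M, IsInducedMatching n k M → vcDim (G M) ≤ k := by
    intro M hM
    by_contra hlt
    push Not at hlt
    obtain ⟨S, hS, hSc⟩ : ∃ S, (G M).Shatters S ∧ S.card = k + 1 := by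
      have : ∃ T, (G M).Shatters T ∧ k + 1 ≤ T.card := by
        by_contra! hno
        have : (G M).vcDim ≤ k := by
          unfold Finset.vcDim
          apply Finset.sup_le
          intro T hT
          have := hno T (by simpa using hT)
          omega
        rw [vcDim_eq'] at hlt
        omega
      obtain ⟨T, hT, hc⟩ := this
      obtain ⟨S, hS, hSc⟩ := Finset.exists_subset_card_eq hc
      exact ⟨S, hT.mono_right hS, hSc⟩
    have hcard : ∀ B ∈ G M, B.card ≤ k + 1 := by
      intro B hB
      rcases (memG M B).1 hB with h | ⟨e, he, rfl⟩
      · omega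
      · exact (hM.1 e he).2.1.le
    obtain ⟨B, hB, hBS⟩ := hS (Finset.Subset.refl S)
    have hSB : S = B := Finset.eq_of_subset_of_card_le (Finset.inter_eq_left.1 hBS)
      (by have := hcard B hB; omega)
    subst hSB
    rcases (memG M S).1 hB with h | ⟨e, he, rfl⟩
    · omega
    obtain ⟨he1, he2, he3⟩ := hM.1 e he
    obtain ⟨B, hB', hBe⟩ := hS he3
    have hsub : e.1 ⊆ B := by rw [← hBe]; exact Finset.inter_subset_right
    rcases (memG M B).1 hB' with h | ⟨e', he', rfl⟩
    · exact h.2 e he (Finset.eq_of_subset_of_card_le hsub (by omega))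
    · by_cases hee : e = e'
      · subst hee
        rw [Finset.inter_self] at hBe
        rw [hBe] at he2
        omega
      · exact (hM.2 e he e' he' hee).2.2.1 hsub
  have hlow : (Finset.univ.filter fun A : Finset (Fin n) => A.card ≤ k).card
      = ∑ i ∈ Finset.range (k + 1), n.choose i := by
    rw [Finset.card_eq_sum_card_fiberwise (f := Finset.card) (t := Finset.range (k + 1))]
    · apply Finset.sum_congr rfl
      intro i hi
      rw [Finset.mem_range] at hi
      rw [← Finset.card_fin n, ← Finset.card_powersetCard, Finset.card_fin]
      congr 1
      ext A
      simp only [Finset.mem_filter, Finset.mem_univ, true_and, Finset.mem_powersetCard,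
        Finset.subset_univ]
      omega
    · intro A hA
      simp at hA ⊢
      omega
  have hcard : ∀ M, IsInducedMatching n k M →
      (G M).card = ∑ i ∈ Finset.range (k + 1), n.choose i := by
    intro M hM
    have h1 : (M.image Prod.fst).card = M.card := by
      apply Finset.card_image_of_injOn
      intro e he e' he' h
      by_contra hne
      exact (hM.2 e he e' he' hne).1 h
    have h2 : (M.image Prod.snd).card = M.card := by
      apply Finset.card_image_of_injOn
      intro e he e' he' h
      by_contra hne
      exact (hM.2 e he e' he' hne).2.1 h
    have h3 : M.image Prod.fst ⊆ Finset.univ.filter fun A : Finset (Fin n) => A.card ≤ k := by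
      intro A hA
      obtain ⟨e, he, rfl⟩ := Finset.mem_image.1 hA
      simp [(hM.1 e he).1]
    have h4 := Finset.card_le_card h3
    simp only [G]
    rw [Finset.card_union_of_disjoint, Finset.card_sdiff_of_subset h3, ← hlow]
    · omega
    · rw [Finset.disjoint_left]
      intro A hA hA'
      obtain ⟨e, he, rfl⟩ := Finset.mem_image.1 hA'
      have := (hM.1 e he).2.1
      simp at hA
      omega
  have hvc' : ∀ M, IsInducedMatching n k M → vcDim (G M) = k := by
    intro M hM
    apply le_antisymm (hvc M hM)
    by_contra hlt
    push Not at hlt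
    have h1 := (G M).card_le_card_shatterer.trans (sauer (G M))
    rw [hcard M hM] at h1
    have h2 : ∑ i ∈ Finset.range (vcDim (G M) + 1), n.choose i ≤ ∑ i ∈ Finset.range k, n.choose i := by
      apply Finset.sum_le_sum_of_subset
      intro x hx
      simp at hx ⊢
      omega
    rw [Finset.sum_range_succ] at h1
    have := Nat.choose_pos hk
    omega
  apply Nat.card_le_card_of_injective
    (fun M => ⟨G M.1, by
      unfold IsMaximal
      rw [hvc' M.1 M.2]
      exact ⟨hcard M.1 M.2, rfl⟩⟩ : {M // IsInducedMatching n k M} →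
        {F : Finset (Finset (Fin n)) // IsMaximal F ∧ vcDim F = k})
  have hle : ∀ M M', IsInducedMatching n k M → IsInducedMatching n k M' → G M = G M' → M ⊆ M' := by
    intro M M' hM hM' h e he
    obtain ⟨c1, c2, c3⟩ := hM.1 e he
    have h2 : e.2 ∈ G M := (memG M _).2 (Or.inr ⟨e, he, rfl⟩)
    rw [h] at h2
    have h1 : e.1 ∉ G M := by
      intro hh
      rcases (memG M _).1 hh with h | ⟨e', he', h⟩
      · exact h.2 e he rfl
      · have := (hM.1 e' he').2.1
        rw [h] at this
        omega
    rw [h] at h1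
    rcases (memG M' _).1 h2 with q | ⟨e', he', q⟩
    · omega
    have : ∃ e'' ∈ M', e''.1 = e.1 := by
      by_contra! hno
      exact h1 ((memG M' _).2 (Or.inl ⟨c1.le, hno⟩))
    obtain ⟨e'', he'', q'⟩ := this
    have : e'' = e' := by
      by_contra hne
      apply (hM'.2 e'' he'' e' he' hne).2.2.1
      rw [q', q]
      exact c3
    subst this
    rw [show e = e'' from Prod.ext q'.symm q.symm]
    exact he''
  rintro ⟨M, hM⟩ ⟨M', hM'⟩ h
  simp only [Subtype.mk.injEq] at h ⊢
  exact Finset.Subset.antisymm (hle M M' hM hM' h) (hle M' M hM' hM h.symm)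

theorem indMat_ge (n k y : ℕ) (hy : y ≤ n) : y ^ ((n - y).choose k) ≤ indMat n k := by
  classical
  obtain ⟨Y, -, hY⟩ := Finset.exists_subset_card_eq
    (show y ≤ (Finset.univ : Finset (Fin n)).card by simpa using hy)
  let P := Finset.powersetCard k Yᶜ
  have hP : P.card = (n - y).choose k := by
    simp [P, Finset.card_powersetCard, Finset.card_compl, hY]
  have hcard : Nat.card ({A // A ∈ P} → {x // x ∈ Y}) = y ^ ((n - y).choose k) := by
    rw [Nat.card_fun]
    simp [hP, hY]
  rw [← hcard]
  unfold indMat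
  let G : ({A // A ∈ P} → {x // x ∈ Y}) → Finset (Finset (Fin n) × Finset (Fin n)) := fun f =>
    Finset.univ.image fun A => (A.1, insert (f A).1 A.1)
  have hG : ∀ f, IsInducedMatching n k (G f) := by
    intro f
    have hsub : ∀ A B : {A // A ∈ P}, A.1 ⊆ insert (f B).1 B.1 → A = B := by
      rintro ⟨A, hA⟩ ⟨B, hB⟩ h
      apply Subtype.ext
      have hA' := Finset.mem_powersetCard.1 hA
      have hB' := Finset.mem_powersetCard.1 hB
      apply Finset.eq_of_subset_of_card_le
      · intro x hx
        rcases Finset.mem_insert.1 (h hx) with hx' | hx'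
        · have := hA'.1 hx
          rw [Finset.mem_compl, hx'] at this
          exact absurd (f ⟨B, hB⟩).2 this
        · exact hx'
      · simp only
        omega
    constructor
    · intro e he
      obtain ⟨A, -, rfl⟩ := Finset.mem_image.1 he
      have hA' := Finset.mem_powersetCard.1 A.2
      refine ⟨hA'.2, ?_, Finset.subset_insert _ _⟩
      simp only
      rw [Finset.card_insert_of_notMem, hA'.2]
      intro h
      exact Finset.mem_compl.1 (hA'.1 h) (f A).2
    · intro e he e' he' hne
      obtain ⟨A, -, rfl⟩ := Finset.mem_image.1 he
      obtain ⟨B, -, rfl⟩ := Finset.mem_image.1 he'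
      have hAB : A ≠ B := by rintro rfl; exact hne rfl
      refine ⟨fun h => hAB (Subtype.ext h), fun h => hAB (hsub A B ?_), fun h => hAB (hsub A B h),
        fun h => hAB (hsub B A h).symm⟩
      simp only at h
      rw [← h]
      exact Finset.subset_insert _ _
  apply Nat.card_le_card_of_injective
    (fun f => ⟨G f, hG f⟩ : _ → {M // IsInducedMatching n k M})
  intro f g hfg
  simp only [Subtype.mk.injEq] at hfg
  funext A
  have : (A.1, insert (f A).1 A.1) ∈ G g := by
    rw [← hfg]
    exact Finset.mem_image_of_mem _ (Finset.mem_univ A)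
  obtain ⟨B, -, hB⟩ := Finset.mem_image.1 this
  simp only [Prod.mk.injEq] at hB
  obtain ⟨h1, h2⟩ := hB
  have hBA : B = A := Subtype.ext h1
  subst hBA
  have hA' := Finset.mem_powersetCard.1 B.2
  have hm : (f B).1 ∈ insert (g B).1 B.1 := by rw [h2]; exact Finset.mem_insert_self _ _
  rcases Finset.mem_insert.1 hm with h | h
  · exact Subtype.ext h
  · exact absurd (f B).2 (Finset.mem_compl.1 (hA'.1 h))

theorem choose_sub_ge (n k : ℕ) : ∀ y, y ≤ n →
    n.choose (k + 1) ≤ (n - y).choose (k + 1) + y * (n - 1).choose k := by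
  intro y
  induction y with
  | zero => simp
  | succ y ih =>
    intro hy
    have h1 := ih (by omega)
    obtain ⟨a, ha⟩ : ∃ a, n - y = a + 1 := ⟨n - y - 1, by omega⟩
    rw [ha, Nat.choose_succ_succ] at h1
    rw [show n - (y + 1) = a by omega]
    have h2 : a.choose k ≤ (n - 1).choose k := Nat.choose_le_choose k (by omega)
    nlinarith

theorem choose_ratio (n L i : ℕ) (h : (L + 1) * (i + 1) ≤ n) :
    L * n.choose i ≤ n.choose (i + 1) := by
  have h1 := Nat.choose_succ_right_eq n i
  have h2 : L * (i + 1) ≤ n - i := by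
    have : (L + 1) * (i + 1) = L * (i + 1) + i + 1 := by ring
    omega
  have h3 : L * n.choose i * (i + 1) ≤ n.choose (i + 1) * (i + 1) := by
    rw [h1]
    calc L * n.choose i * (i + 1) = n.choose i * (L * (i + 1)) := by ring
      _ ≤ _ := Nat.mul_le_mul_left _ h2
  exact Nat.le_of_mul_le_mul_right h3 (by omega)

theorem choose_sum (n L : ℕ) : ∀ k, (L + 2) * k ≤ n →
    L * ∑ i ∈ Finset.range k, n.choose i ≤ n.choose k := by
  intro k
  induction k with
  | zero => simp
  | succ k ih =>
    intro h
    have h1 := ih (by nlinarith)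
    have h2 := choose_ratio n (L + 1) k (by linarith)
    rw [Finset.sum_range_succ]
    nlinarith

theorem lower_bound {n k : ℕ} {ε : ℝ} (hn : 2 ≤ n) (hk : 0 < k) (he : 0 < ε)
    (hkn : (k : ℝ) ≤ (n : ℝ) ^ (ε / 4)) (hbig : 4 / ε ≤ (n : ℝ) ^ (ε / 4)) :
    (n : ℝ) ^ ((1 - ε) * (n.choose k : ℝ)) ≤ (indMat n k : ℝ) := by
  have hn' : (2 : ℝ) ≤ n := by exact_mod_cast hn
  have hn0 : (0 : ℝ) < n := by linarith
  have hC : (0 : ℝ) ≤ n.choose k := by positivity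
  rcases le_or_gt 1 ε with h1 | h1
  · have : (1 : ℝ) ≤ indMat n k := by
      have := indMat_ge n k 1 (by omega)
      rw [one_pow] at this
      exact_mod_cast this
    refine le_trans (Real.rpow_le_one_of_one_le_of_nonpos (by linarith) ?_) this
    exact mul_nonpos_of_nonpos_of_nonneg (by linarith) hC
  set z : ℝ := (n : ℝ) ^ (1 - ε / 2) with hz
  have hz1 : 1 ≤ z := Real.one_le_rpow (by linarith) (by linarith)
  have hzn : z ≤ n := by
    calc z ≤ (n : ℝ) ^ (1 : ℝ) := Real.rpow_le_rpow_of_exponent_le (by linarith) (by linarith)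
      _ = n := Real.rpow_one _
  set y := ⌈z⌉₊ with hy
  have hyn : y ≤ n := Nat.ceil_le.2 hzn
  have hzy : z ≤ y := Nat.le_ceil z
  have hy2 : (y : ℝ) ≤ 2 * z := by
    have := Nat.ceil_lt_add_one (show 0 ≤ z by linarith)
    rw [← hy] at this
    linarith
  obtain ⟨j, rfl⟩ : ∃ j, k = j + 1 := ⟨k - 1, by omega⟩
  have hky : ((j + 1 : ℕ) : ℝ) * y ≤ ε / 2 * n := by
    set w := (n : ℝ) ^ (ε / 4) with hw
    have hw0 : 0 < w := by positivity
    have hzw : z * w * w = n := by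
      rw [hz, hw, ← Real.rpow_add hn0, ← Real.rpow_add hn0]
      rw [show 1 - ε / 2 + ε / 4 + ε / 4 = 1 by ring, Real.rpow_one]
    have h4 : 4 ≤ ε * w := by
      rw [div_le_iff₀ he] at hbig
      linarith
    calc ((j + 1 : ℕ) : ℝ) * y ≤ w * (2 * z) := mul_le_mul hkn hy2 (by positivity) hw0.le
      _ = (z * w) / 2 * 4 := by ring
      _ ≤ (z * w) / 2 * (ε * w) := by
          apply mul_le_mul_of_nonneg_left h4
          positivity
      _ = ε / 2 * (z * w * w) := by ring
      _ = ε / 2 * n := by rw [hzw]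
  have hch : (1 - ε / 2) * (n.choose (j + 1) : ℝ) ≤ ((n - y).choose (j + 1) : ℝ) := by
    have h1 := choose_sub_ge n j y hyn
    have h1' : (n.choose (j + 1) : ℝ) ≤ (n - y).choose (j + 1) + y * (n - 1).choose j := by
      exact_mod_cast h1
    have h2 : (n : ℝ) * (n - 1).choose j = n.choose (j + 1) * (j + 1 : ℕ) := by
      have := Nat.add_one_mul_choose_eq (n - 1) j
      rw [show n - 1 + 1 = n by omega] at this
      exact_mod_cast this
    have h3 : (y : ℝ) * (n - 1).choose j ≤ ε / 2 * n.choose (j + 1) := by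
      have : (n : ℝ) * (y * (n - 1).choose j) ≤ n * (ε / 2 * n.choose (j + 1)) := by
        calc (n : ℝ) * (y * (n - 1).choose j) = y * (n * (n - 1).choose j) := by ring
          _ = ((j + 1 : ℕ) * y) * n.choose (j + 1) := by rw [h2]; ring
          _ ≤ (ε / 2 * n) * n.choose (j + 1) := mul_le_mul_of_nonneg_right hky hC
          _ = _ := by ring
      exact le_of_mul_le_mul_left this hn0
    linarith
  calc (n : ℝ) ^ ((1 - ε) * (n.choose (j + 1) : ℝ))
      ≤ (n : ℝ) ^ ((1 - ε / 2) * ((n - y).choose (j + 1) : ℝ)) := by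
        apply Real.rpow_le_rpow_of_exponent_le (by linarith)
        calc (1 - ε) * (n.choose (j + 1) : ℝ)
            ≤ (1 - ε / 2) * ((1 - ε / 2) * (n.choose (j + 1) : ℝ)) := by nlinarith [sq_nonneg ε]
          _ ≤ _ := mul_le_mul_of_nonneg_left hch (by linarith)
    _ = z ^ ((n - y).choose (j + 1)) := by
        rw [Real.rpow_mul hn0.le, Real.rpow_natCast]
    _ ≤ (y : ℝ) ^ ((n - y).choose (j + 1)) := pow_le_pow_left₀ (by linarith) hzy _
    _ ≤ _ := by exact_mod_cast indMat_ge n (j + 1) y hyn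

theorem upper_bound {n k L : ℕ} {ε : ℝ} (hn : 2 ≤ n) (hk : 0 < k) (he : 0 < ε)
    (hL : 2 / ε ≤ L) (hL1 : 1 ≤ L) (hkn : (L + 2) * k ≤ n) (hbig : 324 ≤ (n : ℝ) ^ (ε / 2)) :
    (exVC n k : ℝ) ≤ (n : ℝ) ^ ((1 + ε) * (n.choose k : ℝ)) := by
  have hn' : (2 : ℝ) ≤ n := by exact_mod_cast hn
  have hn0 : (0 : ℝ) < n := by linarith
  set C := n.choose k with hC
  have hs := choose_sum n L k hkn
  set s := ∑ i ∈ Finset.range k, n.choose i with hs'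
  have hm := exVC_le (n := n) (k := k) hn rfl
  rw [Finset.sum_range_succ, ← hC, ← hs'] at hm
  have hsC : s ≤ C := by nlinarith
  have hnC : n ≤ C := by
    rcases Nat.lt_or_ge 1 k with h | h
    · refine le_trans ?_ hsC
      have := Finset.single_le_sum (f := fun i => n.choose i) (fun i _ => Nat.zero_le _)
        (Finset.mem_range.2 h)
      simpa using this
    · have : k = 1 := by omega
      subst this
      simp [hC]
  have hsr : (s : ℝ) ≤ ε / 2 * C := by
    have h1 : (L : ℝ) * s ≤ C := by exact_mod_cast hs
    have h2 : 2 / ε * s ≤ C := (mul_le_mul_of_nonneg_right hL (by positivity)).trans h1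
    have h3 : ε / 2 * (2 / ε * s) = s := by field_simp
    rw [← h3]
    exact mul_le_mul_of_nonneg_left h2 (by positivity)
  have hA : (1 : ℝ) ≤ 2 ^ n * (9 * n) ^ (s + C) :=
    one_le_mul_of_one_le_of_one_le (one_le_pow₀ (by norm_num)) (one_le_pow₀ (by linarith))
  calc (exVC n k : ℝ) ≤ 2 * (2 ^ n * (9 * n) ^ (s + C)) := by linarith
    _ = 2 ^ (n + 1) * 9 ^ (s + C) * (n : ℝ) ^ (s + C) := by rw [mul_pow]; ring
    _ ≤ 2 ^ (2 * C) * 9 ^ (2 * C) * (n : ℝ) ^ (s + C) := by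
        gcongr
        · norm_num
        · omega
        · norm_num
        · omega
    _ = 324 ^ C * (n : ℝ) ^ ((s : ℝ) + C) := by
        rw [pow_mul, pow_mul, ← mul_pow]
        norm_num
        rw [← Real.rpow_natCast, Nat.cast_add]
    _ ≤ ((n : ℝ) ^ (ε / 2)) ^ C * (n : ℝ) ^ (ε / 2 * C + C) := by
        apply mul_le_mul
        · exact pow_le_pow_left₀ (by norm_num) hbig C
        · exact Real.rpow_le_rpow_of_exponent_le (by linarith) (by linarith)
        · positivity
        · positivity
    _ = _ := by
        rw [← Real.rpow_natCast, ← Real.rpow_mul hn0.le, ← Real.rpow_add hn0]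
        congr 1
        ring

/-- **Theorem 2.** If `k(n) = n^{o(1)}`, then
`n^{(1+o(1))C(n,k)} ≤ IndMat(n,k) ≤ m(n,k) ≤ ExVC(n,k) ≤ n^{(1+o(1))C(n,k)}`. -/
theorem indMat_maxFam_exVC_chain (k : ℕ → ℕ) (hkpos : ∀ n, 0 < k n)
    (hko : Filter.Tendsto (fun n : ℕ => Real.log (k n) / Real.log n)
      Filter.atTop (nhds 0)) :
    ∀ ε : ℝ, 0 < ε → ∃ N : ℕ, ∀ n : ℕ, N ≤ n →
      (n : ℝ) ^ ((1 - ε) * (n.choose (k n) : ℝ)) ≤ (indMat n (k n) : ℝ) ∧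
      indMat n (k n) ≤ maxFamCount n (k n) ∧
      maxFamCount n (k n) ≤ exVC n (k n) ∧
      (exVC n (k n) : ℝ) ≤ (n : ℝ) ^ ((1 + ε) * (n.choose (k n) : ℝ)) := by
  intro ε he
  have hδ : 0 < min (ε / 4) (1 / 2) := by positivity
  have hpow : ∀ c : ℝ, 0 < c → Filter.Tendsto (fun n : ℕ => (n : ℝ) ^ c) Filter.atTop Filter.atTop :=
    fun c hc => (tendsto_rpow_atTop hc).comp tendsto_natCast_atTop_atTop
  obtain ⟨L, hL⟩ := exists_nat_ge (max (2 / ε) 1)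
  have hL2 : 2 / ε ≤ L := (le_max_left _ _).trans hL
  have hL1 : 1 ≤ L := by exact_mod_cast (le_max_right _ _).trans hL
  have hev : ∀ᶠ n : ℕ in Filter.atTop, 2 ≤ n ∧
      Real.log (k n) / Real.log n < min (ε / 4) (1 / 2) ∧ 4 / ε ≤ (n : ℝ) ^ (ε / 4) ∧
      324 ≤ (n : ℝ) ^ (ε / 2) ∧ (L : ℝ) + 2 ≤ (n : ℝ) ^ (1 / 2 : ℝ) := by
    filter_upwards [Filter.eventually_ge_atTop 2, hko.eventually_lt_const hδ,
      (hpow (ε / 4) (by positivity)).eventually_ge_atTop _,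
      (hpow (ε / 2) (by positivity)).eventually_ge_atTop _,
      (hpow (1 / 2) (by norm_num)).eventually_ge_atTop _] with n h1 h2 h3 h4 h5
    exact ⟨h1, h2, h3, h4, h5⟩
  obtain ⟨N, hN⟩ := Filter.eventually_atTop.1 hev
  refine ⟨N, fun n hn => ?_⟩
  obtain ⟨h1, h2, h3, h4, h5⟩ := hN n hn
  have hn' : (2 : ℝ) ≤ n := by exact_mod_cast h1
  have hn0 : (0 : ℝ) < n := by linarith
  have hlog : 0 < Real.log n := Real.log_pos (by linarith)
  have hk0 : (0 : ℝ) < k n := by exact_mod_cast hkpos n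
  have hkn : ∀ c : ℝ, min (ε / 4) (1 / 2) ≤ c → (k n : ℝ) ≤ (n : ℝ) ^ c := by
    intro c hc
    rw [div_lt_iff₀ hlog] at h2
    rw [← Real.log_le_log_iff hk0 (by positivity), Real.log_rpow hn0]
    exact h2.le.trans (mul_le_mul_of_nonneg_right hc hlog.le)
  have hka := hkn _ (min_le_left _ _)
  have hkb := hkn _ (min_le_right _ _)
  have hLk : (L + 2) * k n ≤ n := by
    have : ((L : ℝ) + 2) * k n ≤ n := by
      calc ((L : ℝ) + 2) * k n ≤ (n : ℝ) ^ (1 / 2 : ℝ) * (n : ℝ) ^ (1 / 2 : ℝ) :=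
            mul_le_mul h5 hkb hk0.le (by positivity)
        _ = n := by rw [← Real.rpow_add hn0]; norm_num
    exact_mod_cast this
  exact ⟨lower_bound h1 (hkpos n) he hka h3, indMat_le_maxFam n (k n) (by nlinarith),
    maxFam_le_exVC n (k n), upper_bound h1 (hkpos n) he hL2 hL1 hLk h4⟩
end

section
/- Let k = k(n) be a sequence of positive integers with k(n) = n^{o(1)}, i.e. log k(n)/log n → 0 as n → ∞. Then IndMat(n,k) ≥ n^{(1-o(1))·C(n,k)}; that is, for every ε > 0 there exists N such that for all n ≥ N, the number of induced matchings between layers k(n) and k(n)+1 of the hypercube Q_n is at least n^{(1-ε)·C(n,k(n))}. -/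
lemma isInducedMatching_of_fun (n k : ℕ) (T : Finset (Fin n))
    (f : {A // A ∈ Finset.powersetCard k Tᶜ} → {x // x ∈ T}) :
    IsInducedMatching n k
      (Finset.univ.image fun A : {A // A ∈ Finset.powersetCard k Tᶜ} =>
        ((A : Finset (Fin n)), insert ((f A : Fin n)) (A : Finset (Fin n)))) := by
  classical
  have key : ∀ A B : {A // A ∈ Finset.powersetCard k Tᶜ},
      (A : Finset (Fin n)) ⊆ insert ((f B : Fin n)) (B : Finset (Fin n)) → A = B := by
    rintro ⟨A, hA⟩ ⟨B, hB⟩ h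
    have hB' := hB
    rw [Finset.mem_powersetCard] at hA hB'
    apply Subtype.ext
    apply Finset.eq_of_subset_of_card_le
    · intro x hx
      rcases Finset.mem_insert.1 (h hx) with h1 | h1
      · exfalso
        have := hA.1 hx
        rw [Finset.mem_compl] at this
        exact this (h1 ▸ (f ⟨B, hB⟩).2)
      · exact h1
    · simp only
      omega
  constructor
  · intro e he
    obtain ⟨A, -, rfl⟩ := Finset.mem_image.1 he
    have hA := A.2
    rw [Finset.mem_powersetCard] at hA
    refine ⟨hA.2, ?_, Finset.subset_insert _ _⟩
    rw [Finset.card_insert_of_notMem, hA.2]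
    intro h
    exact (Finset.mem_compl.1 (hA.1 h)) (f A).2
  · intro e₁ he₁ e₂ he₂ hne
    obtain ⟨A, -, rfl⟩ := Finset.mem_image.1 he₁
    obtain ⟨B, -, rfl⟩ := Finset.mem_image.1 he₂
    have hAB : A ≠ B := fun h => hne (by rw [h])
    refine ⟨fun h => hAB (Subtype.ext h), fun h => ?_, fun h => hAB (key A B h),
      fun h => hAB (key B A h).symm⟩
    simp only at h
    exact hAB (key A B (h ▸ Finset.subset_insert _ _))

lemma pow_le_indMat (n k t : ℕ) (ht : t ≤ n) : t ^ ((n - t).choose k) ≤ indMat n k := by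
  classical
  obtain ⟨T, -, hT⟩ := Finset.exists_subset_card_eq (s := (Finset.univ : Finset (Fin n)))
    (n := t) (by simpa using ht)
  let F : ({A // A ∈ Finset.powersetCard k Tᶜ} → {x // x ∈ T}) →
      {M : Finset (Finset (Fin n) × Finset (Fin n)) // IsInducedMatching n k M} :=
    fun f => ⟨_, isInducedMatching_of_fun n k T f⟩
  have hF : Function.Injective F := by
    intro f g h
    have h' := congrArg Subtype.val h
    simp only [F] at h'
    funext A
    have hm : ((A : Finset (Fin n)), insert ((f A : Fin n)) (A : Finset (Fin n))) ∈
        (Finset.univ.image fun A : {A // A ∈ Finset.powersetCard k Tᶜ} =>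
          ((A : Finset (Fin n)), insert ((g A : Fin n)) (A : Finset (Fin n)))) := by
      rw [← h']
      exact Finset.mem_image_of_mem _ (Finset.mem_univ A)
    obtain ⟨B, -, hB⟩ := Finset.mem_image.1 hm
    rw [Prod.mk.injEq] at hB
    have hBA : B = A := Subtype.ext hB.1
    subst hBA
    have h1 : (f B : Fin n) ∈ insert ((g B : Fin n)) (B : Finset (Fin n)) := by
      rw [hB.2]; exact Finset.mem_insert_self _ _
    rcases Finset.mem_insert.1 h1 with h2 | h2
    · exact Subtype.ext h2
    · exact absurd (f B).2 (Finset.mem_compl.1 ((Finset.mem_powersetCard.1 B.2).1 h2))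
  have hc := Nat.card_le_card_of_injective F hF
  rw [Nat.card_eq_fintype_card, Fintype.card_fun, Fintype.card_coe, Fintype.card_coe,
    Finset.card_powersetCard, Finset.card_compl, Fintype.card_fin, hT] at hc
  exact hc

lemma choose_le_add (m k t : ℕ) :
    (m + t).choose (k + 1) ≤ m.choose (k + 1) + t * (m + t - 1).choose k := by
  induction t with
  | zero => simp
  | succ t ih =>
    have h1 : (m + (t + 1)).choose (k + 1) = (m + t).choose k + (m + t).choose (k + 1) := by
      rw [← add_assoc, Nat.choose_succ_succ]
    have h2 : (m + t - 1).choose k ≤ (m + t).choose k := Nat.choose_le_choose k (by omega)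
    have h3 : m + (t + 1) - 1 = m + t := by omega
    rw [h1, h3]
    nlinarith [Nat.mul_le_mul_left t h2]

lemma choose_sub_bound (n k t : ℕ) (hk : 0 < k) (ht : t ≤ n) (hn : 0 < n) :
    n * n.choose k ≤ n * (n - t).choose k + t * k * n.choose k := by
  obtain ⟨k, rfl⟩ : ∃ j, k = j + 1 := ⟨k - 1, by omega⟩
  have h := choose_le_add (n - t) k t
  rw [Nat.sub_add_cancel ht] at h
  obtain ⟨m, rfl⟩ : ∃ j, n = j + 1 := ⟨n - 1, by omega⟩
  have h2 := Nat.add_one_mul_choose_eq m k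
  simp only [Nat.add_sub_cancel] at h
  calc (m + 1) * (m + 1).choose (k + 1)
      ≤ (m + 1) * ((m + 1 - t).choose (k + 1) + t * m.choose k) := Nat.mul_le_mul_left _ h
    _ = (m + 1) * (m + 1 - t).choose (k + 1) + t * ((m + 1) * m.choose k) := by ring
    _ = _ := by rw [h2]; ring

/-- If `k(n) = n^{o(1)}`, then `IndMat(n,k) ≥ n^{(1-o(1))·C(n,k)}`: for every `ε > 0`,
eventually the number of induced matchings between layers `k(n)` and `k(n)+1` of `Q_n`
is at least `n^{(1-ε)·C(n,k(n))}`. -/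
theorem indMat_lower_bound (k : ℕ → ℕ) (hkpos : ∀ n, 0 < k n)
    (hko : Filter.Tendsto (fun n : ℕ => Real.log (k n) / Real.log n)
      Filter.atTop (nhds 0)) :
    ∀ ε : ℝ, 0 < ε → ∃ N : ℕ, ∀ n : ℕ, N ≤ n →
      (n : ℝ) ^ ((1 - ε) * (n.choose (k n) : ℝ)) ≤ (indMat n (k n) : ℝ) := by
  intro ε₀ hε₀
  obtain ⟨δ, hδ, hδ1, hδε⟩ : ∃ δ : ℝ, 0 < δ ∧ δ < 1 / 3 ∧ 3 * δ ≤ ε₀ :=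
    ⟨min (ε₀ / 3) (1 / 4), by positivity, by
      have := min_le_right (ε₀ / 3) (1 / 4 : ℝ); linarith, by
      have := min_le_left (ε₀ / 3) (1 / 4 : ℝ); linarith⟩
  have e1 : ∀ᶠ n : ℕ in Filter.atTop, Real.log (k n) / Real.log n < δ :=
    hko.eventually (gt_mem_nhds hδ)
  have e2 : ∀ᶠ n : ℕ in Filter.atTop, ((n : ℝ) ^ (-δ)) < δ / 2 :=
    ((tendsto_rpow_neg_atTop hδ).comp tendsto_natCast_atTop_atTop).eventually
      (gt_mem_nhds (by positivity))
  obtain ⟨N, hN⟩ := Filter.eventually_atTop.1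
    (e1.and (e2.and (Filter.eventually_ge_atTop 2)))
  refine ⟨N, fun n hn => ?_⟩
  obtain ⟨h1, h2, h3⟩ := hN n hn
  have hn2 : (2 : ℝ) ≤ n := by exact_mod_cast h3
  have hn0 : (0 : ℝ) < n := by linarith
  have hn1 : (1 : ℝ) ≤ n := by linarith
  have hlog : 0 < Real.log n := Real.log_pos (by linarith)
  have hk0 : (0 : ℝ) < k n := by exact_mod_cast hkpos n
  have hk : (k n : ℝ) ≤ (n : ℝ) ^ δ := by
    rw [div_lt_iff₀ hlog] at h1
    rw [← Real.log_le_log_iff hk0 (by positivity), Real.log_rpow hn0]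
    exact h1.le
  set x : ℝ := (n : ℝ) ^ (1 - 2 * δ) with hx
  have hx1 : 1 ≤ x := Real.one_le_rpow hn1 (by linarith)
  have hxn : x ≤ n := by
    calc x ≤ (n : ℝ) ^ (1 : ℝ) := Real.rpow_le_rpow_of_exponent_le hn1 (by linarith)
      _ = n := Real.rpow_one _
  set t : ℕ := ⌈x⌉₊ with ht
  have htn : t ≤ n := Nat.ceil_le.2 hxn
  have hxt : x ≤ t := Nat.le_ceil x
  have htx : (t : ℝ) ≤ 2 * x := by
    have := Nat.ceil_lt_add_one (show 0 ≤ x by linarith)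
    linarith
  have htk : (t : ℝ) * k n ≤ δ * n := by
    have hprod : x * (n : ℝ) ^ δ = (n : ℝ) ^ (-δ) * n := by
      rw [hx, ← Real.rpow_add hn0, ← Real.rpow_add_one hn0.ne']
      congr 1; ring
    calc (t : ℝ) * k n ≤ (2 * x) * (n : ℝ) ^ δ := by gcongr
      _ = 2 * ((n : ℝ) ^ (-δ) * n) := by rw [← hprod]; ring
      _ ≤ 2 * ((δ / 2) * n) := by gcongr
      _ = δ * n := by ring
  have hC : (1 - δ) * (n.choose (k n) : ℝ) ≤ ((n - t).choose (k n) : ℝ) := by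
    have hb : (n : ℝ) * n.choose (k n) ≤
        n * (n - t).choose (k n) + t * k n * n.choose (k n) := by
      exact_mod_cast choose_sub_bound n (k n) t (hkpos n) htn (by omega)
    have hb2 : (t : ℝ) * k n * n.choose (k n) ≤ δ * n * n.choose (k n) := by gcongr
    refine le_of_mul_le_mul_left ?_ hn0
    linarith
  have hCn : (0 : ℝ) ≤ n.choose (k n) := by positivity
  calc (n : ℝ) ^ ((1 - ε₀) * (n.choose (k n) : ℝ))
      ≤ (n : ℝ) ^ ((1 - 2 * δ) * ((n - t).choose (k n) : ℝ)) := by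
        apply Real.rpow_le_rpow_of_exponent_le hn1
        calc (1 - ε₀) * (n.choose (k n) : ℝ)
            ≤ ((1 - 2 * δ) * (1 - δ)) * (n.choose (k n) : ℝ) := by
              apply mul_le_mul_of_nonneg_right _ hCn
              nlinarith
          _ = (1 - 2 * δ) * ((1 - δ) * (n.choose (k n) : ℝ)) := by ring
          _ ≤ _ := mul_le_mul_of_nonneg_left hC (by linarith)
    _ = x ^ ((n - t).choose (k n)) := by
        rw [Real.rpow_mul hn0.le, Real.rpow_natCast]
    _ ≤ (t : ℝ) ^ ((n - t).choose (k n)) := by gcongr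
    _ ≤ (indMat n (k n) : ℝ) := by exact_mod_cast pow_le_indMat n (k n) t htn
end

section
/- For all integers n and k with 1 ≤ k ≤ n-1, the number of maximal families in the power set of [n] of VC dimension exactly k is at least the number of induced matchings between layers k and k+1 of the hypercube Q_n; that is, m(n,k) ≥ IndMat(n,k). -/
/-- All sets of size at most `k`, with the lower ends of `M` replaced by the upper ends. -/
def mfam {n : ℕ} (k : ℕ) (M : Finset (Finset (Fin n) × Finset (Fin n))) :
    Finset (Finset (Fin n)) :=
  ((Finset.univ.filter fun s => s.card ≤ k) \ M.image Prod.fst) ∪ M.image Prod.snd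

theorem mem_mfam {n k : ℕ} {M : Finset (Finset (Fin n) × Finset (Fin n))} {s : Finset (Fin n)} :
    s ∈ mfam k M ↔ (s.card ≤ k ∧ ∀ e ∈ M, e.1 ≠ s) ∨ ∃ e ∈ M, e.2 = s := by
  simp only [mfam, Finset.mem_union, Finset.mem_sdiff, Finset.mem_filter, Finset.mem_univ,
    true_and, Finset.mem_image, not_exists, not_and, ne_eq]

theorem mem_iff_mfam {n k : ℕ} {M : Finset (Finset (Fin n) × Finset (Fin n))}
    (hM : IsInducedMatching n k M) {a b : Finset (Fin n)} :
    (a, b) ∈ M ↔ a.card = k ∧ b.card = k + 1 ∧ a ⊆ b ∧ a ∉ mfam k M ∧ b ∈ mfam k M := by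
  obtain ⟨h1, h2⟩ := hM
  constructor
  · intro h
    obtain ⟨ha, hb, hab⟩ := h1 _ h
    refine ⟨ha, hb, hab, ?_, ?_⟩
    · rw [mem_mfam]
      rintro (⟨-, h3⟩ | ⟨e, he, rfl⟩)
      · exact h3 _ h rfl
      · have := (h1 e he).2.1
        simp only at ha
        omega
    · exact mem_mfam.2 (Or.inr ⟨_, h, rfl⟩)
  · rintro ⟨ha, hb, hab, hna, hmb⟩
    rw [mem_mfam] at hna hmb
    push Not at hna
    obtain ⟨e, he, rfl⟩ := hna.1 ha.le
    rcases hmb with ⟨h3, -⟩ | ⟨e', he', rfl⟩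
    · omega
    · by_cases hee : e = e'
      · subst hee; exact he
      · exact absurd hab (h2 e he e' he' hee).2.2.1

theorem card_layers (n k : ℕ) :
    (Finset.univ.filter fun s : Finset (Fin n) => s.card ≤ k).card
      = ∑ i ∈ Finset.range (k + 1), n.choose i := by
  rw [Finset.card_eq_sum_card_fiberwise (f := Finset.card) (t := Finset.range (k + 1))]
  · refine Finset.sum_congr rfl fun i hi => ?_
    rw [Finset.mem_range] at hi
    have : (Finset.univ.filter fun s : Finset (Fin n) => s.card ≤ k).filter (fun s => s.card = i)
        = Finset.powersetCard i Finset.univ := by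
      ext s
      simp [Finset.mem_powersetCard]
      omega
    rw [this, Finset.card_powersetCard, Finset.card_univ, Fintype.card_fin]
  · intro s hs
    simp at hs ⊢
    omega

theorem mfam_card {n k : ℕ} {M : Finset (Finset (Fin n) × Finset (Fin n))}
    (hM : IsInducedMatching n k M) :
    (mfam k M).card = ∑ i ∈ Finset.range (k + 1), n.choose i := by
  obtain ⟨h1, h2⟩ := hM
  have hsub : M.image Prod.fst ⊆ Finset.univ.filter fun s : Finset (Fin n) => s.card ≤ k := by
    intro s hs
    obtain ⟨e, he, rfl⟩ := Finset.mem_image.1 hs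
    simp [(h1 e he).1]
  have hd : Disjoint ((Finset.univ.filter fun s => s.card ≤ k) \ M.image Prod.fst)
      (M.image Prod.snd) := by
    rw [Finset.disjoint_left]
    intro s hs hs'
    obtain ⟨e, he, rfl⟩ := Finset.mem_image.1 hs'
    have := (h1 e he).2.1
    simp only [Finset.mem_sdiff, Finset.mem_filter] at hs
    omega
  have hA : (M.image Prod.fst).card = M.card := by
    apply Finset.card_image_of_injOn
    intro e he e' he' h
    by_contra hne
    exact (h2 e he e' he' hne).1 h
  have hB : (M.image Prod.snd).card = M.card := by
    apply Finset.card_image_of_injOn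
    intro e he e' he' h
    by_contra hne
    exact (h2 e he e' he' hne).2.1 h
  have hle := Finset.card_le_card hsub
  rw [mfam, Finset.card_union_of_disjoint hd, Finset.card_sdiff_of_subset hsub, hB, ← card_layers]
  omega

theorem mfam_not_shatters {n k : ℕ} {M : Finset (Finset (Fin n) × Finset (Fin n))}
    (hM : IsInducedMatching n k M) {S : Finset (Fin n)} (hS : S.card = k + 1) :
    ¬ Shatters (mfam k M) S := by
  obtain ⟨h1, h2⟩ := hM
  intro h
  obtain ⟨B, hB, hBS⟩ := h S subset_rfl
  have hSB : S ⊆ B := Finset.inter_eq_right.1 hBS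
  have hc := Finset.card_le_card hSB
  rcases mem_mfam.1 hB with ⟨h3, -⟩ | ⟨e, he, rfl⟩
  · omega
  have hee := h1 e he
  have hSe : S = e.2 := Finset.eq_of_subset_of_card_le hSB (by omega)
  subst hSe
  obtain ⟨C, hC, hCS⟩ := h e.1 hee.2.2
  have heC : e.1 ⊆ C := hCS ▸ Finset.inter_subset_left
  rcases mem_mfam.1 hC with ⟨h3, h4⟩ | ⟨e', he', rfl⟩
  · exact h4 e he (Finset.eq_of_subset_of_card_le heC (by omega))
  · by_cases hne : e = e'
    · subst hne
      rw [Finset.inter_self] at hCS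
      have := congrArg Finset.card hCS
      omega
    · exact (h2 e he e' he' hne).2.2.1 heC

theorem Shatters.mono_right {n : ℕ} {F : Finset (Finset (Fin n))} {S T : Finset (Fin n)}
    (h : Shatters F S) (hT : T ⊆ S) : Shatters F T := by
  intro A hA
  obtain ⟨B, hB, hBS⟩ := h A (hA.trans hT)
  refine ⟨B, hB, ?_⟩
  rw [← Finset.inter_eq_right.2 hT, ← Finset.inter_assoc, hBS, Finset.inter_eq_left.2 hA]

theorem mfam_shatters_card {n k : ℕ} {M : Finset (Finset (Fin n) × Finset (Fin n))}
    (hM : IsInducedMatching n k M) {S : Finset (Fin n)} (hS : Shatters (mfam k M) S) :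
    S.card ≤ k := by
  by_contra hlt
  obtain ⟨T, hT, hc⟩ := Finset.exists_subset_card_eq (s := S) (n := k + 1) (by omega)
  exact mfam_not_shatters hM hc (hS.mono_right hT)

theorem mfam_vcDim {n k : ℕ} (hk : k ≤ n) {M : Finset (Finset (Fin n) × Finset (Fin n))}
    (hM : IsInducedMatching n k M) : vcDim (mfam k M) = k := by
  have hex : ∃ S, Shatters (mfam k M) S ∧ S.card = k := by
    by_contra hno
    push Not at hno
    have hsub : (mfam k M).shatterer ⊆
        (Finset.univ.filter fun s : Finset (Fin n) => s.card ≤ k).filter (fun s => s.card ≠ k) := by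
      intro S hS
      rw [Finset.mem_shatterer] at hS
      have hS' : Shatters (mfam k M) S := by
        intro A hA
        obtain ⟨B, hB, h⟩ := hS hA
        exact ⟨B, hB, by rw [Finset.inter_comm]; exact h⟩
      simp [mfam_shatters_card hM hS', hno S hS']
    have h1 := (Finset.card_le_card_shatterer (mfam k M)).trans (Finset.card_le_card hsub)
    rw [mfam_card hM, ← card_layers] at h1
    obtain ⟨T, -, hT⟩ := Finset.exists_subset_card_eq (s := (Finset.univ : Finset (Fin n)))
      (n := k) (by simpa using hk)
    refine absurd h1 (not_le.2 (Finset.card_lt_card ?_))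
    rw [Finset.filter_ssubset]
    exact ⟨T, by simp [hT], by simp [hT]⟩
  apply IsGreatest.csSup_eq
  refine ⟨hex, ?_⟩
  rintro d ⟨S, hS, rfl⟩
  exact mfam_shatters_card hM hS

/-- For `1 ≤ k ≤ n - 1`, the number of maximal families of VC dimension exactly `k`
is at least the number of induced matchings between layers `k` and `k+1` of `Q_n`. -/
theorem indMat_le_maxFamCount (n k : ℕ) (hk : 1 ≤ k) (hkn : k ≤ n - 1) :
    indMat n k ≤ maxFamCount n k := by
  classical
  have hk' : k ≤ n := by omega
  unfold indMat maxFamCount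
  refine Nat.card_le_card_of_injective
    (fun M => ⟨mfam k M.1, ?_, mfam_vcDim hk' M.2⟩) ?_
  · unfold IsMaximal
    rw [mfam_vcDim hk' M.2, mfam_card M.2]
  · rintro ⟨M, hM⟩ ⟨N, hN⟩ h
    have h' : mfam k M = mfam k N := congrArg Subtype.val h
    apply Subtype.ext
    ext ⟨a, b⟩
    rw [mem_iff_mfam hM, mem_iff_mfam hN, h']
end

section
/- Let 1 ≤ k ≤ n-1 and let S be an induced matching between layers k and k+1 of the hypercube Q_n. Define φ(S) to be the family consisting of: all subsets of [n] of size at most k-1, all k-element subsets of [n] not covered by an edge of S, and all (k+1)-element subsets of [n] covered by an edge of S. Then |φ(S)| = Σ_{i=0}^{k} C(n,i) and the VC dimension of φ(S) is exactly k; in particular, φ(S) is a maximal family of VC dimension k. -/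
theorem card_filter_le_layers (n k : ℕ) :
    (Finset.univ.filter (fun B : Finset (Fin n) => B.card ≤ k)).card
      = ∑ i ∈ Finset.range (k + 1), n.choose i := by
  rw [Finset.card_eq_sum_card_fiberwise (f := Finset.card) (t := Finset.range (k + 1))]
  · apply Finset.sum_congr rfl
    intro i hi
    have h : (Finset.univ.filter (fun B : Finset (Fin n) => B.card ≤ k)).filter
        (fun B => B.card = i) = Finset.powersetCard i Finset.univ := by
      ext B
      simp only [Finset.mem_filter, Finset.mem_univ, true_and, Finset.mem_powersetCard,
        Finset.subset_univ]
      have := Finset.mem_range.1 hi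
      omega
    rw [h, Finset.card_powersetCard, Finset.card_univ, Fintype.card_fin]
  · intro B hB
    simp only [Finset.coe_filter, Finset.mem_univ, true_and, Set.mem_setOf_eq] at hB
    simp only [Finset.coe_range, Set.mem_Iio]
    omega

open Classical in
/-- Given an induced matching `M` between layers `k` and `k+1` of `Q_n` (with
`1 ≤ k ≤ n-1`), the family `φ(M)` consisting of all sets of size at most `k-1`,
the `k`-sets not covered by an edge of `M`, and the `(k+1)`-sets covered by an edge
of `M`, has size `∑_{i=0}^{k} C(n,i)` and VC dimension exactly `k`; in particular
it is a maximal family of VC dimension `k`. -/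
theorem phi_of_induced_matching_maximal (n k : ℕ) (hk : 1 ≤ k) (hkn : k ≤ n - 1)
    (M : Finset (Finset (Fin n) × Finset (Fin n))) (hM : IsInducedMatching n k M) :
    let φM : Finset (Finset (Fin n)) := Finset.univ.filter (fun B : Finset (Fin n) =>
      B.card ≤ k - 1 ∨
      (B.card = k ∧ ∀ e ∈ M, e.1 ≠ B) ∨
      (B.card = k + 1 ∧ ∃ e ∈ M, e.2 = B))
    φM.card = ∑ i ∈ Finset.range (k + 1), n.choose i ∧ vcDim φM = k ∧ IsMaximal φM := by
  intro φM
  obtain ⟨hM1, hM2⟩ := hM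
  have hcard : φM.card = ∑ i ∈ Finset.range (k + 1), n.choose i := by
    rw [← card_filter_le_layers]
    let R : Finset (Finset (Fin n)) := Finset.univ.filter (fun B : Finset (Fin n) =>
      B.card ≤ k - 1 ∨ (B.card = k ∧ ∀ e ∈ M, e.1 ≠ B))
    have h1 : φM = R ∪ M.image Prod.snd := by
      ext B
      simp only [φM, R, Finset.mem_filter, Finset.mem_univ, true_and, Finset.mem_union,
        Finset.mem_image]
      constructor
      · tauto
      · rintro (h | ⟨e, he, rfl⟩)
        · tauto
        · exact Or.inr (Or.inr ⟨(hM1 e he).2.1, e, he, rfl⟩)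
    have h2 : Finset.univ.filter (fun B : Finset (Fin n) => B.card ≤ k)
        = R ∪ M.image Prod.fst := by
      ext B
      simp only [R, Finset.mem_filter, Finset.mem_univ, true_and, Finset.mem_union,
        Finset.mem_image]
      constructor
      · intro h
        by_cases hB : ∃ e ∈ M, e.1 = B
        · exact Or.inr hB
        · push Not at hB
          rcases Nat.lt_or_ge B.card k with h' | h'
          · left; left; omega
          · left; right; exact ⟨by omega, hB⟩
      · rintro ((h | h) | ⟨e, he, rfl⟩)
        · omega
        · omega
        · exact (hM1 e he).1.le
    have d1 : Disjoint R (M.image Prod.snd) := by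
      rw [Finset.disjoint_right]
      intro B hB hR
      obtain ⟨e, he, rfl⟩ := Finset.mem_image.1 hB
      have := (hM1 e he).2.1
      simp only [R, Finset.mem_filter, Finset.mem_univ, true_and] at hR
      omega
    have d2 : Disjoint R (M.image Prod.fst) := by
      rw [Finset.disjoint_right]
      intro B hB hR
      obtain ⟨e, he, rfl⟩ := Finset.mem_image.1 hB
      have := (hM1 e he).1
      simp only [R, Finset.mem_filter, Finset.mem_univ, true_and] at hR
      rcases hR with hR | hR
      · omega
      · exact hR.2 e he rfl
    rw [h1, h2, Finset.card_union_of_disjoint d1, Finset.card_union_of_disjoint d2,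
      Finset.card_image_of_injOn, Finset.card_image_of_injOn]
    · intro a ha b hb hab
      by_contra hne
      exact (hM2 a ha b hb hne).1 hab
    · intro a ha b hb hab
      by_contra hne
      exact (hM2 a ha b hb hne).2.1 hab
  have hmem : ∀ B, B ∈ φM ↔ (B.card ≤ k - 1 ∨
      (B.card = k ∧ ∀ e ∈ M, e.1 ≠ B) ∨
      (B.card = k + 1 ∧ ∃ e ∈ M, e.2 = B)) := by
    intro B
    simp only [φM, Finset.mem_filter, Finset.mem_univ, true_and]
  have hub : ∀ S, Shatters φM S → S.card ≤ k := by
    intro S hS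
    by_contra hlt
    obtain ⟨B, hB, hBS⟩ := hS S (Finset.Subset.refl S)
    have hSB : S ⊆ B := Finset.inter_eq_right.1 hBS
    have hc := Finset.card_le_card hSB
    rw [hmem] at hB
    rcases hB with hB | hB | ⟨hB, e, he, rfl⟩
    · omega
    · omega
    have hSe : S = e.2 := Finset.eq_of_subset_of_card_le hSB (by omega)
    subst hSe
    obtain ⟨he1, he2, hes⟩ := hM1 e he
    obtain ⟨C, hC, hCe⟩ := hS e.1 hes
    have hsub : e.1 ⊆ C := hCe ▸ Finset.inter_subset_left
    have hc' := Finset.card_le_card hsub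
    rw [hmem] at hC
    rcases hC with hC | ⟨hC, hC'⟩ | ⟨hC, f, hf, rfl⟩
    · omega
    · exact hC' e he (Finset.eq_of_subset_of_card_le hsub (by omega))
    · by_cases hef : e = f
      · subst hef
        rw [Finset.inter_self] at hCe
        rw [hCe] at he2
        omega
      · exact (hM2 e he f hf hef).2.2.1 hsub
  have hex : ∃ S, Shatters φM S ∧ S.card = k := by
    by_contra hno
    push Not at hno
    have hsub : φM.shatterer ⊆
        Finset.univ.filter (fun B : Finset (Fin n) => B.card ≤ k - 1) := by
      intro S hS
      rw [Finset.mem_shatterer] at hS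
      have hS' : Shatters φM S := by
        intro A hA
        obtain ⟨u, hu, h⟩ := hS hA
        exact ⟨u, hu, by rw [Finset.inter_comm]; exact h⟩
      have := hub S hS'
      have := hno S hS'
      simp only [Finset.mem_filter, Finset.mem_univ, true_and]
      omega
    have h := (Finset.card_le_card_shatterer φM).trans (Finset.card_le_card hsub)
    rw [card_filter_le_layers, hcard, Nat.sub_add_cancel hk, Finset.sum_range_succ] at h
    have : 0 < n.choose k := Nat.choose_pos (by omega)
    omega
  have hvc : vcDim φM = k := by
    have : IsGreatest {d : ℕ | ∃ S : Finset (Fin n), Shatters φM S ∧ S.card = d} k := by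
      refine ⟨hex, ?_⟩
      rintro d ⟨S, hS, rfl⟩
      exact hub S hS
    exact this.csSup_eq
  refine ⟨hcard, hvc, ?_⟩
  unfold IsMaximal
  rw [hvc, hcard]
end

section
/- Let n, m, k be integers with 1 ≤ m ≤ n and 1 ≤ k ≤ n - m. Then the number of induced matchings between layers k and k+1 of the hypercube Q_n is at least m^{C(n-m, k)}. (Concretely, fixing A = {1,…,m} and B = [n] \ A, each function assigning to every k-element subset C of B an element a(C) of A yields the matching {(C, C ∪ {a(C)}) : C ∈ C(B,k)}; any such matching is an induced matching between layers k and k+1, and distinct functions yield distinct matchings.) -/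
/-- For `1 ≤ m ≤ n` and `1 ≤ k ≤ n - m`, the number of induced matchings between
layers `k` and `k+1` of the hypercube `Q_n` is at least `m^{C(n-m,k)}`. -/
theorem indMat_ge_pow (n m k : ℕ) (hm : 1 ≤ m) (hmn : m ≤ n)
    (hk : 1 ≤ k) (hkn : k ≤ n - m) :
    m ^ ((n - m).choose k) ≤ indMat n k := by
  obtain ⟨A, -, hA⟩ := Finset.exists_subset_card_eq (s := (Finset.univ : Finset (Fin n)))
    (n := m) (by simpa using hmn)
  let T := {C : Finset (Fin n) // C ∈ Finset.powersetCard k Aᶜ}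
  have hT : ∀ C : T, C.1 ⊆ Aᶜ ∧ C.1.card = k := fun C => Finset.mem_powersetCard.1 C.2
  have hnot : ∀ (C : T) (a : Fin n), a ∈ A → a ∉ C.1 := fun C a ha hC =>
    (Finset.mem_compl.1 ((hT C).1 hC)) ha
  let F : (T → A) → Finset (Finset (Fin n) × Finset (Fin n)) := fun f =>
    Finset.univ.image (fun C : T => (C.1, insert (f C).1 C.1))
  have hsub : ∀ (f : T → A) (C D : T), C.1 ⊆ insert (f D).1 D.1 → C = D := by
    intro f C D h
    have h1 : C.1 ⊆ D.1 := by
      intro x hx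
      rcases Finset.mem_insert.1 (h hx) with h2 | h2
      · exact absurd hx (hnot C x (h2 ▸ (f D).2))
      · exact h2
    exact Subtype.ext (Finset.eq_of_subset_of_card_le h1 (by rw [(hT C).2, (hT D).2]))
  have hF : ∀ f, IsInducedMatching n k (F f) := by
    intro f
    constructor
    · intro e he
      obtain ⟨C, -, rfl⟩ := Finset.mem_image.1 he
      refine ⟨(hT C).2, ?_, Finset.subset_insert _ _⟩
      rw [Finset.card_insert_of_notMem (hnot C _ (f C).2), (hT C).2]
    · intro e₁ he₁ e₂ he₂ hne
      obtain ⟨C, -, rfl⟩ := Finset.mem_image.1 he₁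
      obtain ⟨D, -, rfl⟩ := Finset.mem_image.1 he₂
      have hCD : C ≠ D := fun h => hne (by rw [h])
      refine ⟨fun h => hCD (Subtype.ext h), fun h => hCD (hsub f C D ?_),
        fun h => hCD (hsub f C D h), fun h => hCD (hsub f D C h).symm⟩
      exact (Finset.subset_insert _ _).trans (le_of_eq h)
  have hinj : Function.Injective F := by
    intro f g hfg
    funext C
    have h1 : (C.1, insert (f C).1 C.1) ∈ F g :=
      hfg ▸ Finset.mem_image.2 ⟨C, Finset.mem_univ _, rfl⟩
    obtain ⟨D, -, hD⟩ := Finset.mem_image.1 h1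
    obtain ⟨h2, h3⟩ := Prod.mk.inj hD
    obtain rfl : D = C := Subtype.ext h2
    have h4 : (f D).1 ∈ insert (g D).1 D.1 := h3 ▸ Finset.mem_insert_self _ _
    rcases Finset.mem_insert.1 h4 with h5 | h5
    · exact Subtype.ext h5
    · exact absurd h5 (hnot D _ (f D).2)
  have hcard : Nat.card (T → A) = m ^ ((n - m).choose k) := by
    rw [Nat.card_fun, Nat.card_eq_fintype_card, Nat.card_eq_fintype_card, Fintype.card_coe,
      Fintype.card_coe, Finset.card_powersetCard, Finset.card_compl, hA, Fintype.card_fin]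
  rw [← hcard]
  exact Nat.card_le_card_of_injective
    (fun f => (⟨F f, hF f⟩ : {M // IsInducedMatching n k M}))
    (fun f g h => hinj (congrArg Subtype.val h))
end

section
/- For all integers n ≥ 1 and k ≥ 0, the number ExVC(n,k) of extremal families in the power set of [n] with VC dimension at most k satisfies ExVC(n,k) ≤ 2^{n+1} · (e·n)^{Σ_{i=0}^{k} C(n,i)}. -/
lemma perc_aux {V : Type*} [Fintype V] [DecidableEq V] (N : V → Finset V)
    (𝒞 : Finset (Finset V)) (v : V) (hv : ∀ C ∈ 𝒞, v ∈ C)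
    (hc : ∀ C ∈ 𝒞, ∀ T ⊆ C, T.Nonempty → (C \ T).Nonempty → ∃ x ∈ T, ∃ y ∈ C \ T, y ∈ N x)
    (p : ℝ) (hp0 : 0 ≤ p) (hp1 : p ≤ 1) :
    ∑ C ∈ 𝒞, p ^ C.card * (1 - p) ^ (C.biUnion N \ C).card ≤ 1 := by
  have hsub : ∀ C ∈ 𝒞, ∀ C' ∈ 𝒞, ∀ A : Finset V, C' ⊆ A → Disjoint A (C.biUnion N \ C) →
      C' ⊆ C := by
    intro C hC C' hC' A hA hd
    by_contra hcon
    obtain ⟨x, hx, y, hy, hxy⟩ := hc C' hC' (C' ∩ C) Finset.inter_subset_left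
      ⟨v, Finset.mem_inter.2 ⟨hv _ hC', hv _ hC⟩⟩ (by
        obtain ⟨z, hz, hz'⟩ := Finset.not_subset.1 hcon
        exact ⟨z, by simp [hz, hz']⟩)
    simp only [Finset.mem_inter, Finset.mem_sdiff, not_and] at hx hy
    refine Finset.disjoint_left.1 hd (hA hy.1) ?_
    simp only [Finset.mem_sdiff, Finset.mem_biUnion]
    exact ⟨⟨x, hx.2, hxy⟩, hy.2 hy.1⟩
  let R : Finset V → Finset V := fun C => (C ∪ (C.biUnion N \ C))ᶜ
  let w : Finset V → ℝ := fun A => p ^ A.card * (1 - p) ^ (Fintype.card V - A.card)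
  have h1 : ∀ C ∈ 𝒞, p ^ C.card * (1 - p) ^ (C.biUnion N \ C).card
      = ∑ B ∈ (R C).powerset, w (C ∪ B) := by
    intro C _
    have hs := Finset.sum_pow_mul_eq_add_pow p (1 - p) (R C)
    rw [add_sub_cancel, one_pow] at hs
    trans (p ^ C.card * (1 - p) ^ (C.biUnion N \ C).card) *
      ∑ t ∈ (R C).powerset, p ^ t.card * (1 - p) ^ ((R C).card - t.card)
    · rw [hs, mul_one]
    rw [Finset.mul_sum]
    refine Finset.sum_congr rfl fun B hB => ?_
    rw [Finset.mem_powerset] at hB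
    have hd : Disjoint C B := by
      rw [Finset.disjoint_left]
      intro a ha hb
      have := hB hb
      simp [R, ha] at this
    have hR : (R C).card + (C.card + (C.biUnion N \ C).card) = Fintype.card V := by
      rw [← Finset.card_union_of_disjoint (Finset.disjoint_sdiff)]
      exact Finset.card_compl_add_card _
    have hB' := Finset.card_le_card hB
    simp only [w]
    rw [Finset.card_union_of_disjoint hd,
      show Fintype.card V - (C.card + B.card)
        = (C.biUnion N \ C).card + ((R C).card - B.card) by omega, pow_add, pow_add]
    ring
  rw [Finset.sum_congr rfl h1, Finset.sum_sigma']
  have htot : ∑ A : Finset V, w A = 1 := by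
    have hs := Finset.sum_pow_mul_eq_add_pow p (1 - p) (Finset.univ : Finset V)
    rw [add_sub_cancel, one_pow, Finset.powerset_univ] at hs
    simpa [w] using hs
  rw [← htot]
  have hdis : ∀ C, ∀ B ⊆ R C, Disjoint C B ∧ Disjoint (C ∪ B) (C.biUnion N \ C) := by
    intro C B hB
    constructor
    · rw [Finset.disjoint_left]
      intro a ha hb
      have := hB hb
      simp [R, ha] at this
    · rw [Finset.disjoint_left]
      intro a ha hb
      rcases Finset.mem_union.1 ha with h | h
      · exact (Finset.mem_sdiff.1 hb).2 h
      · have := hB h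
        simp only [R, Finset.mem_compl, Finset.mem_union, not_or] at this
        exact this.2 hb
  have hinj : Set.InjOn (fun x : (_ : Finset V) × Finset V => x.1 ∪ x.2)
      (𝒞.sigma fun C => (R C).powerset) := by
    rintro ⟨C, B⟩ h ⟨C', B'⟩ h' heq
    simp only [Finset.coe_sigma, Set.mem_sigma_iff, Finset.mem_coe, Finset.mem_powerset] at h h'
    simp only at heq
    obtain ⟨hd1, hd2⟩ := hdis _ _ h.2
    obtain ⟨hd1', hd2'⟩ := hdis _ _ h'.2
    have e1 : C' ⊆ C := hsub C h.1 C' h'.1 (C ∪ B) (heq ▸ Finset.subset_union_left) hd2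
    have e2 : C ⊆ C' := hsub C' h'.1 C h.1 (C' ∪ B') (heq ▸ Finset.subset_union_left) hd2'
    obtain rfl := Finset.Subset.antisymm e1 e2
    have : B = B' := by
      rw [← Finset.union_sdiff_cancel_left hd1, heq, Finset.union_sdiff_cancel_left hd1']
    rw [this]
  rw [← Finset.sum_image (f := w) (g := fun x : (_ : Finset V) × Finset V => x.1 ∪ x.2) hinj]
  refine Finset.sum_le_sum_of_subset_of_nonneg (Finset.subset_univ _) fun A _ _ => ?_
  have : 0 ≤ 1 - p := by linarith
  positivity

lemma exp_aux (n : ℕ) (hn : 1 ≤ n) : (Real.exp 1)⁻¹ ≤ (1 - 1 / (n : ℝ)) ^ (n - 1) := by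
  obtain ⟨m, rfl⟩ : ∃ m, n = m + 1 := ⟨n - 1, by omega⟩
  rcases Nat.eq_zero_or_pos m with rfl | hm
  · simp only [zero_add, Nat.sub_self, pow_zero]
    exact inv_le_one_of_one_le₀ (Real.one_le_exp zero_le_one)
  have hm' : (0 : ℝ) < m := by exact_mod_cast hm
  have h : (1 - 1 / ((m + 1 : ℕ) : ℝ)) = (1 + 1 / (m : ℝ))⁻¹ := by
    push_cast
    field_simp
    ring
  rw [h, Nat.add_sub_cancel, inv_pow]
  apply inv_anti₀ (by positivity)
  calc (1 + 1 / (m : ℝ)) ^ m ≤ (Real.exp (1 / m)) ^ m := by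
        gcongr
        linarith [Real.add_one_le_exp (1 / (m : ℝ))]
    _ = Real.exp 1 := by
        rw [← Real.exp_nat_mul]
        congr 1
        field_simp

lemma shatter_split {n : ℕ} (F : Finset (Finset (Fin n))) (a : Fin n) :
    (F.filter (a ∉ ·)).shatterer.card + (F.filter (a ∈ ·)).shatterer.card ≤ F.shatterer.card := by
  set F0 := F.filter (a ∉ ·) with hF0
  set F1 := F.filter (a ∈ ·) with hF1
  have n0 : ∀ S ∈ F0.shatterer, a ∉ S := by
    intro S hS ha
    obtain ⟨u, hu, h⟩ := Finset.mem_shatterer.1 hS (Finset.Subset.refl S)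
    have : a ∈ S ∩ u := by rwa [h]
    exact (Finset.mem_filter.1 hu).2 (Finset.mem_inter.1 this).2
  have n1 : ∀ S ∈ F1.shatterer, a ∉ S := by
    intro S hS ha
    obtain ⟨u, hu, h⟩ := Finset.mem_shatterer.1 hS (Finset.empty_subset S)
    have : a ∈ S ∩ u := Finset.mem_inter.2 ⟨ha, (Finset.mem_filter.1 hu).2⟩
    simp [h] at this
  rw [← Finset.card_union_add_card_inter]
  have hinj : Set.InjOn (insert a) ((F0.shatterer ∩ F1.shatterer : Finset (Finset (Fin n))) :
      Set (Finset (Fin n))) := by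
    intro S hS S' hS' h
    have h1 := n0 S (Finset.mem_inter.1 hS).1
    have h2 := n0 S' (Finset.mem_inter.1 hS').1
    rw [← Finset.erase_insert h1, ← Finset.erase_insert h2]
    rw [h]
  rw [← Finset.card_image_of_injOn hinj, ← Finset.card_union_of_disjoint]
  · apply Finset.card_le_card
    intro S hS
    rcases Finset.mem_union.1 hS with h | h
    · rcases Finset.mem_union.1 h with h | h
      · exact Finset.shatterer_mono (Finset.filter_subset _ _) h
      · exact Finset.shatterer_mono (Finset.filter_subset _ _) h
    · obtain ⟨S, hS', rfl⟩ := Finset.mem_image.1 h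
      obtain ⟨h0, h1⟩ := Finset.mem_inter.1 hS'
      have haS := n0 S h0
      rw [Finset.mem_shatterer] at h0 h1 ⊢
      intro t ht
      by_cases hat : a ∈ t
      · obtain ⟨u, hu, h⟩ := h1 (t := t.erase a) (by grind)
        exact ⟨u, (Finset.mem_filter.1 hu).1, by grind⟩
      · obtain ⟨u, hu, h⟩ := h0 (t := t) (by grind)
        exact ⟨u, (Finset.mem_filter.1 hu).1, by grind⟩
  · rw [Finset.disjoint_left]
    intro S hS h
    obtain ⟨S', hS', rfl⟩ := Finset.mem_image.1 h
    rcases Finset.mem_union.1 hS with h | h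
    · exact n0 _ h (Finset.mem_insert_self _ _)
    · exact n1 _ h (Finset.mem_insert_self _ _)

lemma disconn_aux {n : ℕ} (m : ℕ) : ∀ F T : Finset (Finset (Fin n)), F.card = m → T ⊆ F →
    T.Nonempty → (F \ T).Nonempty →
    (∀ x ∈ T, ∀ y ∈ F \ T, ∀ a, y ≠ symmDiff x {a}) → F.card < F.shatterer.card := by
  induction m using Nat.strong_induction_on with
  | _ m ih =>
  intro F T hm hT hTn hUn hno
  have hcard : ∀ a, (F.filter (a ∉ ·)).card + (F.filter (a ∈ ·)).card = F.card := by
    intro a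
    rw [add_comm]
    exact Finset.card_filter_add_card_filter_not _
  by_cases H : ∃ a, (F.filter (a ∉ ·)).Nonempty ∧ (F.filter (a ∈ ·)).Nonempty ∧
      ((∃ x ∈ T, ∃ y ∈ F \ T, a ∉ x ∧ a ∉ y) ∨ (∃ x ∈ T, ∃ y ∈ F \ T, a ∈ x ∧ a ∈ y))
  · obtain ⟨a, h0, h1, h⟩ := H
    have hs := shatter_split F a
    have hc := hcard a
    have p0 := h0.card_pos
    have p1 := h1.card_pos
    have q0 := Finset.card_le_card_shatterer (F.filter (a ∉ ·))
    have q1 := Finset.card_le_card_shatterer (F.filter (a ∈ ·))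
    rcases h with ⟨x, hx, y, hy, hax, hay⟩ | ⟨x, hx, y, hy, hax, hay⟩
    · have := ih (F.filter (a ∉ ·)).card (by omega) (F.filter (a ∉ ·)) (T.filter (a ∉ ·)) rfl
        (Finset.filter_subset_filter _ hT) ⟨x, by simp [hx, hax]⟩
        ⟨y, by grind⟩ (fun x hx y hy => hno x (by grind) y (by grind))
      omega
    · have := ih (F.filter (a ∈ ·)).card (by omega) (F.filter (a ∈ ·)) (T.filter (a ∈ ·)) rfl
        (Finset.filter_subset_filter _ hT) ⟨x, by simp [hx, hax]⟩
        ⟨y, by grind⟩ (fun x hx y hy => hno x (by grind) y (by grind))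
      omega
  · push Not at H
    obtain ⟨x, hx⟩ := hTn
    obtain ⟨y, hy⟩ := hUn
    have hxF := hT hx
    have hyF := (Finset.mem_sdiff.1 hy).1
    have hxy : x ≠ y := fun h => (Finset.mem_sdiff.1 hy).2 (h ▸ hx)
    -- coordinates nonconstant on F separate T from the rest
    have key : ∀ a, ∀ z ∈ F, ∀ z' ∈ F, a ∉ z → a ∈ z' →
        (∀ x ∈ T, ∀ y ∈ F \ T, (a ∈ x ↔ a ∉ y)) := by
      intro a z hz z' hz' haz haz' x hx y hy
      have := H a ⟨z, by simp [hz, haz]⟩ ⟨z', by simp [hz', haz']⟩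
      have h1 := this.1 x hx y hy
      have h2 := this.2 x hx y hy
      tauto
    have hTx : ∀ z ∈ T, z = x := by
      intro z hz
      ext a
      by_contra hne
      have hzF := hT hz
      by_cases haz : a ∈ z
      · have hax : a ∉ x := by tauto
        have k := key a x hxF z hzF hax haz
        have k1 := k x hx y hy
        have k2 := k z hz y hy
        tauto
      · have hax : a ∈ x := by tauto
        have k := key a z hzF x hxF haz hax
        have k1 := k x hx y hy
        have k2 := k z hz y hy
        tauto
    have hUy : ∀ z ∈ F \ T, z = y := by
      intro z hz
      ext a
      by_contra hne
      have hzF := (Finset.mem_sdiff.1 hz).1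
      by_cases haz : a ∈ z
      · have hax : a ∉ y := by tauto
        have k := key a y hyF z hzF hax haz
        have k1 := k x hx y hy
        have k2 := k x hx z hz
        tauto
      · have hax : a ∈ y := by tauto
        have k := key a z hzF y hyF haz hax
        have k1 := k x hx y hy
        have k2 := k x hx z hz
        tauto
    have hF : F ⊆ {x, y} := by
      intro z hz
      by_cases h : z ∈ T
      · simp [hTx z h]
      · simp [hUy z (Finset.mem_sdiff.2 ⟨hz, h⟩)]
    have hF2 : F.card ≤ 2 := (Finset.card_le_card hF).trans Finset.card_le_two
    have hD : 1 < (symmDiff x y).card := by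
      by_contra hle
      push Not at hle
      have hne : (symmDiff x y).Nonempty := by
        rw [Finset.nonempty_iff_ne_empty]
        intro h
        exact hxy (symmDiff_eq_bot.1 h)
      obtain ⟨a, ha⟩ := Finset.card_eq_one.1 (le_antisymm hle hne.card_pos)
      exact hno x hx y hy a (by rw [← ha, symmDiff_symmDiff_cancel_left])
    obtain ⟨a, ha, b, hb, hab⟩ := Finset.one_lt_card.1 hD
    have hsing : ∀ a ∈ symmDiff x y, ({a} : Finset (Fin n)) ∈ F.shatterer := by
      intro a ha
      rw [Finset.mem_shatterer]
      intro t ht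
      rw [Finset.mem_symmDiff] at ha
      rcases Finset.subset_singleton_iff.1 ht with rfl | rfl
      · rcases ha with h | h
        · exact ⟨y, hyF, by simp [h.2]⟩
        · exact ⟨x, hxF, by simp [h.2]⟩
      · rcases ha with h | h
        · exact ⟨x, hxF, by simp [h.1]⟩
        · exact ⟨y, hyF, by simp [h.1]⟩
    have hthree : ({∅, {a}, {b}} : Finset (Finset (Fin n))) ⊆ F.shatterer := by
      intro S hS
      simp only [Finset.mem_insert, Finset.mem_singleton] at hS
      rcases hS with rfl | rfl | rfl
      · rw [Finset.mem_shatterer, Finset.shatters_empty]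
        exact ⟨x, hxF⟩
      · exact hsing _ ha
      · exact hsing _ hb
    have h3 : ({∅, {a}, {b}} : Finset (Finset (Fin n))).card = 3 := by
      rw [Finset.card_eq_three]
      refine ⟨_, _, _, ?_, ?_, ?_, rfl⟩
      · exact (Finset.singleton_ne_empty a).symm
      · exact (Finset.singleton_ne_empty b).symm
      · simpa using hab
    have := Finset.card_le_card hthree
    omega

lemma shatters_iff_aux {n : ℕ} (F : Finset (Finset (Fin n))) (S : Finset (Fin n)) :
    Shatters F S ↔ F.Shatters S := by
  unfold Shatters Finset.Shatters
  simp only [Finset.inter_comm]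

lemma card_bound_aux {n k : ℕ} (F : Finset (Finset (Fin n))) (h : vcDim F ≤ k) :
    F.card ≤ ∑ i ∈ Finset.range (k + 1), n.choose i := by
  have hk : F.vcDim ≤ k := by
    refine Finset.sup_le fun S hS => le_trans ?_ h
    refine le_csSup ⟨n, ?_⟩ ⟨S, (shatters_iff_aux F S).2 (Finset.mem_shatterer.1 hS), rfl⟩
    rintro d ⟨S, -, rfl⟩
    simpa using S.card_le_univ
  refine (Finset.card_le_card_shatterer F).trans (Finset.card_shatterer_le_sum_vcDim.trans ?_)
  rw [Fintype.card_fin]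
  refine Finset.sum_le_sum_of_subset ?_
  intro i hi
  simp only [Finset.mem_Iic, Finset.mem_range] at *
  omega

lemma rooted_aux {n : ℕ} (hn : 1 ≤ n) (M : ℕ) (v : Finset (Fin n))
    (𝒞 : Finset (Finset (Finset (Fin n)))) (hv : ∀ C ∈ 𝒞, v ∈ C)
    (hext : ∀ C ∈ 𝒞, C.shatterer.card = C.card) (h2 : ∀ C ∈ 𝒞, 2 ≤ C.card)
    (hM : ∀ C ∈ 𝒞, C.card ≤ M) : (𝒞.card : ℝ) ≤ (Real.exp 1 * n) ^ M := by
  let N : Finset (Fin n) → Finset (Finset (Fin n)) :=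
    fun x => Finset.univ.image fun a => symmDiff x {a}
  have hN : ∀ x, (N x).card ≤ n := fun x => by
    simpa using (Finset.card_image_le (s := Finset.univ) (f := fun a : Fin n => symmDiff x {a}))
  have hc : ∀ C ∈ 𝒞, ∀ T ⊆ C, T.Nonempty → (C \ T).Nonempty →
      ∃ x ∈ T, ∃ y ∈ C \ T, y ∈ N x := by
    intro C hC T hT h1 h2
    by_contra hcon
    push Not at hcon
    have := disconn_aux _ C T rfl hT h1 h2 (fun x hx y hy a h => hcon x hx y hy (by
      simp only [N, Finset.mem_image]
      exact ⟨a, Finset.mem_univ _, h.symm⟩))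
    exact absurd (hext C hC) (by omega)
  have hn' : (1 : ℝ) ≤ n := by exact_mod_cast hn
  have hp1 : 1 / (n : ℝ) ≤ 1 := by
    rw [div_le_one (by linarith)]
    exact hn'
  have hperc := perc_aux N 𝒞 v hv hc (1 / (n : ℝ)) (by positivity) hp1
  have hq : 1 ≤ Real.exp 1 * n := by
    have := Real.add_one_le_exp (1 : ℝ)
    nlinarith
  have hterm : ∀ C ∈ 𝒞, ((Real.exp 1 * n) ^ M)⁻¹ ≤
      (1 / (n : ℝ)) ^ C.card * (1 - 1 / (n : ℝ)) ^ (C.biUnion N \ C).card := by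
    intro C hC
    have hb : (C.biUnion N \ C).card ≤ (n - 1) * C.card := by
      have : C.biUnion N \ C ⊆ C.biUnion fun x => N x \ C := by
        intro y hy
        simp only [Finset.mem_sdiff, Finset.mem_biUnion] at hy ⊢
        obtain ⟨⟨x, hx, hxy⟩, hyC⟩ := hy
        exact ⟨x, hx, hxy, hyC⟩
      refine (Finset.card_le_card this).trans ?_
      rw [mul_comm]
      refine Finset.card_biUnion_le_card_mul _ _ _ fun x hx => ?_
      obtain ⟨x', hx', y, hy, hxy⟩ := hc C hC {x} (by simpa using hx) (by simp) (by
        rw [← Finset.card_pos, Finset.card_sdiff_of_subset (by simpa using hx),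
          Finset.card_singleton]
        have := h2 C hC
        omega)
      rw [Finset.mem_singleton] at hx'
      subst hx'
      have : (N x' \ C).card < (N x').card := by
        apply Finset.card_lt_card
        refine ⟨Finset.sdiff_subset, fun hs => ?_⟩
        exact (Finset.mem_sdiff.1 (hs hxy)).2 (Finset.mem_sdiff.1 hy).1
      have := hN x'
      omega
    have h0 : 0 ≤ 1 - 1 / (n : ℝ) := by linarith
    calc ((Real.exp 1 * n) ^ M)⁻¹ ≤ ((Real.exp 1 * n) ^ C.card)⁻¹ := by
          apply inv_anti₀ (by positivity)
          exact pow_le_pow_right₀ hq (hM C hC)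
      _ = (1 / (n : ℝ)) ^ C.card * ((Real.exp 1)⁻¹) ^ C.card := by
          rw [← mul_pow, ← inv_pow, mul_inv, one_div, mul_comm]
      _ ≤ (1 / (n : ℝ)) ^ C.card * ((1 - 1 / (n : ℝ)) ^ (n - 1)) ^ C.card := by
          gcongr
          exact exp_aux n hn
      _ ≤ _ := by
          rw [← pow_mul]
          gcongr ?_ * ?_
          exact pow_le_pow_of_le_one h0 (by linarith [show 0 ≤ 1 / (n : ℝ) by positivity]) hb
  have := (Finset.sum_le_sum hterm).trans hperc
  rw [Finset.sum_const, nsmul_eq_mul, ← div_eq_mul_inv, div_le_one (by positivity)] at this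
  exact this

/-- For all `n ≥ 1` and `k ≥ 0`, the number of shattering-extremal families in the
power set of `[n]` of VC dimension at most `k` satisfies
`ExVC(n,k) ≤ 2^{n+1} · (e·n)^{∑_{i=0}^{k} C(n,i)}`. -/
theorem exVC_upper_bound (n k : ℕ) (hn : 1 ≤ n) :
    (exVC n k : ℝ) ≤
      2 ^ (n + 1) * (Real.exp 1 * n) ^ (∑ i ∈ Finset.range (k + 1), n.choose i) := by
  classical
  set M := ∑ i ∈ Finset.range (k + 1), n.choose i with hM
  let E : Finset (Finset (Finset (Fin n))) :=
    Finset.univ.filter fun F => F.shatterer.card = F.card ∧ vcDim F ≤ k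
  have hE : exVC n k = E.card := by
    unfold exVC
    rw [← Nat.card_eq_finsetCard]
    apply Nat.card_congr
    refine Equiv.subtypeEquivRight fun F => ?_
    have : Nat.card {S : Finset (Fin n) // Shatters F S} = F.shatterer.card := by
      rw [← Nat.card_eq_finsetCard]
      exact Nat.card_congr (Equiv.subtypeEquivRight fun S => by
        rw [Finset.mem_shatterer, shatters_iff_aux])
    rw [this]
    simp [E]
  let 𝒞 : Finset (Fin n) → Finset (Finset (Finset (Fin n))) :=
    fun v => E.filter fun F => v ∈ F ∧ 2 ≤ F.card
  have hsub : E ⊆ ({∅} ∪ Finset.univ.image (fun v : Finset (Fin n) => {v})) ∪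
      Finset.univ.biUnion 𝒞 := by
    intro F hF
    rcases Finset.eq_empty_or_nonempty F with h | ⟨v, hv⟩
    · simp [h]
    · by_cases h2 : 2 ≤ F.card
      · apply Finset.mem_union_right
        simp only [Finset.mem_biUnion, 𝒞, Finset.mem_filter]
        exact ⟨v, Finset.mem_univ _, hF, hv, h2⟩
      · apply Finset.mem_union_left
        apply Finset.mem_union_right
        have h1 : F.card = 1 := by
          have := Finset.card_pos.2 ⟨v, hv⟩
          omega
        obtain ⟨u, rfl⟩ := Finset.card_eq_one.1 h1
        exact Finset.mem_image_of_mem _ (Finset.mem_univ _)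
  have hcard : E.card ≤ (1 + 2 ^ n) + ∑ v, (𝒞 v).card := by
    refine (Finset.card_le_card hsub).trans ((Finset.card_union_le _ _).trans ?_)
    refine add_le_add ((Finset.card_union_le _ _).trans (add_le_add (by simp) ?_))
      Finset.card_biUnion_le
    refine Finset.card_image_le.trans ?_
    simp
  have hroot : ∀ v, ((𝒞 v).card : ℝ) ≤ (Real.exp 1 * n) ^ M := by
    intro v
    refine rooted_aux hn M v (𝒞 v) ?_ ?_ ?_ ?_
    all_goals
      intro C hC
      simp only [𝒞, E, Finset.mem_filter, Finset.mem_univ, true_and] at hC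
    · exact hC.2.1
    · exact hC.1.1
    · exact hC.2.2
    · exact card_bound_aux C hC.1.2
  have hsum : (∑ v, ((𝒞 v).card : ℝ)) ≤ 2 ^ n * (Real.exp 1 * n) ^ M := by
    refine (Finset.sum_le_sum fun v _ => hroot v).trans ?_
    simp
  have hM1 : 1 ≤ M := by
    rw [hM, Finset.sum_range_succ']
    simp
  have hn' : (1 : ℝ) ≤ n := by exact_mod_cast hn
  have hq : 2 ≤ Real.exp 1 * n := by
    have := Real.add_one_le_exp (1 : ℝ)
    nlinarith
  have hqM : 2 ≤ (Real.exp 1 * n) ^ M :=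
    hq.trans (le_self_pow₀ (by linarith) (by omega))
  have h2n : (1 : ℝ) ≤ 2 ^ n := one_le_pow₀ (by norm_num)
  have hcR : (E.card : ℝ) ≤ (1 + 2 ^ n) + ∑ v, ((𝒞 v).card : ℝ) := by exact_mod_cast hcard
  rw [hE, pow_succ]
  nlinarith
end

section
/- There exists a constant C > 0 such that for every n ≥ 2 and every nonempty family F of subsets of [n] there exists a vertex x of Q_n with |S_{r₀}(x) ∩ F| ≤ (C·√(log n)/√n) · |B_{r₀}(x) ∩ F|, where r₀ = ⌊n/2 − α√n⌋ and α = α(n) > 0 is the unique positive real satisfying e^{2α²}·α = √n/√(log n). -/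
lemma sum_card_filter_symmDiff {n : ℕ} (F : Finset (Finset (Fin n))) (p : ℕ → Prop)
    [DecidablePred p] :
    ∑ x : Finset (Fin n), (F.filter (fun y => p (symmDiff x y).card)).card
      = F.card * (Finset.univ.filter (fun z : Finset (Fin n) => p z.card)).card := by
  simp only [Finset.card_filter]
  rw [Finset.sum_comm, ← smul_eq_mul, ← Finset.sum_const]
  refine Finset.sum_congr rfl fun y _ => ?_
  refine Fintype.sum_bijective (fun x => symmDiff x y) ?_ _ _ (fun x => rfl)
  have h : Function.Involutive (fun x : Finset (Fin n) => symmDiff x y) := by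
    intro x
    simp
  exact h.bijective

lemma card_sphere (n r : ℕ) :
    (Finset.univ.filter (fun z : Finset (Fin n) => z.card = r)).card = n.choose r := by
  simp

lemma card_ball (n r : ℕ) :
    (Finset.univ.filter (fun z : Finset (Fin n) => z.card ≤ r)).card
      = ∑ i ∈ Finset.range (r + 1), n.choose (r - i) := by
  have h1 : ∑ i ∈ Finset.range (r + 1), n.choose (r - i)
      = ∑ i ∈ Finset.range (r + 1), n.choose i := by
    rw [← Finset.sum_range_reflect]
    refine Finset.sum_congr rfl fun i hi => ?_
    simp at hi
    congr 1
    omega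
  rw [h1, Finset.card_eq_sum_card_fiberwise (f := fun z => z.card) (t := Finset.range (r + 1))]
  · refine Finset.sum_congr rfl fun i hi => ?_
    rw [← card_sphere, Finset.filter_filter]
    congr 1
    ext z
    simp at hi ⊢
    omega
  · intro z hz
    simp at hz ⊢
    omega

lemma choose_lower (n r J : ℕ) (δ : ℝ) (hδ : 0 ≤ δ) (hJr : J ≤ r) (hr : 2 * r ≤ n)
    (h : (n : ℝ) - 2 * (r - J) ≤ δ * (n / 2)) (i : ℕ) (hi : i ≤ J) (hd1 : δ ≤ 1) :
    (n.choose r : ℝ) * (1 - i * δ) ≤ n.choose (r - i) := by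
  induction i with
  | zero => simp
  | succ i ih =>
    have ih := ih (by omega)
    obtain ⟨k, hk⟩ : ∃ k, r = k + (i + 1) := ⟨r - (i + 1), by omega⟩
    have e1 : r - i = k + 1 := by omega
    have e2 : r - (i + 1) = k := by omega
    rw [e1] at ih
    rw [e2]
    have h1 : (n.choose (k + 1) : ℝ) * (k + 1) = n.choose k * (n - k) := by
      have := Nat.choose_succ_right_eq n k
      have hkn : k ≤ n := by omega
      rw [← Nat.cast_sub hkn]
      exact_mod_cast this
    have hkr : (k : ℝ) + (i + 1) = r := by rw [hk]; push_cast; ring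
    have hiJ : (i : ℝ) + 1 ≤ J := by exact_mod_cast hi
    have hrn : 2 * (r : ℝ) ≤ n := by exact_mod_cast hr
    have hi0 : (0 : ℝ) ≤ i := by positivity
    have hk0 : (0 : ℝ) ≤ k := by positivity
    have hnk : (n : ℝ) / 2 ≤ n - k := by linarith
    have hnk0 : (0 : ℝ) < n - k := by linarith
    have hq : (1 - δ) * (n - k) ≤ k + 1 := by
      nlinarith [mul_le_mul_of_nonneg_left hnk hδ]
    have h2 : (1 - δ) * n.choose (k + 1) ≤ (n.choose k : ℝ) := by
      have hc : (0 : ℝ) ≤ n.choose (k + 1) := by positivity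
      have := mul_le_mul_of_nonneg_left hq hc
      rw [h1] at this
      refine le_of_mul_le_mul_right ?_ hnk0
      linarith
    have h3 := mul_le_mul_of_nonneg_left ih (sub_nonneg.2 hd1)
    have hc : (0 : ℝ) ≤ n.choose r := by positivity
    have h4 : (n.choose r : ℝ) * (1 - ((i : ℝ) + 1) * δ)
        ≤ (1 - δ) * (n.choose r * (1 - i * δ)) := by
      have : 0 ≤ (n.choose r : ℝ) * (i * δ * δ) := by positivity
      nlinarith
    push_cast
    linarith

lemma alpha_lt (n : ℕ) (hn : 2 ≤ n) (α : ℝ)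
    (h : Real.exp (2 * α ^ 2) * α = Real.sqrt n / Real.sqrt (Real.log n)) :
    α ≤ Real.sqrt (Real.log n) := by
  by_contra! hc
  have hn' : (2 : ℝ) ≤ n := by exact_mod_cast hn
  have hl2 : Real.log 2 ≤ Real.log n := Real.log_le_log (by norm_num) hn'
  have hl := Real.log_two_gt_d9
  have hL : 0 < Real.sqrt (Real.log n) := Real.sqrt_pos.2 (by linarith)
  have hLs := Real.sq_sqrt (show 0 ≤ Real.log n by linarith)
  have hs := Real.sq_sqrt (show (0:ℝ) ≤ n by linarith)
  set L := Real.sqrt (Real.log n)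
  set s := Real.sqrt (n : ℝ)
  have hs0 : 0 ≤ s := Real.sqrt_nonneg _
  have h1 : (n : ℝ) ^ 2 ≤ Real.exp (2 * α ^ 2) := by
    have : (n : ℝ) ^ 2 = Real.exp (2 * L ^ 2) := by
      rw [hLs, two_mul, Real.exp_add, Real.exp_log (by linarith)]; ring
    rw [this]
    apply Real.exp_le_exp.2
    nlinarith
  rw [eq_div_iff hL.ne'] at h
  have h2 : (n : ℝ) ^ 2 * L * L ≤ s := by
    rw [← h]
    gcongr
  have h3 : s ≤ n := by nlinarith
  nlinarith

lemma choose_le_ball (n : ℕ) (hn : 2 ≤ n) (α : ℝ) (hα : 0 < α)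
    (h : Real.exp (2 * α ^ 2) * α = Real.sqrt n / Real.sqrt (Real.log n))
    (hbig : 64 * Real.sqrt (Real.log n) < Real.sqrt n) (r : ℕ)
    (hr : r = ⌊(n : ℝ) / 2 - α * Real.sqrt n⌋₊) :
    (n.choose r : ℝ) ≤ 64 * Real.sqrt (Real.log n) / Real.sqrt n *
      (∑ i ∈ Finset.range (r + 1), n.choose (r - i) : ℕ) := by
  have hαL := alpha_lt n hn α h
  have hn' : (2 : ℝ) ≤ n := by exact_mod_cast hn
  have hl2 : Real.log 2 ≤ Real.log n := Real.log_le_log (by norm_num) hn'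
  have hl := Real.log_two_gt_d9
  have hL : 0 < Real.sqrt (Real.log n) := Real.sqrt_pos.2 (by linarith)
  have hLs := Real.sq_sqrt (show 0 ≤ Real.log n by linarith)
  have hs := Real.sq_sqrt (show (0:ℝ) ≤ n by linarith)
  set L := Real.sqrt (Real.log n)
  set s := Real.sqrt (n : ℝ)
  have hL8 : 0.8 ≤ L := by nlinarith
  have hs50 : 51 < s := by linarith
  have hs0 : 0 < s := by linarith
  have hαs : α * s ≤ L * s := mul_le_mul_of_nonneg_right hαL hs0.le
  have hαs0 : 0 < α * s := mul_pos hα hs0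
  have hLss : 64 * (L * s) ≤ s ^ 2 := by nlinarith
  have hss : 51 * s ≤ s ^ 2 := by nlinarith
  have hr1 : (n : ℝ) / 2 - L * s - 1 < r := by
    have := Nat.lt_floor_add_one ((n : ℝ) / 2 - α * s)
    rw [← hr] at this
    linarith
  have hr2 : (r : ℝ) ≤ n / 2 - α * s := by
    rw [hr]
    exact Nat.floor_le (by rw [← hs]; linarith)
  obtain ⟨J, hJ⟩ : ∃ J : ℕ, J = ⌊s / (16 * L)⌋₊ := ⟨_, rfl⟩
  have hJ1 : (J : ℝ) ≤ s / (16 * L) := by rw [hJ]; exact Nat.floor_le (by positivity)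
  have hJ2 : s / (16 * L) < J + 1 := by rw [hJ]; exact Nat.lt_floor_add_one _
  rw [le_div_iff₀ (by positivity)] at hJ1
  rw [div_lt_iff₀ (by positivity)] at hJ2
  have hJ0 : (0 : ℝ) ≤ J := by positivity
  have hJs : 12 * (J : ℝ) ≤ s := by nlinarith
  have hJr : J ≤ r := by
    have : (J : ℝ) ≤ r := by nlinarith
    exact_mod_cast this
  have hrn : 2 * r ≤ n := by
    have : 2 * (r : ℝ) ≤ n := by linarith
    exact_mod_cast this
  obtain ⟨δ, hδ⟩ : ∃ δ, δ = (4 * (L * s) + 4 * J + 4) / s ^ 2 := ⟨_, rfl⟩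
  have hδs : δ * s ^ 2 = 4 * (L * s) + 4 * J + 4 := by
    rw [hδ]; field_simp
  have hδ0 : 0 ≤ δ := by rw [hδ]; positivity
  have hJδ : J * δ ≤ 1 / 2 := by
    have : J * δ * s ^ 2 ≤ 1 / 2 * s ^ 2 := by
      rw [mul_assoc, hδs]
      have a1 : J * (L * s) * 16 ≤ s ^ 2 := by
        linarith [mul_le_mul_of_nonneg_right hJ1 hs0.le]
      have a2 : 144 * (J * J : ℝ) ≤ s ^ 2 := by
        linarith [mul_le_mul hJs hJs (by positivity) hs0.le]
      linarith
    exact le_of_mul_le_mul_right this (by positivity)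
  have hd1 : δ ≤ 1 := by
    have : δ * s ^ 2 ≤ 1 * s ^ 2 := by rw [hδs]; linarith
    exact le_of_mul_le_mul_right this (by positivity)
  have key : ∀ i ∈ Finset.range (J + 1), (n.choose r : ℝ) / 2 ≤ n.choose (r - i) := by
    intro i hi
    have hi' : i ≤ J := by simp at hi; omega
    have := choose_lower n r J δ hδ0 hJr hrn (by rw [← hs]; rw [← hs] at hr1; linarith) i hi' hd1
    have hc : (0 : ℝ) ≤ n.choose r := by positivity
    have hiJ : (i : ℝ) * δ ≤ J * δ := by gcongr
    nlinarith
  have hsum : ((J : ℝ) + 1) * (n.choose r / 2)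
      ≤ (∑ i ∈ Finset.range (r + 1), n.choose (r - i) : ℕ) := by
    push_cast
    calc ((J : ℝ) + 1) * (n.choose r / 2)
        = ∑ i ∈ Finset.range (J + 1), (n.choose r : ℝ) / 2 := by simp
      _ ≤ ∑ i ∈ Finset.range (J + 1), (n.choose (r - i) : ℝ) := Finset.sum_le_sum key
      _ ≤ _ := Finset.sum_le_sum_of_subset_of_nonneg
          (Finset.range_subset_range.2 (by omega)) (fun _ _ _ => by positivity)
  generalize (∑ i ∈ Finset.range (r + 1), n.choose (r - i) : ℕ) = V at hsum ⊢
  rw [div_mul_eq_mul_div, le_div_iff₀ hs0]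
  have hc : (0 : ℝ) ≤ n.choose r := by positivity
  have b1 := mul_le_mul_of_nonneg_left hsum hL.le
  have b2 := mul_le_mul_of_nonneg_left hJ2.le hc
  have b3 : (0 : ℝ) ≤ L * V := by positivity
  linarith

/-- The intersection of the Hamming sphere of radius `r` around `x` with `F`,
identifying `{0,1}^n` with subsets of `[n]` (Hamming distance = size of symmetric
difference). -/
def sphereInter {n : ℕ} (F : Finset (Finset (Fin n))) (x : Finset (Fin n)) (r : ℕ) :
    Finset (Finset (Fin n)) :=
  F.filter (fun y => (symmDiff x y).card = r)

/-- The intersection of the Hamming ball of radius `r` around `x` with `F`. -/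
def ballInter {n : ℕ} (F : Finset (Finset (Fin n))) (x : Finset (Fin n)) (r : ℕ) :
    Finset (Finset (Fin n)) :=
  F.filter (fun y => (symmDiff x y).card ≤ r)

/-- There is a constant `C > 0` such that for every `n ≥ 2` and every nonempty family
`F ⊆ P([n])` there is a vertex `x` of `Q_n` with
`|S_{r₀}(x) ∩ F| ≤ (C √(log n)/√n) · |B_{r₀}(x) ∩ F|`, where `r₀ = ⌊n/2 − α√n⌋` and
`α > 0` satisfies `e^{2α²}·α = √n/√(log n)`. -/
theorem sphere_vs_ball_intersection :
    ∃ C : ℝ, 0 < C ∧ ∀ n : ℕ, 2 ≤ n → ∀ α : ℝ, 0 < α →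
      Real.exp (2 * α ^ 2) * α = Real.sqrt n / Real.sqrt (Real.log n) →
      ∀ F : Finset (Finset (Fin n)), F.Nonempty →
        ∃ x : Finset (Fin n),
          ((sphereInter F x ⌊(n : ℝ) / 2 - α * Real.sqrt n⌋₊).card : ℝ) ≤
            C * Real.sqrt (Real.log n) / Real.sqrt n *
              ((ballInter F x ⌊(n : ℝ) / 2 - α * Real.sqrt n⌋₊).card : ℝ) := by
  refine ⟨64, by norm_num, ?_⟩
  intro n hn α hα h F hF
  obtain ⟨r, hr⟩ : ∃ r, r = ⌊(n : ℝ) / 2 - α * Real.sqrt n⌋₊ := ⟨_, rfl⟩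
  rw [← hr]
  have hn' : (2 : ℝ) ≤ n := by exact_mod_cast hn
  have hs0 : 0 < Real.sqrt (n : ℝ) := Real.sqrt_pos.2 (by linarith)
  by_cases hbig : 64 * Real.sqrt (Real.log n) < Real.sqrt n
  · by_contra! hcon
    have hlt := Finset.sum_lt_sum_of_nonempty (s := (Finset.univ : Finset (Finset (Fin n))))
      Finset.univ_nonempty (fun x _ => hcon x)
    have e1 := sum_card_filter_symmDiff F (fun k => k = r)
    have e2 := sum_card_filter_symmDiff F (fun k => k ≤ r)
    rw [card_sphere] at e1
    rw [card_ball] at e2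
    rw [← Finset.mul_sum, ← Nat.cast_sum, ← Nat.cast_sum] at hlt
    simp only [sphereInter, ballInter] at hlt
    rw [e1, e2] at hlt
    have hb := choose_le_ball n hn α hα h hbig r hr
    have := mul_le_mul_of_nonneg_left hb (Nat.cast_nonneg (α := ℝ) F.card)
    rw [Nat.cast_mul, Nat.cast_mul] at hlt
    linarith
  · refine ⟨∅, ?_⟩
    have hsub : (sphereInter F ∅ r).card ≤ (ballInter F ∅ r).card := by
      apply Finset.card_le_card
      intro y
      simp only [sphereInter, ballInter, Finset.mem_filter]
      exact fun hy => ⟨hy.1, hy.2.le⟩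
    have hsub' : ((sphereInter F ∅ r).card : ℝ) ≤ (ballInter F ∅ r).card := by
      exact_mod_cast hsub
    have h1 : 1 ≤ 64 * Real.sqrt (Real.log n) / Real.sqrt n := by
      rw [le_div_iff₀ hs0]
      linarith
    exact hsub'.trans (le_mul_of_one_le_left (by positivity) h1)
end

section
/- Let α = α(n) > 0 be the unique positive real satisfying e^{2α²}·α = √n/√(log n), and set r₀ = ⌊n/2 − α√n⌋. Then Σ_{i=0}^{r₀} C(n,i) = Θ(2^n · √(log n)/√n); that is, there exist constants c, C > 0 and N such that for all n ≥ N, c · 2^n √(log n)/√n ≤ Σ_{i=0}^{r₀} C(n,i) ≤ C · 2^n √(log n)/√n. -/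
theorem aux_f_hasSum (t : ℝ) (h0 : 0 ≤ t) (h1 : t < 1) :
    HasSum (fun k : ℕ => t ^ (2 * k + 2) * (1 / ((k + 1) * (2 * k + 1))))
      ((1 - t) * Real.log (1 - t) + (1 + t) * Real.log (1 + t)) := by
  have ht : |t| < 1 := by rw [abs_of_nonneg h0]; exact h1
  have ht2 : |t ^ 2| < 1 := by
    rw [abs_of_nonneg (sq_nonneg t)]; nlinarith
  have A := (Real.hasSum_log_sub_log_of_abs_lt_one ht).mul_left t
  have B := Real.hasSum_pow_div_log_of_abs_lt_one ht2
  have hl : Real.log (1 - t ^ 2) = Real.log (1 - t) + Real.log (1 + t) := by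
    rw [← Real.log_mul (by linarith) (by linarith)]; congr 1; ring
  have D := A.sub B
  have e1 : (fun k : ℕ => t ^ (2 * k + 2) * (1 / (((k : ℝ) + 1) * (2 * k + 1)))) =
      fun b : ℕ => t * (2 * (1 / (2 * (b : ℝ) + 1)) * t ^ (2 * b + 1)) -
        (t ^ 2) ^ (b + 1) / ((b : ℝ) + 1) := by
    funext k
    have : (k : ℝ) + 1 ≠ 0 := by positivity
    have : 2 * (k : ℝ) + 1 ≠ 0 := by positivity
    rw [← pow_mul]
    field_simp
    ring
  have e2 : (1 - t) * Real.log (1 - t) + (1 + t) * Real.log (1 + t) =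
      t * (Real.log (1 + t) - Real.log (1 - t)) - -Real.log (1 - t ^ 2) := by
    rw [hl]; ring
  rw [e1, e2]
  exact D

theorem aux_f_lower (t : ℝ) (h0 : 0 ≤ t) (h1 : t < 1) :
    t ^ 2 ≤ (1 - t) * Real.log (1 - t) + (1 + t) * Real.log (1 + t) := by
  have := le_hasSum (aux_f_hasSum t h0 h1) 0 (fun k _ => by positivity)
  simpa using this

theorem aux_f_upper (t : ℝ) (h0 : 0 ≤ t) (h1 : t ≤ 1 / 2) :
    (1 - t) * Real.log (1 - t) + (1 + t) * Real.log (1 + t) ≤ t ^ 2 + t ^ 4 := by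
  have A := aux_f_hasSum t h0 (by linarith)
  have A' := (hasSum_nat_add_iff' 1).2 A
  have G := (hasSum_geometric_of_lt_one (sq_nonneg t) (by nlinarith)).mul_left (t ^ 4 / 6)
  have H := hasSum_le (fun k => ?_) A' G
  · simp at H
    have : t ^ 4 / 6 * (1 - t ^ 2)⁻¹ ≤ t ^ 4 := by
      rw [← div_eq_mul_inv, div_le_iff₀ (by nlinarith)]
      have : 0 ≤ t ^ 4 := by positivity
      have h4 : t ^ 2 ≤ 1 / 4 := by nlinarith
      nlinarith [mul_le_mul_of_nonneg_left h4 this]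
    linarith
  · rw [← pow_mul]
    have e : t ^ (2 * (k + 1) + 2) = t ^ 4 * t ^ (2 * k) := by ring
    rw [e, div_mul_eq_mul_div, div_eq_mul_one_div (t ^ 4 * t ^ (2 * k))]
    apply mul_le_mul_of_nonneg_left _ (by positivity)
    apply one_div_le_one_div_of_le (by norm_num)
    push_cast
    have : (0 : ℝ) ≤ k := by positivity
    nlinarith

noncomputable def auxS (n : ℕ) : ℝ := Real.sqrt n * (n / Real.exp 1) ^ n

theorem auxS_pos (n : ℕ) (h : 1 ≤ n) : 0 < auxS n := by
  unfold auxS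
  have : (0 : ℝ) < n := by exact_mod_cast h
  positivity

theorem auxS_lower (n : ℕ) (h : 1 ≤ n) : auxS n ≤ n.factorial := by
  have H := Stirling.le_factorial_stirling n
  refine le_trans ?_ H
  unfold auxS
  gcongr
  have : (0 : ℝ) < n := by exact_mod_cast h
  nlinarith [Real.pi_gt_three]

theorem auxS_upper (n : ℕ) (h : 1 ≤ n) : (n.factorial : ℝ) ≤ 3 * auxS n := by
  obtain ⟨k, rfl⟩ : ∃ k, n = k + 1 := ⟨n - 1, by omega⟩
  have H := Stirling.stirlingSeq'_antitone (Nat.zero_le k)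
  simp only [Function.comp, Nat.succ_eq_add_one, zero_add, Stirling.stirlingSeq_one] at H
  unfold Stirling.stirlingSeq at H
  have hp : (0 : ℝ) < ((k + 1 : ℕ) : ℝ) := by positivity
  rw [div_le_iff₀ (by positivity)] at H
  refine H.trans ?_
  rw [Real.sqrt_mul (by norm_num)]
  have h2 : Real.sqrt 2 ≠ 0 := by positivity
  have : Real.exp 1 / √2 * (√2 * √((k + 1 : ℕ) : ℝ) * (((k + 1 : ℕ) : ℝ) / Real.exp 1) ^ (k + 1))
     = Real.exp 1 * auxS (k + 1) := by
    unfold auxS; field_simp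
  rw [this]
  have := auxS_pos (k + 1) (by omega)
  nlinarith [Real.exp_one_lt_d9]

theorem auxS_log (n : ℕ) (h : 1 ≤ n) :
    Real.log (auxS n) = Real.log n / 2 + n * Real.log n - n := by
  unfold auxS
  have : (0 : ℝ) < n := by exact_mod_cast h
  rw [Real.log_mul (by positivity) (by positivity), Real.log_sqrt this.le, Real.log_pow,
    Real.log_div (by positivity) (by positivity), Real.log_exp]
  ring

theorem auxS_ratio (n m : ℕ) (t : ℝ) (hm : 1 ≤ m) (hmn : m < n) (ht : t = 1 - 2 * m / n) :
    auxS n / (auxS m * auxS (n - m)) = Real.sqrt (n / (m * (n - m))) * 2 ^ n *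
      Real.exp (-(n / 2 * ((1 - t) * Real.log (1 - t) + (1 + t) * Real.log (1 + t)))) := by
  have p1 := auxS_pos n (by omega)
  have p2 := auxS_pos m (by omega)
  have p3 := auxS_pos (n - m) (by omega)
  have hn0 : (0 : ℝ) < n := by exact_mod_cast (by omega : 0 < n)
  have hm0 : (0 : ℝ) < m := by exact_mod_cast (by omega : 0 < m)
  have hnm0 : (0 : ℝ) < n - m := by
    have : (m : ℝ) < n := by exact_mod_cast hmn
    linarith
  have e1 : 1 - t = 2 * m / n := by rw [ht]; ring
  have e2 : 1 + t = 2 * (n - m) / n := by rw [ht]; field_simp; ring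
  rw [e1, e2]
  apply Real.log_injOn_pos
  · exact div_pos p1 (mul_pos p2 p3)
  · show (0 : ℝ) < _
    positivity
  rw [Real.log_div p1.ne' (mul_pos p2 p3).ne', Real.log_mul p2.ne' p3.ne',
    Real.log_mul (by positivity) (by positivity), Real.log_mul (by positivity) (by positivity),
    Real.log_exp, Real.log_pow, Real.log_sqrt (by positivity),
    Real.log_div hn0.ne' (by positivity), Real.log_mul hm0.ne' hnm0.ne',
    Real.log_div (by positivity) hn0.ne', Real.log_div (by positivity) hn0.ne',
    Real.log_mul (by norm_num) hm0.ne', Real.log_mul (by norm_num) hnm0.ne',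
    auxS_log _ (by omega), auxS_log _ hm, auxS_log _ (by omega), Nat.cast_sub hmn.le]
  field_simp
  ring

theorem aux_choose (n m : ℕ) (hm : 1 ≤ m) (hmn : m < n) :
    1 / 9 * (auxS n / (auxS m * auxS (n - m))) ≤ n.choose m ∧
    (n.choose m : ℝ) ≤ 3 * (auxS n / (auxS m * auxS (n - m))) := by
  have p1 := auxS_pos n (by omega)
  have p2 := auxS_pos m (by omega)
  have p3 := auxS_pos (n - m) (by omega)
  have l1 := auxS_lower n (by omega)
  have l2 := auxS_lower m (by omega)
  have l3 := auxS_lower (n - m) (by omega)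
  have u1 := auxS_upper n (by omega)
  have u2 := auxS_upper m (by omega)
  have u3 := auxS_upper (n - m) (by omega)
  rw [Nat.cast_choose ℝ hmn.le]
  constructor
  · calc 1 / 9 * (auxS n / (auxS m * auxS (n - m)))
        = auxS n / ((3 * auxS m) * (3 * auxS (n - m))) := by field_simp; norm_num
      _ ≤ _ := by gcongr
  · calc _ ≤ (3 * auxS n) / (auxS m * auxS (n - m)) := by gcongr
      _ = _ := by ring

theorem aux_point (n m : ℕ) (t : ℝ) (hm : (n : ℝ) / 4 ≤ m) (hmn : (m : ℝ) ≤ n / 2) (hn : 1 ≤ n)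
    (ht : t = 1 - 2 * m / n) :
    2 / 9 * 2 ^ n / Real.sqrt n * Real.exp (-(n / 2 * (t ^ 2 + t ^ 4))) ≤ n.choose m ∧
    (n.choose m : ℝ) ≤ 9 * 2 ^ n / Real.sqrt n * Real.exp (-(n / 2 * t ^ 2)) := by
  have hn0 : (0 : ℝ) < n := by exact_mod_cast (by omega : 0 < n)
  have hm0 : (0 : ℝ) < m := by linarith
  have hm1 : 1 ≤ m := by exact_mod_cast hm0
  have hmn1 : m < n := by
    have : (m : ℝ) < n := by linarith
    exact_mod_cast this
  have hnm0 : (0 : ℝ) < n - m := by linarith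
  obtain ⟨L, U⟩ := aux_choose n m hm1 hmn1
  rw [auxS_ratio n m t hm1 hmn1 ht] at L U
  have t0 : 0 ≤ t := by
    rw [ht, sub_nonneg, div_le_one hn0]; linarith
  have t1 : t ≤ 1 / 2 := by
    have : 1 / 2 ≤ 2 * (m : ℝ) / n := by rw [le_div_iff₀ hn0]; linarith
    linarith
  have fl := aux_f_lower t t0 (by linarith)
  have fu := aux_f_upper t t0 t1
  have hs : 0 < Real.sqrt n := Real.sqrt_pos.2 hn0
  have hss : Real.sqrt n ^ 2 = n := Real.sq_sqrt hn0.le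
  have sl : 2 / Real.sqrt n ≤ Real.sqrt (n / (m * (n - m))) := by
    apply Real.le_sqrt_of_sq_le
    rw [div_pow, hss, div_le_div_iff₀ hn0 (by positivity)]
    nlinarith [sq_nonneg ((n : ℝ) - 2 * m)]
  have su : Real.sqrt (n / (m * (n - m))) ≤ 3 / Real.sqrt n := by
    apply Real.sqrt_le_iff.2 ⟨by positivity, ?_⟩
    rw [div_pow, hss, div_le_div_iff₀ (by positivity) hn0]
    nlinarith [mul_nonneg (sub_nonneg.2 hm) (by linarith : (0 : ℝ) ≤ 3 * n / 4 - m)]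
  constructor
  · refine le_trans ?_ L
    calc _ = 1 / 9 * (2 / √(n : ℝ) * 2 ^ n * Real.exp (-(n / 2 * (t ^ 2 + t ^ 4)))) := by ring
      _ ≤ _ := by gcongr
  · refine U.trans ?_
    calc _ ≤ 3 * (3 / √(n : ℝ) * 2 ^ n * Real.exp (-(n / 2 * t ^ 2))) := by gcongr
      _ = _ := by ring

theorem aux_tail (n m : ℕ) (h : 2 * m ≤ n) :
    ((n : ℝ) - 2 * m + 1) * (∑ i ∈ Finset.range (m + 1), n.choose i : ℝ) ≤
      (n - m + 1) * n.choose m := by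
  induction m with
  | zero => simp
  | succ m ih =>
    have ih := ih (by omega)
    rw [Finset.sum_range_succ]
    set S := (∑ i ∈ Finset.range (m + 1), n.choose i : ℝ)
    have hc : (n.choose (m + 1) : ℝ) * (m + 1) = n.choose m * (n - m) := by
      have := Nat.choose_succ_right_eq n m
      have h2 : ((n - m : ℕ) : ℝ) = n - m := Nat.cast_sub (by omega)
      rw [← h2]; exact_mod_cast this
    have hr : 2 * ((m : ℝ) + 1) ≤ n := by exact_mod_cast h
    have hm0 : (0 : ℝ) ≤ m := by positivity
    have ha : (0 : ℝ) < n - 2 * m + 1 := by linarith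
    have hb : (0 : ℝ) < n - m := by linarith
    set X := (n.choose (m + 1) : ℝ)
    set Y := (n.choose m : ℝ)
    have hX : 0 ≤ X := by positivity
    have key : ((n : ℝ) - 2 * m - 1) * S ≤ (m + 1) * X := by
      have h1 : S ≤ (n - m + 1) * Y / (n - 2 * m + 1) := by rw [le_div_iff₀ ha]; linarith
      have hY : Y = X * (m + 1) / (n - m) := by rw [eq_div_iff hb.ne', hc]
      calc _ ≤ ((n : ℝ) - 2 * m - 1) * ((n - m + 1) * Y / (n - 2 * m + 1)) :=
            mul_le_mul_of_nonneg_left h1 (by linarith)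
        _ = ((m + 1) * X) * (((n : ℝ) - 2 * m - 1) * (n - m + 1) / ((n - 2 * m + 1) * (n - m))) := by
            rw [hY]; field_simp
        _ ≤ ((m + 1) * X) * 1 := by
            apply mul_le_mul_of_nonneg_left _ (by positivity)
            rw [div_le_one (by positivity)]
            nlinarith
        _ = _ := by ring
    push_cast
    linarith

theorem aux_large : ∃ N : ℕ, ∀ n : ℕ, N ≤ n →
    Real.exp 18 * 3 ≤ Real.sqrt n / Real.sqrt (Real.log n) ∧ 3 ≤ n := by
  have h := Real.isLittleO_log_id_atTop.bound
    (show (0 : ℝ) < ((Real.exp 18 * 3) ^ 2)⁻¹ by positivity)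
  have h' := (tendsto_natCast_atTop_atTop (R := ℝ)).eventually h
  obtain ⟨N, hN⟩ := Filter.eventually_atTop.1 h'
  refine ⟨max N 3, fun n hn => ?_⟩
  have h3 : 3 ≤ n := le_trans (le_max_right _ _) hn
  refine ⟨?_, h3⟩
  have := hN n (le_trans (le_max_left _ _) hn)
  have hn1 : (1 : ℝ) < n := by exact_mod_cast (by omega : 1 < n)
  have hL := Real.log_pos hn1
  simp only [id, Real.norm_eq_abs] at this
  rw [abs_of_pos hL, abs_of_pos (by linarith)] at this
  rw [← Real.sqrt_div (by linarith)]
  apply Real.le_sqrt_of_sq_le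
  rw [le_div_iff₀ hL]
  rw [inv_mul_eq_div, le_div_iff₀ (by positivity)] at this
  linarith


set_option maxHeartbeats 2000000

/-- With `α = α(n) > 0` the unique positive real satisfying
`e^{2α²}·α = √n/√(log n)` and `r₀ = ⌊n/2 − α√n⌋`, the Hamming ball size satisfies
`∑_{i=0}^{r₀} C(n,i) = Θ(2^n √(log n)/√n)`. -/
theorem ball_size_asymptotics :
    ∃ c C : ℝ, 0 < c ∧ 0 < C ∧ ∃ N : ℕ, ∀ n : ℕ, N ≤ n → ∀ α : ℝ, 0 < α →
      Real.exp (2 * α ^ 2) * α = Real.sqrt n / Real.sqrt (Real.log n) →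
      c * 2 ^ n * Real.sqrt (Real.log n) / Real.sqrt n ≤
        (∑ i ∈ Finset.range (⌊(n : ℝ) / 2 - α * Real.sqrt n⌋₊ + 1), n.choose i : ℝ) ∧
      (∑ i ∈ Finset.range (⌊(n : ℝ) / 2 - α * Real.sqrt n⌋₊ + 1), n.choose i : ℝ) ≤
        C * 2 ^ n * Real.sqrt (Real.log n) / Real.sqrt n := by
  obtain ⟨N, hN⟩ := aux_large
  refine ⟨Real.exp (-17) / 9, 9, by positivity, by norm_num, N, fun n hn α hα heq => ?_⟩
  obtain ⟨hbig, hn3⟩ := hN n hn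
  have hn0 : (3 : ℝ) ≤ n := by exact_mod_cast hn3
  have hL : 1 ≤ Real.log n := by
    rw [Real.le_log_iff_exp_le (by linarith)]
    linarith [Real.exp_one_lt_d9]
  have hsL : 1 ≤ √(Real.log n) := Real.one_le_sqrt.2 hL
  have hs : 0 < √(n : ℝ) := Real.sqrt_pos.2 (by linarith)
  have hss : √(n : ℝ) ^ 2 = n := Real.sq_sqrt (by linarith)
  have hα3 : 3 ≤ α := by
    by_contra hc
    push Not at hc
    have : Real.exp (2 * α ^ 2) < Real.exp 18 := Real.exp_lt_exp.2 (by nlinarith)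
    have : Real.exp (2 * α ^ 2) * α < Real.exp 18 * 3 := by gcongr
    linarith
  have hE : Real.exp (2 * α ^ 2) ≤ √(n : ℝ) := by
    have h1 : √(n : ℝ) / √(Real.log n) ≤ √(n : ℝ) := div_le_self hs.le hsL
    nlinarith [Real.exp_pos (2 * α ^ 2)]
  have hP : 648 * α ^ 4 ≤ n := by
    have h1 : Real.exp (4 * α ^ 2) ≤ n := by
      rw [← hss, show 4 * α ^ 2 = 2 * α ^ 2 + 2 * α ^ 2 by ring, Real.exp_add, ← sq]
      gcongr
    have h2 := Real.pow_div_factorial_le_exp (4 * α ^ 2) (by positivity) 4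
    norm_num [Nat.factorial] at h2
    have h3 : (81 : ℝ) ≤ α ^ 4 := by
      calc (81 : ℝ) = 3 ^ 4 := by norm_num
        _ ≤ _ := by gcongr
    nlinarith
  have hα2 : 9 ≤ α ^ 2 := by nlinarith
  have hP2 : 144 * α ^ 2 ≤ n := by nlinarith
  set s := √(n : ℝ) with hsdef
  have hsα : 12 * α ≤ s := by
    apply Real.le_sqrt_of_sq_le; nlinarith
  have hexp : Real.exp (-(2 * α ^ 2)) / α = √(Real.log n) / s := by
    rw [Real.exp_neg]
    have := Real.exp_pos (2 * α ^ 2)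
    rw [div_eq_div_iff hα.ne' hs.ne']
    rw [eq_div_iff (by positivity)] at heq
    rw [inv_mul_eq_div, div_eq_iff this.ne']
    linarith
  have hαs : 12 * (α * s) ≤ n := by nlinarith
  set m := ⌊(n : ℝ) / 2 - α * s⌋₊ with hm
  have hmle : (m : ℝ) ≤ n / 2 - α * s := Nat.floor_le (by linarith)
  have hmlt : (n : ℝ) / 2 - α * s < m + 1 := Nat.lt_floor_add_one _
  have hαs0 : 0 < α * s := by positivity
  -- the window length
  set K := ⌊s / α⌋₊ with hK
  have hsa : 12 ≤ s / α := by rw [le_div_iff₀ hα]; exact hsα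
  have hKle : (K : ℝ) ≤ s / α := Nat.floor_le (by linarith)
  have hKlt : s / α < K + 1 := Nat.lt_floor_add_one _
  have hYb : (α * s + 2 * (s / α)) ^ 2 ≤ (α ^ 2 + 8) * n := by
    have e : (α * s + 2 * (s / α)) ^ 2 = α ^ 2 * n + 4 * n + 4 * (n / α ^ 2) := by
      rw [← hss]; field_simp; ring
    have : (n : ℝ) / α ^ 2 ≤ n := div_le_self (by linarith) (by linarith)
    rw [e]; linarith
  have hY4 : α * s + 2 * (s / α) ≤ n / 4 := by
    refine abs_le_of_sq_le_sq' ?_ (by linarith) |>.2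
    refine hYb.trans ?_
    nlinarith
  have hm4 : (n : ℝ) / 4 ≤ m - K := by linarith
  have hKm : K ≤ m := by
    have : (K : ℝ) ≤ m := by linarith
    exact_mod_cast this
  constructor
  · have hterm : ∀ i ∈ Finset.Ioc (m - K) m,
        2 / 9 * 2 ^ n / s * Real.exp (-(2 * α ^ 2) - 17) ≤ (n.choose i : ℝ) := by
      intro i hi
      rw [Finset.mem_Ioc] at hi
      have hi1 : (m : ℝ) - K ≤ i := by
        rw [← Nat.cast_sub hKm]; exact_mod_cast hi.1.le
      have hi2 : (i : ℝ) ≤ m := by exact_mod_cast hi.2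
      have hp := (aux_point n i _ (by linarith) (by linarith) (by omega) rfl).1
      refine le_trans ?_ hp
      apply mul_le_mul_of_nonneg_left _ (by positivity)
      apply Real.exp_le_exp.2
      set y := (n : ℝ) / 2 - i with hy
      have hy0 : 0 ≤ y := by linarith
      have hyle : y ≤ α * s + 2 * (s / α) := by linarith
      have hy2 : y ^ 2 ≤ (α ^ 2 + 8) * n := le_trans (by gcongr) hYb
      have et : 1 - 2 * (i : ℝ) / n = 2 * y / n := by rw [hy]; field_simp
      rw [et]
      have e2 : (n : ℝ) / 2 * ((2 * y / n) ^ 2 + (2 * y / n) ^ 4)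
          = 2 * (y ^ 2 / n) + 8 * (y ^ 2 / n) ^ 2 / n := by field_simp; ring
      rw [e2]
      have hz : y ^ 2 / n ≤ α ^ 2 + 8 := by rw [div_le_iff₀ (by linarith)]; exact hy2
      have hz0 : 0 ≤ y ^ 2 / n := by positivity
      have : 8 * (y ^ 2 / n) ^ 2 / n ≤ 1 := by
        rw [div_le_one (by linarith)]
        have : (y ^ 2 / n) ^ 2 ≤ (9 * α ^ 2) ^ 2 := by
          gcongr; linarith
        nlinarith
      linarith
    have hsum := Finset.card_nsmul_le_sum _ _ _ hterm
    rw [Nat.card_Ioc, Nat.sub_sub_self hKm, nsmul_eq_mul] at hsum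
    have hsub : ∑ i ∈ Finset.Ioc (m - K) m, (n.choose i : ℝ) ≤
        ∑ i ∈ Finset.range (m + 1), (n.choose i : ℝ) := by
      apply Finset.sum_le_sum_of_subset_of_nonneg
      · intro i hi
        rw [Finset.mem_Ioc] at hi
        rw [Finset.mem_range]; omega
      · intros; positivity
    refine le_trans ?_ (hsum.trans hsub)
    have hKh : s / α / 2 ≤ K := by linarith
    calc Real.exp (-17) / 9 * 2 ^ n * √(Real.log n) / s
        = Real.exp (-17) / 9 * 2 ^ n * (√(Real.log n) / s) := by ring
      _ = s / α / 2 * (2 / 9 * 2 ^ n / s * Real.exp (-(2 * α ^ 2) - 17)) := by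
          rw [← hexp, sub_eq_add_neg, Real.exp_add]; field_simp
      _ ≤ _ := mul_le_mul_of_nonneg_right hKh (by positivity)
  · have hK0 : (0 : ℝ) ≤ K := by positivity
    have hp := (aux_point n m _ (by linarith) (by linarith) (by omega) rfl).2
    have h2m : 2 * m ≤ n := by
      have : 2 * (m : ℝ) ≤ n := by linarith
      exact_mod_cast this
    have ht := aux_tail n m h2m
    set S := (∑ i ∈ Finset.range (m + 1), n.choose i : ℝ)
    have hS0 : 0 ≤ S := Finset.sum_nonneg (fun i _ => by positivity)
    have hexpo : 2 * α ^ 2 ≤ n / 2 * (1 - 2 * (m : ℝ) / n) ^ 2 := by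
      have e : (n : ℝ) / 2 * (1 - 2 * (m : ℝ) / n) ^ 2 = 2 * (n / 2 - m) ^ 2 / n := by
        field_simp
      rw [e, le_div_iff₀ (by linarith)]
      have : (α * s) ^ 2 ≤ (n / 2 - m) ^ 2 := by gcongr; linarith
      rw [mul_pow, hss] at this
      linarith
    have h1 : 2 * (α * s) * S ≤ (2 * n) * (9 * 2 ^ n / s * Real.exp (-(2 * α ^ 2))) := by
      calc _ ≤ ((n : ℝ) - 2 * m + 1) * S := by gcongr; linarith
        _ ≤ _ := ht
        _ ≤ (2 * n) * (n.choose m : ℝ) := by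
          gcongr
          have : (0 : ℝ) ≤ m := by positivity
          linarith
        _ ≤ _ := by
          gcongr
          refine hp.trans ?_
          gcongr
    calc S ≤ (2 * n) * (9 * 2 ^ n / s * Real.exp (-(2 * α ^ 2))) / (2 * (α * s)) := by
          rw [le_div_iff₀ (by positivity)]; linarith
      _ = 9 * 2 ^ n * (Real.exp (-(2 * α ^ 2)) / α) := by
          rw [← hss]; field_simp
      _ = _ := by rw [hexp]; ring
end

section
/- Let α = α(n) > 0 be the unique positive real satisfying e^{2α²}·α = √n/√(log n), and set r₀ = ⌊n/2 − α√n⌋. Then C(n, r₀) = Θ(2^n · (log n)/n); that is, there exist constants c, C > 0 and N such that for all n ≥ N, c · 2^n (log n)/n ≤ C(n, r₀) ≤ C · 2^n (log n)/n. -/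
lemma log_stirling_bdd : ∃ M : ℝ, ∀ m : ℕ, 0 < m →
    |Real.log (m.factorial : ℝ) - (1 / 2 * Real.log (2 * m) + m * Real.log m - m)| ≤ M := by
  obtain ⟨a, ha⟩ : ∃ a : ℝ, ∀ n : ℕ, a ≤ Real.log (Stirling.stirlingSeq (n + 1)) :=
    ⟨_, Stirling.log_stirlingSeq_bounded_by_constant⟩
  refine ⟨|a| + |Real.log (Stirling.stirlingSeq 1)|, fun m hm => ?_⟩
  obtain ⟨k, rfl⟩ : ∃ k, m = k + 1 := ⟨m - 1, by omega⟩
  have h1 := ha k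
  have h2 : Real.log (Stirling.stirlingSeq (k + 1)) ≤ Real.log (Stirling.stirlingSeq 1) :=
    Stirling.log_stirlingSeq'_antitone (Nat.zero_le k)
  have h3 := Stirling.log_stirlingSeq_formula (k + 1)
  have hk : ((k + 1 : ℕ) : ℝ) ≠ 0 := by positivity
  rw [Real.log_div hk (Real.exp_pos 1).ne', Real.log_exp] at h3
  have e : Real.log ((k + 1).factorial : ℝ) - (1 / 2 * Real.log (2 * (k + 1 : ℕ))
      + (k + 1 : ℕ) * Real.log (k + 1 : ℕ) - (k + 1 : ℕ)) =
      Real.log (Stirling.stirlingSeq (k + 1)) := by rw [h3]; ring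
  rw [e, abs_le]
  constructor
  · linarith [neg_abs_le a, abs_nonneg (Real.log (Stirling.stirlingSeq 1))]
  · linarith [le_abs_self (Real.log (Stirling.stirlingSeq 1)), abs_nonneg a]

lemma entropy_bound (x : ℝ) (h0 : 0 ≤ x) (h1 : x ≤ 1 / 2) :
    |(1 + x) * Real.log (1 + x) + (1 - x) * Real.log (1 - x) - x ^ 2| ≤ 5 * x ^ 4 := by
  have p := Real.abs_log_sub_add_sum_range_le (x := x) (by rw [abs_of_nonneg h0]; linarith) 3
  have q := Real.abs_log_sub_add_sum_range_le (x := -x)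
    (by rw [abs_neg, abs_of_nonneg h0]; linarith) 3
  rw [abs_neg] at q
  have hb : |x| ^ (3 + 1) / (1 - |x|) ≤ 2 * x ^ 4 := by
    rw [abs_of_nonneg h0, div_le_iff₀ (by linarith)]
    have := mul_nonneg (pow_nonneg h0 4) (by linarith : (0:ℝ) ≤ 1 - 2 * x)
    norm_num
    linarith
  replace p := abs_le.1 (p.trans hb)
  replace q := abs_le.1 (q.trans hb)
  simp only [Finset.sum_range_succ, Finset.sum_range_zero] at p q
  norm_num at p q
  obtain ⟨p1, p2⟩ := p
  obtain ⟨q1, q2⟩ := q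
  have hx4 := pow_nonneg h0 4
  rw [abs_le]
  constructor <;> nlinarith [mul_le_mul_of_nonneg_left p1 (by linarith : (0:ℝ) ≤ 1 - x),
    mul_le_mul_of_nonneg_left p2 (by linarith : (0:ℝ) ≤ 1 - x),
    mul_le_mul_of_nonneg_left q1 (by linarith : (0:ℝ) ≤ 1 + x),
    mul_le_mul_of_nonneg_left q2 (by linarith : (0:ℝ) ≤ 1 + x)]

lemma log_choose_bound : ∃ K : ℝ, ∀ n r : ℕ, 0 < n → ∀ x : ℝ, 0 ≤ x → x ≤ 1 / 2 →
    (r : ℝ) = n * (1 - x) / 2 →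
    |Real.log (n.choose r : ℝ) - (n * Real.log 2 - 1 / 2 * Real.log n - n / 2 * x ^ 2)|
      ≤ K + 5 / 2 * (n * x ^ 4) := by
  obtain ⟨M, hM⟩ := log_stirling_bdd
  refine ⟨3 * M + 2, fun n r hn x h0 h1 hr => ?_⟩
  have hnR : (0 : ℝ) < n := by exact_mod_cast hn
  have hrR : (0 : ℝ) < r := by rw [hr]; have : 0 < 1 - x := by linarith
                               positivity
  have hr0 : 0 < r := by exact_mod_cast hrR
  have hrn : (r : ℝ) < n := by rw [hr]; nlinarith
  have hrn' : r < n := by exact_mod_cast hrn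
  have hs : ((n - r : ℕ) : ℝ) = n * (1 + x) / 2 := by
    rw [Nat.cast_sub hrn'.le, hr]; ring
  have a1 := abs_le.1 (hM n hn)
  have a2 := abs_le.1 (hM r hr0)
  have a3 := abs_le.1 (hM (n - r) (by omega))
  have hc : Real.log (n.choose r : ℝ) = Real.log (n.factorial : ℝ) - Real.log (r.factorial : ℝ)
      - Real.log ((n - r).factorial : ℝ) := by
    rw [Nat.cast_choose ℝ hrn'.le, Real.log_div (by positivity) (by positivity),
      Real.log_mul (by positivity) (by positivity)]
    ring
  have u1 : (1 - x) ≠ 0 := by linarith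
  have u2 : (1 + x) ≠ 0 := by linarith
  have l1 : Real.log r = Real.log n + Real.log (1 - x) - Real.log 2 := by
    rw [hr, Real.log_div (by positivity) (by norm_num), Real.log_mul hnR.ne' u1]
  have l2 : Real.log (n - r : ℕ) = Real.log n + Real.log (1 + x) - Real.log 2 := by
    rw [hs, Real.log_div (by positivity) (by norm_num), Real.log_mul hnR.ne' u2]
  have hsR : (0 : ℝ) < (n - r : ℕ) := by rw [hs]; positivity
  rw [Real.log_mul two_ne_zero hnR.ne'] at a1
  rw [Real.log_mul two_ne_zero hrR.ne', l1] at a2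
  rw [Real.log_mul two_ne_zero hsR.ne', l2] at a3
  have hE := abs_le.1 (entropy_bound x h0 h1)
  have b1 : Real.log (1 - x) ≤ 0 := by linarith [Real.log_le_sub_one_of_pos (by linarith : 0 < 1 - x)]
  have b2 : Real.log (1 + x) ≤ 1 := by linarith [Real.log_le_sub_one_of_pos (by linarith : 0 < 1 + x)]
  have b3 : 0 ≤ Real.log (1 + x) := Real.log_nonneg (by linarith)
  have b4 : -1 ≤ Real.log (1 - x) := by
    have := Real.one_sub_inv_le_log_of_pos (by linarith : 0 < 1 - x)
    have h2 : (1 - x)⁻¹ ≤ 2 := by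
      rw [inv_le_comm₀ (by linarith) (by norm_num)]; linarith
    linarith
  have c1 : 0 ≤ Real.log 2 := Real.log_nonneg (by norm_num)
  have c2 : Real.log 2 ≤ 1 := by linarith [Real.log_le_sub_one_of_pos (by norm_num : (0:ℝ) < 2)]
  have e : (r : ℝ) * (Real.log n + Real.log (1 - x) - Real.log 2) +
      (n - r : ℕ) * (Real.log n + Real.log (1 + x) - Real.log 2) =
      n * Real.log n - n * Real.log 2 +
        n / 2 * ((1 + x) * Real.log (1 + x) + (1 - x) * Real.log (1 - x)) := by
    rw [hr, hs]; ring
  have er : (r : ℝ) + (n - r : ℕ) = n := by rw [hr, hs]; ring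
  have g1 := mul_le_mul_of_nonneg_left hE.1 (by positivity : (0:ℝ) ≤ n / 2)
  have g2 := mul_le_mul_of_nonneg_left hE.2 (by positivity : (0:ℝ) ≤ n / 2)
  rw [hc, abs_le]
  constructor
  · linarith [a1.1, a2.2, a3.2]
  · linarith [a1.2, a2.1, a3.1]

lemma alpha_bounds (L α : ℝ) (hL : 1 ≤ L) (hα : 0 < α)
    (h : 2 * α ^ 2 + Real.log α = 1 / 2 * L - 1 / 2 * Real.log L) :
    α ^ 2 ≤ L ∧ Real.log L - 2 * Real.log 4 ≤ 2 * Real.log α ∧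
      2 * Real.log α ≤ Real.log L := by
  have hL0 : 0 ≤ Real.log L := Real.log_nonneg hL
  have hlog2 : Real.log (α ^ 2) = 2 * Real.log α := by rw [Real.log_pow]; norm_num
  have A : α ^ 2 ≤ L := by
    by_contra hc
    push Not at hc
    have : 0 ≤ Real.log (α ^ 2) := Real.log_nonneg (by linarith)
    linarith
  refine ⟨A, ?_, ?_⟩
  · by_contra hc
    push Not at hc
    have h16 : Real.log (L / 16) = Real.log L - 2 * Real.log 4 := by
      rw [Real.log_div (by positivity) (by norm_num),
        show (16 : ℝ) = 4 ^ 2 by norm_num, Real.log_pow]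
      norm_num
    rw [← h16, ← hlog2] at hc
    have hlt := (Real.log_lt_log_iff (by positivity) (by positivity)).1 hc
    have := Real.log_le_sub_one_of_pos (by positivity : 0 < L / 4)
    have h4 : Real.log (L / 4) = Real.log L - Real.log 4 := by
      rw [Real.log_div (by positivity) (by norm_num)]
    have h4' : 0 < Real.log 4 := Real.log_pos (by norm_num)
    rw [hlog2, h16] at hc
    linarith
  · rw [← hlog2]
    exact Real.log_le_log (by positivity) A

set_option maxHeartbeats 1000000 in
/-- With `α = α(n) > 0` the unique positive real satisfying
`e^{2α²}·α = √n/√(log n)` and `r₀ = ⌊n/2 − α√n⌋`, the Hamming sphere size satisfies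
`C(n, r₀) = Θ(2^n (log n)/n)`. -/
theorem sphere_size_asymptotics :
    ∃ c C : ℝ, 0 < c ∧ 0 < C ∧ ∃ N : ℕ, ∀ n : ℕ, N ≤ n → ∀ α : ℝ, 0 < α →
      Real.exp (2 * α ^ 2) * α = Real.sqrt n / Real.sqrt (Real.log n) →
      c * 2 ^ n * Real.log n / n ≤ (n.choose ⌊(n : ℝ) / 2 - α * Real.sqrt n⌋₊ : ℝ) ∧
      (n.choose ⌊(n : ℝ) / 2 - α * Real.sqrt n⌋₊ : ℝ) ≤ C * 2 ^ n * Real.log n / n := by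
  obtain ⟨K, hK⟩ := log_choose_bound
  set D : ℝ := K + 2560 + 6 + Real.log 4 with hD
  refine ⟨Real.exp (-D), Real.exp D, Real.exp_pos _, Real.exp_pos _, 20000,
    fun n hn α hα h => ?_⟩
  have hnR : (20000 : ℝ) ≤ n := by exact_mod_cast hn
  have hn0 : (0 : ℝ) < n := by linarith
  set L := Real.log n with hLdef
  set s := Real.sqrt n with hsdef
  have hss : s ^ 2 = n := Real.sq_sqrt hn0.le
  have hs0 : 0 < s := Real.sqrt_pos.2 hn0
  have hs : 128 ≤ s := by
    rw [hsdef]; apply Real.le_sqrt_of_sq_le; linarith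
  have hLs : L ≤ 2 * s := by
    have : L = 2 * Real.log s := by rw [hLdef, ← hss, Real.log_pow]; norm_num
    linarith [Real.log_le_sub_one_of_pos hs0]
  have hL1 : 1 ≤ L := by
    rw [hLdef, Real.le_log_iff_exp_le hn0]
    linarith [Real.exp_one_lt_d9]
  have hlog : 2 * α ^ 2 + Real.log α = 1 / 2 * L - 1 / 2 * Real.log L := by
    have := congrArg Real.log h
    rw [Real.log_mul (Real.exp_pos _).ne' hα.ne', Real.log_exp,
      Real.log_div hs0.ne' (Real.sqrt_pos.2 (by linarith)).ne', hsdef,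
      Real.log_sqrt hn0.le, Real.log_sqrt (by linarith)] at this
    linarith
  obtain ⟨A1, A2, A3⟩ := alpha_bounds L α hL1 hα hlog
  -- bounds on the shift
  have ht0 : 0 < α * s := by positivity
  have ht : α * s ≤ n / 8 := by
    have : α ≤ s / 8 := by
      refine (pow_le_pow_iff_left₀ hα.le (by positivity) two_ne_zero).1 ?_
      nlinarith
    nlinarith
  set r := ⌊(n : ℝ) / 2 - α * s⌋₊ with hrdef
  have r1 : (r : ℝ) ≤ n / 2 - α * s := Nat.floor_le (by linarith)
  have r2 : (n : ℝ) / 2 - α * s < r + 1 := Nat.lt_floor_add_one _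
  obtain ⟨d, hd⟩ : ∃ d : ℝ, d = n / 2 - r := ⟨_, rfl⟩
  have d1 : α * s ≤ d := by linarith
  have d2 : d ≤ α * s + 1 := by linarith
  have hx := hK n r (by omega) (2 * d / n) (by have : 0 < d := by linarith
                                               positivity)
    (by rw [div_le_iff₀ hn0]; linarith) (by rw [hd]; field_simp; ring)
  have x2 : (n : ℝ) / 2 * (2 * d / n) ^ 2 = 2 * d ^ 2 / n := by field_simp
  have x4 : (n : ℝ) * (2 * d / n) ^ 4 = 16 * d ^ 4 / n ^ 3 := by field_simp; ring
  have m1 : 2 * α ^ 2 ≤ 2 * d ^ 2 / n := by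
    rw [le_div_iff₀ hn0, ← hss]
    nlinarith
  have m2 : 2 * d ^ 2 / n ≤ 2 * α ^ 2 + 6 := by
    rw [div_le_iff₀ hn0]
    have : d ^ 2 ≤ (α * s + 1) ^ 2 := by apply pow_le_pow_left₀ <;> linarith
    have e : (α * s + 1) ^ 2 = α ^ 2 * n + 2 * (α * s) + 1 := by rw [← hss]; ring
    nlinarith
  have m3 : 16 * d ^ 4 / n ^ 3 ≤ 1024 := by
    rw [div_le_iff₀ (by positivity)]
    have h1 : d ^ 2 ≤ (α * s + 1) ^ 2 := by apply pow_le_pow_left₀ <;> linarith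
    have e : (α * s + 1) ^ 2 ≤ 2 * (α ^ 2 * n) + 2 := by
      rw [← hss]; nlinarith [sq_nonneg (α * s - 1)]
    have h2 : α ^ 2 * n ≤ L * n := by gcongr
    have h0 : 1 * 1 ≤ L * n := by
      apply mul_le_mul hL1 _ (by norm_num) (by linarith)
      linarith
    have h3 : d ^ 2 ≤ 4 * (L * n) := by linarith
    have h4 : (d ^ 2) ^ 2 ≤ (4 * (L * n)) ^ 2 := by gcongr
    have h5 : L ^ 2 ≤ (2 * s) ^ 2 := by gcongr
    have h6 : L ^ 2 * n ^ 2 ≤ (2 * s) ^ 2 * n ^ 2 := by gcongr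
    have h7 : (2 * s) ^ 2 * (n : ℝ) ^ 2 = 4 * n ^ 3 := by rw [mul_pow, hss]; ring
    have h8 : (d ^ 2) ^ 2 = d ^ 4 := by ring
    have h9 : (4 * (L * n)) ^ 2 = 16 * (L ^ 2 * n ^ 2) := by ring
    linarith
  rw [x2, x4] at hx
  have hx := abs_le.1 hx
  have hrn : r ≤ n := by
    have : (r : ℝ) ≤ n := by linarith
    exact_mod_cast this
  have hCpos : (0 : ℝ) < n.choose r := by exact_mod_cast Nat.choose_pos hrn
  have hlog4 : 0 ≤ Real.log 4 := Real.log_nonneg (by norm_num)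
  have key : ∀ E : ℝ, Real.log (Real.exp E * 2 ^ n * L / n) =
      E + n * Real.log 2 + Real.log L - L := by
    intro E
    have : L ≠ 0 := by linarith
    rw [Real.log_div (by positivity) (by positivity), Real.log_mul (by positivity) this,
      Real.log_mul (by positivity) (by positivity), Real.log_exp, Real.log_pow]
  have hLpos : 0 < L := by linarith
  constructor
  · rw [← Real.log_le_log_iff (by positivity) hCpos, key]
    linarith [hx.1]
  · rw [← Real.log_le_log_iff hCpos (by positivity), key]
    linarith [hx.2]
end
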